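/- arXiv:0706.0699 — 3 statements merged into one kernel-verified Lean document; each statement's English description precedes it below -/
import Mathlib

section
/- Let u be a smooth solution to the special Lagrangian equation ∑_{i=1}^n arctan λᵢ(x) = c on an open set Ω ⊆ ℝⁿ, and let x₀ ∈ Ω be a point at which the Hessian D²u(x₀) is a diagonal matrix with diagonal entries λ₁,…,λₙ. Setting h_ijk = ∂ᵢ∂ⱼ∂ₖu(x₀) / √((1+λᵢ²)(1+λⱼ²)(1+λₖ²)), one has the formula Δ_g ln V (x₀) = ∑_{i,j,k=1}^n (1 + λᵢλⱼ) h_ijk². -/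
noncomputable section

/-- The Hessian matrix `D²u(x)`, with entries `∂ᵢ∂ⱼ u (x)`. -/
def Hess {n : ℕ} (u : EuclideanSpace ℝ (Fin n) → ℝ) (x : EuclideanSpace ℝ (Fin n)) :
    Matrix (Fin n) (Fin n) ℝ :=
  Matrix.of fun i j =>
    iteratedFDeriv ℝ 2 u x ![EuclideanSpace.single i 1, EuclideanSpace.single j 1]

/-- The induced metric `g = I + D²u · D²u` on the gradient graph `(x, ∇u(x))`. -/
def gMat {n : ℕ} (u : EuclideanSpace ℝ (Fin n) → ℝ) (x : EuclideanSpace ℝ (Fin n)) :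
    Matrix (Fin n) (Fin n) ℝ :=
  1 + Hess u x * Hess u x

/-- The Laplace–Beltrami operator `Δ_g v = ∑ g^{ij} ∂ᵢ∂ⱼ v` of the induced metric. -/
def lapg {n : ℕ} (u v : EuclideanSpace ℝ (Fin n) → ℝ) (x : EuclideanSpace ℝ (Fin n)) : ℝ :=
  ∑ i, ∑ j, (gMat u x)⁻¹ i j *
    iteratedFDeriv ℝ 2 v x ![EuclideanSpace.single i 1, EuclideanSpace.single j 1]

/-- The squared metric gradient norm `|∇_g v|²_g = ∑ g^{ij} ∂ᵢv ∂ⱼv`. -/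
def gradSq {n : ℕ} (u v : EuclideanSpace ℝ (Fin n) → ℝ) (x : EuclideanSpace ℝ (Fin n)) : ℝ :=
  ∑ i, ∑ j, (gMat u x)⁻¹ i j * fderiv ℝ v x (EuclideanSpace.single i 1) *
    fderiv ℝ v x (EuclideanSpace.single j 1)

/-- The volume element `V = √(det g)`. -/
def Vol {n : ℕ} (u : EuclideanSpace ℝ (Fin n) → ℝ) (x : EuclideanSpace ℝ (Fin n)) : ℝ :=
  Real.sqrt ((gMat u x).det)

end
open Matrix Filter Topology

/-- Jacobi's formula for the derivative of a determinant along a curve. -/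
lemma hasDerivAt_det_aux {n : ℕ} {A : ℝ → Matrix (Fin n) (Fin n) ℂ}
    {A' : Matrix (Fin n) (Fin n) ℂ} {t : ℝ}
    (h : ∀ i j, HasDerivAt (fun s => A s i j) (A' i j) t) :
    HasDerivAt (fun s => (A s).det) (((A t).adjugate * A').trace) t := by
  have h1 : HasDerivAt (fun s => ∑ σ : Equiv.Perm (Fin n),
      (((Equiv.Perm.sign σ : ℤˣ) : ℤ) : ℂ) * ∏ i, A s (σ i) i)
      (∑ σ : Equiv.Perm (Fin n), (((Equiv.Perm.sign σ : ℤˣ) : ℤ) : ℂ) *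
        ∑ i, (∏ j ∈ Finset.univ.erase i, A t (σ j) j) • A' (σ i) i) t := by
    refine HasDerivAt.fun_sum fun σ _ => ?_
    refine HasDerivAt.const_mul _ ?_
    exact HasDerivAt.fun_finsetProd fun i _ => h (σ i) i
  simp_rw [Matrix.det_apply']
  convert h1 using 1
  have h2 : ((A t).adjugate * A').trace = ∑ i, ((A t).updateCol i (fun j => A' j i)).det := by
    simp only [Matrix.trace, Matrix.diag]
    refine Finset.sum_congr rfl fun i _ => ?_
    rw [← Matrix.cramer_apply, Matrix.cramer_eq_adjugate_mulVec]
    rfl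
  rw [h2]
  simp_rw [Matrix.det_apply', Finset.mul_sum]
  rw [Finset.sum_comm]
  refine Finset.sum_congr rfl fun σ _ => Finset.sum_congr rfl fun i _ => ?_
  congr 1
  rw [← Finset.mul_prod_erase _ _ (Finset.mem_univ i), mul_comm, smul_eq_mul]
  congr 1
  · refine Finset.prod_congr rfl fun j hj => ?_
    rw [Matrix.updateCol_ne (Finset.ne_of_mem_erase hj)]
  · simp

/-- Derivative of the inverse matrix at a point where the matrix is diagonal. -/
lemma hasDerivAt_inv_aux {n : ℕ} {A : ℝ → Matrix (Fin n) (Fin n) ℂ}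
    {A' : Matrix (Fin n) (Fin n) ℂ} {a : Fin n → ℂ}
    (h : ∀ i j, HasDerivAt (fun s => A s i j) (A' i j) 0)
    (hA : A 0 = diagonal a) (ha : ∀ i, a i ≠ 0)
    (hdet : ∀ᶠ t in 𝓝 (0:ℝ), (A t).det ≠ 0) (i j : Fin n) :
    HasDerivAt (fun s => (A s)⁻¹ i j) (-((a i)⁻¹ * A' i j * (a j)⁻¹)) 0 := by
  have hinv0 : (A 0)⁻¹ = diagonal (fun i => (a i)⁻¹) := by
    rw [hA]
    apply Matrix.inv_eq_right_inv
    rw [Matrix.diagonal_mul_diagonal, ← Matrix.diagonal_one]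
    congr 1; ext i; exact mul_inv_cancel₀ (ha i)
  have hdiff : ∀ i j, DifferentiableAt ℝ (fun s => (A s)⁻¹ i j) 0 := by
    intro i j
    have e : (fun s => (A s)⁻¹ i j) =
        fun s => ((A s).det)⁻¹ * ((A s).updateRow j (Pi.single i 1)).det := by
      ext s
      rw [Matrix.inv_def, Matrix.smul_apply, Matrix.adjugate_apply, Ring.inverse_eq_inv',
        smul_eq_mul]
    rw [e]
    have d1 := (hasDerivAt_det_aux h).differentiableAt
    have d2 : DifferentiableAt ℝ (fun s => ((A s).updateRow j (Pi.single i 1)).det) 0 := by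
      refine (hasDerivAt_det_aux (A' := A'.updateRow j 0) fun p q => ?_).differentiableAt
      by_cases hp : p = j
      · subst hp; simpa using hasDerivAt_const (0:ℝ) _
      · simpa [Matrix.updateRow_ne hp] using h p q
    exact (d1.inv hdet.self_of_nhds).mul d2
  have key : HasDerivAt (fun s => ∑ k, (A s)⁻¹ i k * A s k j)
      (∑ k, (deriv (fun s => (A s)⁻¹ i k) 0 * A 0 k j + (A 0)⁻¹ i k * A' k j)) 0 :=
    HasDerivAt.fun_sum fun k _ => (hdiff i k).hasDerivAt.mul (h k j)
  have key2 : HasDerivAt (fun s => ∑ k, (A s)⁻¹ i k * A s k j) 0 0 := by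
    refine (hasDerivAt_const (0:ℝ) ((1 : Matrix (Fin n) (Fin n) ℂ) i j)).congr_of_eventuallyEq ?_
    filter_upwards [hdet] with s hs
    rw [← Matrix.mul_apply, Matrix.nonsing_inv_mul _ (isUnit_iff_ne_zero.2 hs)]
  have e := key.unique key2
  rw [Finset.sum_add_distrib, hinv0, hA] at e
  simp only [Matrix.diagonal_apply, mul_ite, mul_zero, ite_mul, zero_mul, Finset.sum_ite_eq,
    Finset.sum_ite_eq', Finset.mem_univ, if_true] at e
  have e' : deriv (fun s => (A s)⁻¹ i j) 0 = -((a i)⁻¹ * A' i j * (a j)⁻¹) := by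
    rw [← neg_mul, eq_mul_inv_iff_mul_eq₀ (ha j)]
    linear_combination e
  rw [← e']
  exact (hdiff i j).hasDerivAt

/-- One-variable computation: second derivative of the logarithm of the phase-normalised
determinant. -/
lemma second_deriv_log {n : ℕ} {M M1 : ℝ → Matrix (Fin n) (Fin n) ℝ}
    {M2 : Matrix (Fin n) (Fin n) ℝ} {v L L1 : ℝ → ℝ} {L2 : ℝ} {w : ℂ} {lam : Fin n → ℝ}
    (hw : w ≠ 0)
    (hM : ∀ᶠ t in 𝓝 (0:ℝ), ∀ i j, HasDerivAt (fun s => M s i j) (M1 t i j) t)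
    (hM1 : ∀ i j, HasDerivAt (fun s => M1 s i j) (M2 i j) 0)
    (hM0 : M 0 = diagonal lam)
    (hv : ∀ᶠ t in 𝓝 (0:ℝ), 0 < v t)
    (hL : ∀ t, L t = Real.log (v t))
    (hdet : ∀ᶠ t in 𝓝 (0:ℝ),
      (1 + Complex.I • (M t).map (algebraMap ℝ ℂ) : Matrix (Fin n) (Fin n) ℂ).det = v t * w)
    (hL1 : ∀ᶠ t in 𝓝 (0:ℝ), HasDerivAt L (L1 t) t)
    (hL2 : HasDerivAt L1 L2 0) :
    (L2 : ℂ) = ∑ p, ∑ q, (1 + Complex.I * lam p)⁻¹ * (1 + Complex.I * lam q)⁻¹ *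
        (M1 0 p q * M1 0 q p : ℝ) + Complex.I * ∑ p, (1 + Complex.I * lam p)⁻¹ * (M2 p p : ℂ) := by
  set A : ℝ → Matrix (Fin n) (Fin n) ℂ := fun t => 1 + Complex.I • (M t).map (algebraMap ℝ ℂ)
    with hAdef
  set A1 : ℝ → Matrix (Fin n) (Fin n) ℂ := fun t => Complex.I • (M1 t).map (algebraMap ℝ ℂ)
    with hA1def
  set A2 : Matrix (Fin n) (Fin n) ℂ := Complex.I • M2.map (algebraMap ℝ ℂ) with hA2def
  have hA : ∀ᶠ t in 𝓝 (0:ℝ), ∀ i j, HasDerivAt (fun s => A s i j) (A1 t i j) t := by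
    filter_upwards [hM] with t ht i j
    have := ((ht i j).ofReal_comp.const_mul Complex.I).const_add
      ((1 : Matrix (Fin n) (Fin n) ℂ) i j)
    simpa [hAdef, hA1def] using this
  have hA1 : ∀ i j, HasDerivAt (fun s => A1 s i j) (A2 i j) 0 := by
    intro i j
    simpa [hA1def, hA2def] using ((hM1 i j).ofReal_comp.const_mul Complex.I)
  have hdet0 : ∀ᶠ t in 𝓝 (0:ℝ), (A t).det ≠ 0 := by
    filter_upwards [hv, hdet] with t h1 h2
    rw [h2]
    exact mul_ne_zero (by exact_mod_cast h1.ne') hw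
  set a : Fin n → ℂ := fun p => 1 + Complex.I * lam p with hadef
  have ha : ∀ p, a p ≠ 0 := by
    intro p h
    have := congrArg Complex.re h
    simp [hadef] at this
  have hA0 : A 0 = diagonal a := by
    ext i j
    by_cases hij : i = j
    · subst hij; simp [hAdef, hM0, hadef]
    · simp [hAdef, hM0, hadef, hij]
  have hL1' : ∀ᶠ t in 𝓝 (0:ℝ), (L1 t : ℂ) = ∑ i, ∑ j, (A t)⁻¹ i j * A1 t j i := by
    filter_upwards [hA, hdet0, hdet.eventually_nhds, hv.eventually_nhds, hL1] with t h1 h2 h3 h4 h5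
    have d1 : HasDerivAt (fun s => (A s).det) ((v t * L1 t : ℝ) * w) t := by
      have : HasDerivAt (fun s => Real.exp (L s)) (Real.exp (L t) * L1 t) t := h5.exp
      have hvt : Real.exp (L t) = v t := by rw [hL, Real.exp_log h4.self_of_nhds]
      rw [hvt] at this
      refine (this.ofReal_comp.mul_const w).congr_of_eventuallyEq ?_
      filter_upwards [h3, h4] with s hs hs'
      rw [hL, Real.exp_log hs', hs]
    have e := d1.unique (hasDerivAt_det_aux h1)
    have e3 := h3.self_of_nhds
    have : ((A t).adjugate * A1 t).trace = (A t).det * ∑ i, ∑ j, (A t)⁻¹ i j * A1 t j i := by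
      simp only [Matrix.trace, Matrix.diag, Matrix.mul_apply, Finset.mul_sum]
      refine Finset.sum_congr rfl fun i _ => Finset.sum_congr rfl fun j _ => ?_
      rw [Matrix.inv_def, Matrix.smul_apply, Ring.inverse_eq_inv', smul_eq_mul]
      field_simp
    rw [this] at e
    apply mul_left_cancel₀ h2
    rw [← e]
    change (A t).det = _ at e3
    rw [e3]; push_cast; ring
  have d2 : HasDerivAt (fun t => ((L1 t : ℝ) : ℂ))
      (∑ i, ∑ j, (-((a i)⁻¹ * A1 0 i j * (a j)⁻¹) * A1 0 j i + (A 0)⁻¹ i j * A2 j i)) 0 := by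
    refine HasDerivAt.congr_of_eventuallyEq ?_ hL1'
    refine HasDerivAt.fun_sum fun i _ => HasDerivAt.fun_sum fun j _ => ?_
    exact (hasDerivAt_inv_aux hA.self_of_nhds hA0 ha hdet0 i j).mul (hA1 j i)
  have e := hL2.ofReal_comp.unique d2
  rw [e]
  have hinv0 : (A 0)⁻¹ = diagonal (fun i => (a i)⁻¹) := by
    rw [hA0]
    apply Matrix.inv_eq_right_inv
    rw [Matrix.diagonal_mul_diagonal, ← Matrix.diagonal_one]
    congr 1; ext i; exact mul_inv_cancel₀ (ha i)
  simp only [Finset.sum_add_distrib]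
  congr 1
  · refine Finset.sum_congr rfl fun i _ => Finset.sum_congr rfl fun j _ => ?_
    simp only [hA1def, Matrix.smul_apply, Matrix.map_apply, smul_eq_mul, Complex.coe_algebraMap]
    push_cast
    linear_combination (-(a i)⁻¹ * (a j)⁻¹ * (M1 0 i j) * (M1 0 j i)) * Complex.I_sq
  · rw [hinv0, Finset.mul_sum]
    refine Finset.sum_congr rfl fun i _ => ?_
    simp only [Matrix.diagonal_apply, ite_mul, zero_mul, Finset.sum_ite_eq, Finset.mem_univ,
      if_true, hA2def, Matrix.smul_apply, Matrix.map_apply, smul_eq_mul, Complex.coe_algebraMap]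
    ring

lemma one_add_I_mul (x : ℝ) : (1 + Complex.I * x : ℂ) =
    (Real.sqrt (1 + x ^ 2) : ℝ) * Complex.exp (Complex.I * (Real.arctan x : ℝ)) := by
  have h : Real.sqrt (1 + x ^ 2) ≠ 0 := by positivity
  rw [mul_comm Complex.I ((Real.arctan x : ℝ) : ℂ), Complex.exp_mul_I, ← Complex.ofReal_cos,
    ← Complex.ofReal_sin, Real.cos_arctan, Real.sin_arctan]
  push_cast
  have : ((Real.sqrt (1 + x ^ 2) : ℝ) : ℂ) ≠ 0 := by exact_mod_cast h
  field_simp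

lemma det_one_add_smul {n : ℕ} {H : Matrix (Fin n) (Fin n) ℝ} (hH : H.IsHermitian) (z : ℂ)
    (hz : z ≠ 0) :
    (1 + z • H.map (algebraMap ℝ ℂ) : Matrix (Fin n) (Fin n) ℂ).det =
      ∏ i, (1 + z * (hH.eigenvalues i : ℝ)) := by
  have h1 : (1 + z • H.map (algebraMap ℝ ℂ) : Matrix (Fin n) (Fin n) ℂ) =
      (-z) • (Matrix.scalar (Fin n) (-z⁻¹) - H.map (algebraMap ℝ ℂ)) := by
    ext i j
    by_cases hij : i = j
    · subst hij; simp; field_simp; ring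
    · simp [hij]
  rw [h1, Matrix.det_smul, ← Matrix.eval_charpoly, Matrix.charpoly_map, hH.charpoly_eq,
    Polynomial.map_prod, Polynomial.eval_prod, Finset.card_univ.symm, ← Finset.prod_const,
    ← Finset.prod_mul_distrib]
  refine Finset.prod_congr rfl fun i _ => ?_
  simp
  field_simp
  ring

lemma det_one_add_sq {n : ℕ} {H : Matrix (Fin n) (Fin n) ℝ} (hH : H.IsHermitian) :
    (1 + H * H).det = ∏ i, (1 + hH.eigenvalues i ^ 2) := by
  have h1 := det_one_add_smul hH Complex.I Complex.I_ne_zero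
  have h2 := det_one_add_smul hH (-Complex.I) (neg_ne_zero.2 Complex.I_ne_zero)
  have h3 : (1 + Complex.I • H.map (algebraMap ℝ ℂ) : Matrix (Fin n) (Fin n) ℂ) *
      (1 + (-Complex.I) • H.map (algebraMap ℝ ℂ)) = (1 + H * H).map (algebraMap ℝ ℂ) := by
    rw [Matrix.map_add _ (by simp), Matrix.map_one _ (by simp) (by simp), Matrix.map_mul,
      mul_add, add_mul, add_mul]
    simp only [one_mul, mul_one, Matrix.smul_mul, Matrix.mul_smul, smul_smul]
    simp
  have h4 : (((1 + H * H).det : ℝ) : ℂ) = ((∏ i, (1 + hH.eigenvalues i ^ 2) : ℝ) : ℂ) := by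
    have := congrArg Matrix.det h3
    rw [Matrix.det_mul, h1, h2, ← Finset.prod_mul_distrib] at this
    have h5 : ((1 + H * H).map (algebraMap ℝ ℂ)).det = (((1 + H * H).det : ℝ) : ℂ) :=
      ((algebraMap ℝ ℂ).map_det (1 + H * H)).symm
    rw [← h5, ← this]
    push_cast
    refine Finset.prod_congr rfl fun i _ => ?_
    linear_combination (-(hH.eigenvalues i : ℂ) ^ 2) * Complex.I_sq
  exact_mod_cast h4

lemma det_phase {n : ℕ} {H : Matrix (Fin n) (Fin n) ℝ} (hH : H.IsHermitian) :
    (1 + Complex.I • H.map (algebraMap ℝ ℂ) : Matrix (Fin n) (Fin n) ℂ).det =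
      (Real.sqrt ((1 + H * H).det) : ℝ) *
        Complex.exp (Complex.I * (∑ i, Real.arctan (hH.eigenvalues i) : ℝ)) := by
  rw [det_one_add_smul hH _ Complex.I_ne_zero, det_one_add_sq hH,
    Real.sqrt_prod _ (fun i _ => by positivity)]
  simp_rw [one_add_I_mul]
  push_cast
  rw [Finset.mul_sum, Complex.exp_sum, Finset.prod_mul_distrib]

lemma hasDerivAt_line {n : ℕ} {f : EuclideanSpace ℝ (Fin n) → ℝ} {k : ℕ}
    {x e : EuclideanSpace ℝ (Fin n)} {t : ℝ} (m : Fin k → EuclideanSpace ℝ (Fin n))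
    (m' : Fin (k + 1) → EuclideanSpace ℝ (Fin n))
    (hm : m' = Fin.cons e m)
    (hf : ContDiffAt ℝ (k + 1 : ℕ) f (x + t • e)) :
    HasDerivAt (fun s : ℝ => iteratedFDeriv ℝ k f (x + s • e) m)
      (iteratedFDeriv ℝ (k + 1) f (x + t • e) m') t := by
  have h1 : DifferentiableAt ℝ (iteratedFDeriv ℝ k f) (x + t • e) :=
    (hf.iteratedFDeriv_right (m := 1) (i := k) (by norm_cast; omega)).differentiableAt (by simp)
  have h2 : HasDerivAt (fun s : ℝ => x + s • e) e t := by
    simpa using ((hasDerivAt_id t).smul_const e).const_add x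
  have h3 := h1.hasFDerivAt.comp_hasDerivAt t h2
  have h4 := ((ContinuousMultilinearMap.apply ℝ (fun _ : Fin k => EuclideanSpace ℝ (Fin n)) ℝ m).hasFDerivAt
    (x := iteratedFDeriv ℝ k f (x + t • e))).comp_hasDerivAt t h3
  rw [iteratedFDeriv_succ_apply_left, hm]
  simpa [Function.comp_def] using h4

lemma iter_congr {n : ℕ} {f : EuclideanSpace ℝ (Fin n) → ℝ} {k : ℕ}
    {x : EuclideanSpace ℝ (Fin n)} (e : EuclideanSpace ℝ (Fin n))
    (m₁ m₂ : Fin k → EuclideanSpace ℝ (Fin n))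
    (hf : ContDiffAt ℝ (k + 1 : ℕ) f x)
    (h : ∀ᶠ y in 𝓝 x, iteratedFDeriv ℝ k f y m₁ = iteratedFDeriv ℝ k f y m₂) :
    iteratedFDeriv ℝ (k + 1) f x (Fin.cons e m₁) = iteratedFDeriv ℝ (k + 1) f x (Fin.cons e m₂) := by
  have hx : x + (0:ℝ) • e = x := by simp
  have h1 := hasDerivAt_line (t := 0) (e := e) m₁ _ rfl (hx.symm ▸ hf)
  have h2 := hasDerivAt_line (t := 0) (e := e) m₂ _ rfl (hx.symm ▸ hf)
  rw [hx] at h1 h2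
  refine h1.unique (h2.congr_of_eventuallyEq ?_)
  have hc : Tendsto (fun s : ℝ => x + s • e) (𝓝 0) (𝓝 x) := by
    have : Continuous (fun s : ℝ => x + s • e) := by fun_prop
    simpa using this.tendsto 0
  exact hc.eventually h

lemma iter_swap {n : ℕ} {f : EuclideanSpace ℝ (Fin n) → ℝ} {k : ℕ}
    {x : EuclideanSpace ℝ (Fin n)} (a b : EuclideanSpace ℝ (Fin n))
    (m : Fin k → EuclideanSpace ℝ (Fin n))
    (hf : ContDiffAt ℝ (k + 2 : ℕ) f x) :
    iteratedFDeriv ℝ (k + 2) f x (Fin.cons a (Fin.cons b m : Fin (k + 1) → _)) =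
      iteratedFDeriv ℝ (k + 2) f x (Fin.cons b (Fin.cons a m : Fin (k + 1) → _)) := by
  have hF : ContDiffAt ℝ 2 (iteratedFDeriv ℝ k f) x :=
    hf.iteratedFDeriv_right (by norm_cast; omega)
  have hsymm : IsSymmSndFDerivAt ℝ (iteratedFDeriv ℝ k f) x :=
    hF.isSymmSndFDerivAt (by simp)
  have key : ∀ a b : EuclideanSpace ℝ (Fin n),
      iteratedFDeriv ℝ (k + 2) f x (Fin.cons a (Fin.cons b m : Fin (k + 1) → _)) =
        fderiv ℝ (fderiv ℝ (iteratedFDeriv ℝ k f)) x a b m := by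
    intro a b
    have hx : x + (0:ℝ) • a = x := by simp
    have h1 := hasDerivAt_line (t := 0) (e := a) (Fin.cons b m : Fin (k + 1) → _) _ rfl
      (hx.symm ▸ hf)
    rw [hx] at h1
    have h2 : HasDerivAt (fun s : ℝ => x + s • a) a 0 := by
      simpa using ((hasDerivAt_id (0:ℝ)).smul_const a).const_add x
    have hd : DifferentiableAt ℝ (fderiv ℝ (iteratedFDeriv ℝ k f)) (x + (0:ℝ) • a) := by
      rw [hx]
      exact (hF.fderiv_right (m := 1) (by norm_num)).differentiableAt (by simp)
    have h3 := HasFDerivAt.comp_hasDerivAt (l := fderiv ℝ (iteratedFDeriv ℝ k f))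
      (f := fun s : ℝ => x + s • a) (0:ℝ) hd.hasFDerivAt h2
    have h4 := h3.clm_apply (hasDerivAt_const (0:ℝ) b)
    have h5 := ((ContinuousMultilinearMap.apply ℝ (fun _ : Fin k => EuclideanSpace ℝ (Fin n)) ℝ
      m).hasFDerivAt (x := fderiv ℝ (iteratedFDeriv ℝ k f) (x + (0:ℝ) • a) b)).comp_hasDerivAt
        (0:ℝ) h4
    refine h1.unique ?_
    simp_rw [iteratedFDeriv_succ_apply_left]
    simpa [Function.comp_def, hx] using h5
  rw [key, key, hsymm.eq]

lemma real_parts {n : ℕ} {lam : Fin n → ℝ} {S : Fin n → Fin n → ℝ} {T : Fin n → ℝ} {L2 : ℝ}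
    (h : (L2 : ℂ) = ∑ p, ∑ q, (1 + Complex.I * lam p)⁻¹ * (1 + Complex.I * lam q)⁻¹ *
        (S p q : ℝ) + Complex.I * ∑ p, (1 + Complex.I * lam p)⁻¹ * (T p : ℂ)) :
    L2 = ∑ p, ∑ q, (1 - lam p * lam q) * ((1 + lam p ^ 2)⁻¹ * (1 + lam q ^ 2)⁻¹ * S p q) +
        ∑ p, lam p * (1 + lam p ^ 2)⁻¹ * T p ∧
    ∑ p, (1 + lam p ^ 2)⁻¹ * T p =
      ∑ p, ∑ q, (lam p + lam q) * ((1 + lam p ^ 2)⁻¹ * (1 + lam q ^ 2)⁻¹ * S p q) := by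
  have hinv : ∀ x : ℝ, (1 + Complex.I * x : ℂ)⁻¹ =
      (((1 + x ^ 2)⁻¹ : ℝ) : ℂ) - Complex.I * ((x * (1 + x ^ 2)⁻¹ : ℝ) : ℂ) := by
    intro x
    have hx : ((1 + x ^ 2 : ℝ) : ℂ) ≠ 0 := by
      exact_mod_cast (by positivity : (1 + x ^ 2 : ℝ) ≠ 0)
    apply inv_eq_of_mul_eq_one_right
    push_cast at hx ⊢
    field_simp
    linear_combination (-(x:ℂ) ^ 2) * Complex.I_sq
  simp_rw [hinv] at h
  have hre := congrArg Complex.re h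
  have him := congrArg Complex.im h
  simp only [Complex.add_re, Complex.add_im, Complex.re_sum, Complex.im_sum, Complex.mul_re,
    Complex.mul_im, Complex.sub_re, Complex.sub_im, Complex.ofReal_re, Complex.ofReal_im,
    Complex.I_re, Complex.I_im, mul_zero, zero_mul, one_mul, zero_add, add_zero, sub_zero,
    zero_sub] at hre him
  constructor
  · rw [hre]
    congr 1
    · refine Finset.sum_congr rfl fun p _ => Finset.sum_congr rfl fun q _ => ?_
      ring
    · rw [← Finset.sum_neg_distrib]
      refine Finset.sum_congr rfl fun p _ => ?_
      ring
  · rw [← sub_eq_iff_eq_add', zero_sub,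
      ← Finset.sum_neg_distrib] at him
    refine Eq.trans ?_ (him.symm.trans ?_)
    · refine Finset.sum_congr rfl fun p _ => ?_
      ring
    · refine Finset.sum_congr rfl fun p _ => ?_
      rw [← Finset.sum_neg_distrib]
      refine Finset.sum_congr rfl fun q _ => ?_
      ring

/-- The final summation by symmetry. -/
lemma final_sum {n : ℕ} (lam G : Fin n → ℝ) (U : Fin n → Fin n → Fin n → ℝ)
    (T : Fin n → Fin n → ℝ) (L2 : Fin n → ℝ)
    (hU1 : ∀ i j k, U i j k = U j i k) (hU2 : ∀ i j k, U i j k = U i k j)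
    (hT : ∀ i j, T i j = T j i)
    (h1 : ∀ j, L2 j = ∑ p, ∑ q, (1 - lam p * lam q) * (G p * G q * (U j p q * U j q p)) +
        ∑ p, lam p * G p * T j p)
    (h2 : ∀ j, ∑ p, G p * T j p = ∑ p, ∑ q, (lam p + lam q) * (G p * G q * (U j p q * U j q p))) :
    ∑ j, G j * L2 j = ∑ i, ∑ j, ∑ k, (1 + lam i * lam j) * (U i j k ^ 2 * (G i * G j * G k)) := by
  have e1 : ∑ j, G j * ∑ p, lam p * G p * T j p =
      ∑ j, lam j * G j * ∑ p, G p * T j p := by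
    simp_rw [Finset.mul_sum]
    rw [Finset.sum_comm]
    refine Finset.sum_congr rfl fun i _ => Finset.sum_congr rfl fun j _ => ?_
    rw [hT j i]; ring
  simp_rw [h1, mul_add, Finset.sum_add_distrib]
  rw [e1]
  simp_rw [h2]
  set W : Fin n → Fin n → Fin n → ℝ := fun i j k => U i j k ^ 2 * (G i * G j * G k) with hW
  have W1 : ∀ i j k, W i j k = W j i k := fun i j k => by simp only [hW]; rw [hU1 i j k]; ring
  have W2 : ∀ i j k, W i j k = W i k j := fun i j k => by simp only [hW]; rw [hU2 i j k]; ring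
  have a1 : ∑ j, G j * ∑ p, ∑ q, (1 - lam p * lam q) * (G p * G q * (U j p q * U j q p)) =
      ∑ j, ∑ p, ∑ q, (W j p q - lam p * lam q * W j p q) := by
    simp_rw [Finset.mul_sum]
    refine Finset.sum_congr rfl fun j _ => Finset.sum_congr rfl fun p _ =>
      Finset.sum_congr rfl fun q _ => ?_
    simp only [hW]; rw [hU2 j q p]; ring
  have a2 : ∑ j, lam j * G j * ∑ p, ∑ q, (lam p + lam q) * (G p * G q * (U j p q * U j q p)) =
      ∑ j, ∑ p, ∑ q, (lam j * lam p * W j p q + lam j * lam q * W j p q) := by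
    simp_rw [Finset.mul_sum]
    refine Finset.sum_congr rfl fun j _ => Finset.sum_congr rfl fun p _ =>
      Finset.sum_congr rfl fun q _ => ?_
    simp only [hW]; rw [hU2 j q p]; ring
  have a3 : ∑ i, ∑ j, ∑ k, (1 + lam i * lam j) * W i j k =
      ∑ j, ∑ p, ∑ q, (W j p q + lam j * lam p * W j p q) := by
    refine Finset.sum_congr rfl fun j _ => Finset.sum_congr rfl fun p _ =>
      Finset.sum_congr rfl fun q _ => ?_
    ring
  have b1 : ∑ j, ∑ p, ∑ q, lam j * lam q * W j p q = ∑ j, ∑ p, ∑ q, lam p * lam q * W j p q := by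
    rw [Finset.sum_comm]
    refine Finset.sum_congr rfl fun j _ => Finset.sum_congr rfl fun p _ =>
      Finset.sum_congr rfl fun q _ => ?_
    rw [W1 p j q]
  rw [a1, a2, a3]
  simp only [Finset.sum_add_distrib, Finset.sum_sub_distrib]
  rw [b1]; ring

/-- The Simons-type formula `Δ_g ln V = ∑ (1 + λᵢλⱼ) h_ijk²` at a point where
the Hessian is diagonal (formula (2.4)). -/
theorem stmt_4 {n : ℕ} (hn : 2 ≤ n) (Ω : Set (EuclideanSpace ℝ (Fin n))) (hΩ : IsOpen Ω)
    (u : EuclideanSpace ℝ (Fin n) → ℝ) (c : ℝ)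
    (hu : ContDiffOn ℝ (⊤ : ℕ∞) u Ω)
    (hsym : ∀ x ∈ Ω, (Hess u x).IsHermitian)
    (hsol : ∀ x, ∀ hx : x ∈ Ω, ∑ i, Real.arctan ((hsym x hx).eigenvalues i) = c)
    (x₀ : EuclideanSpace ℝ (Fin n)) (hx₀ : x₀ ∈ Ω)
    (lam : Fin n → ℝ) (hdiag : Hess u x₀ = Matrix.diagonal lam) :
    lapg u (fun y => Real.log (Vol u y)) x₀ =
      ∑ i, ∑ j, ∑ k, (1 + lam i * lam j) *
        (iteratedFDeriv ℝ 3 u x₀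
            ![EuclideanSpace.single i 1, EuclideanSpace.single j 1,
              EuclideanSpace.single k 1] /
          Real.sqrt ((1 + lam i ^ 2) * (1 + lam j ^ 2) * (1 + lam k ^ 2))) ^ 2 := by
  have hC : ∀ y ∈ Ω, ∀ m : ℕ, ContDiffAt ℝ m u y := fun y hy m =>
    (hu.contDiffAt (hΩ.mem_nhds hy)).of_le (by exact_mod_cast le_top)
  have hnear : ∀ᶠ y in 𝓝 x₀, y ∈ Ω := hΩ.mem_nhds hx₀
  -- abbreviations
  set e : Fin n → EuclideanSpace ℝ (Fin n) := fun i => EuclideanSpace.single i 1 with he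
  set v : EuclideanSpace ℝ (Fin n) → ℝ := fun y => Real.log (Vol u y) with hv
  -- positivity of the determinant
  have hdetpos : ∀ y ∈ Ω, 0 < (gMat u y).det := by
    intro y hy
    rw [gMat, det_one_add_sq (hsym y hy)]
    exact Finset.prod_pos fun i _ => by positivity
  have hVpos : ∀ y ∈ Ω, 0 < Vol u y := fun y hy => Real.sqrt_pos.2 (hdetpos y hy)
  have hphase : ∀ y ∈ Ω, (1 + Complex.I • (Hess u y).map (algebraMap ℝ ℂ) :
      Matrix (Fin n) (Fin n) ℂ).det = (Vol u y : ℝ) * Complex.exp (Complex.I * (c : ℝ)) := by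
    intro y hy
    rw [det_phase (hsym y hy), hsol y hy]
    rfl
  -- smoothness of log V
  have hHess : ∀ y ∈ Ω, ∀ i j, ContDiffAt ℝ 2 (fun z => Hess u z i j) y := by
    intro y hy i j
    have h1 : ContDiffAt ℝ 2 (iteratedFDeriv ℝ 2 u) y :=
      (hC y hy 4).iteratedFDeriv_right (by norm_num)
    exact (ContinuousMultilinearMap.apply ℝ (fun _ : Fin 2 => EuclideanSpace ℝ (Fin n)) ℝ
      ![e i, e j]).contDiff.contDiffAt.comp y h1
  have hvC : ∀ y ∈ Ω, ContDiffAt ℝ 2 v y := by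
    intro y hy
    have hd : ContDiffAt ℝ 2 (fun z => (gMat u z).det) y := by
      simp_rw [Matrix.det_apply']
      refine ContDiffAt.sum fun σ _ => contDiffAt_const.mul ?_
      refine contDiffAt_prod fun i _ => ?_
      simp only [gMat, Matrix.add_apply, Matrix.mul_apply]
      refine contDiffAt_const.add ?_
      exact ContDiffAt.sum fun k _ => (hHess y hy _ _).mul (hHess y hy _ _)
    exact (hd.sqrt (hdetpos y hy).ne').log (hVpos y hy).ne'
  -- symmetries
  have swap3 : ∀ y ∈ Ω, ∀ a b d : EuclideanSpace ℝ (Fin n),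
      iteratedFDeriv ℝ 3 u y ![a, b, d] = iteratedFDeriv ℝ 3 u y ![b, a, d] := fun y hy a b d =>
    iter_swap a b ![d] (hC y hy 3)
  have swap3' : ∀ y ∈ Ω, ∀ a b d : EuclideanSpace ℝ (Fin n),
      iteratedFDeriv ℝ 3 u y ![a, b, d] = iteratedFDeriv ℝ 3 u y ![a, d, b] := fun y hy a b d => by
    refine iter_congr a ![b, d] ![d, b] (hC y hy 3) ?_
    filter_upwards [hΩ.mem_nhds hy] with z hz
    exact iter_swap b d ![] (hC z hz 2)
  have symm4 : ∀ a b : EuclideanSpace ℝ (Fin n),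
      iteratedFDeriv ℝ 4 u x₀ ![a, a, b, b] = iteratedFDeriv ℝ 4 u x₀ ![b, b, a, a] := by
    intro a b
    have s1 : iteratedFDeriv ℝ 4 u x₀ ![a, a, b, b] = iteratedFDeriv ℝ 4 u x₀ ![a, b, a, b] :=
      iter_congr a ![a, b, b] ![b, a, b] (hC x₀ hx₀ 4) (hnear.mono fun y hy => swap3 y hy _ _ _)
    have s2 : iteratedFDeriv ℝ 4 u x₀ ![a, b, a, b] = iteratedFDeriv ℝ 4 u x₀ ![b, a, a, b] :=
      iter_swap a b ![a, b] (hC x₀ hx₀ 4)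
    have s3 : iteratedFDeriv ℝ 4 u x₀ ![b, a, a, b] = iteratedFDeriv ℝ 4 u x₀ ![b, a, b, a] :=
      iter_congr b ![a, a, b] ![a, b, a] (hC x₀ hx₀ 4) (hnear.mono fun y hy => swap3' y hy _ _ _)
    have s4 : iteratedFDeriv ℝ 4 u x₀ ![b, a, b, a] = iteratedFDeriv ℝ 4 u x₀ ![b, b, a, a] :=
      iter_congr b ![a, b, a] ![b, a, a] (hC x₀ hx₀ 4) (hnear.mono fun y hy => swap3 y hy _ _ _)
    rw [s1, s2, s3, s4]
  -- second derivatives of log V along coordinate lines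
  have main : ∀ j, _ := fun j => by
    have hc : ∀ᶠ s : ℝ in 𝓝 0, x₀ + s • e j ∈ Ω := by
      have hc : Tendsto (fun s : ℝ => x₀ + s • e j) (𝓝 0) (𝓝 x₀) := by
        have : Continuous (fun s : ℝ => x₀ + s • e j) := by fun_prop
        simpa using this.tendsto 0
      exact hc.eventually hnear
    have hx : x₀ + (0:ℝ) • e j = x₀ := by simp
    have key := second_deriv_log (lam := lam) (M := fun s => Hess u (x₀ + s • e j))
      (M1 := fun s => Matrix.of fun p q => iteratedFDeriv ℝ 3 u (x₀ + s • e j) ![e j, e p, e q])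
      (M2 := Matrix.of fun p q => iteratedFDeriv ℝ 4 u x₀ ![e j, e j, e p, e q])
      (v := fun s => Vol u (x₀ + s • e j)) (L := fun s => v (x₀ + s • e j))
      (L1 := fun s => iteratedFDeriv ℝ 1 v (x₀ + s • e j) ![e j])
      (L2 := iteratedFDeriv ℝ 2 v x₀ ![e j, e j])
      (w := Complex.exp (Complex.I * (c : ℝ))) (Complex.exp_ne_zero _)
      (hc.mono fun s hs p q => hasDerivAt_line ![e p, e q] ![e j, e p, e q] rfl (hC _ hs 3))
      (fun p q => by
        have := hasDerivAt_line (t := 0) (x := x₀) (e := e j) ![e j, e p, e q]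
          ![e j, e j, e p, e q] rfl (hx.symm ▸ hC _ hx₀ 4)
        rw [hx] at this
        exact this)
      (by simp only [hx]; exact hdiag)
      (hc.mono fun s hs => hVpos _ hs)
      (fun s => rfl)
      (hc.mono fun s hs => hphase _ hs)
      (hc.mono fun s hs => by
        have := hasDerivAt_line (t := s) (x := x₀) (e := e j) (f := v) ![] ![e j] rfl
          ((hvC _ hs).of_le (by norm_num))
        simpa using this)
      (by
        have := hasDerivAt_line (t := 0) (x := x₀) (e := e j) (f := v) ![e j]
          ![e j, e j] rfl (hx.symm ▸ hvC _ hx₀)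
        rw [hx] at this
        exact this)
    simp only [hx, Matrix.of_apply] at key
    exact real_parts key
  have hginv : (gMat u x₀)⁻¹ = diagonal (fun i => (1 + lam i ^ 2)⁻¹) := by
    apply Matrix.inv_eq_right_inv
    rw [gMat, hdiag, Matrix.diagonal_mul_diagonal, ← Matrix.diagonal_one, Matrix.diagonal_add,
      Matrix.diagonal_mul_diagonal]
    congr 1; ext i
    have : (1 + lam i ^ 2) ≠ 0 := by positivity
    field_simp
  have hlap : lapg u v x₀ =
      ∑ j, (1 + lam j ^ 2)⁻¹ * iteratedFDeriv ℝ 2 v x₀ ![e j, e j] := by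
    rw [lapg, hginv]
    refine Finset.sum_congr rfl fun i _ => ?_
    simp [Matrix.diagonal_apply, he]
  rw [hlap, final_sum lam (fun i => (1 + lam i ^ 2)⁻¹)
    (fun i j k => iteratedFDeriv ℝ 3 u x₀ ![e i, e j, e k])
    (fun i j => iteratedFDeriv ℝ 4 u x₀ ![e i, e i, e j, e j]) _
    (fun i j k => swap3 x₀ hx₀ _ _ _) (fun i j k => swap3' x₀ hx₀ _ _ _)
    (fun i j => symm4 _ _) (fun j => (main j).1) (fun j => (main j).2)]
  refine Finset.sum_congr rfl fun i _ => Finset.sum_congr rfl fun j _ =>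
      Finset.sum_congr rfl fun k _ => ?_
  rw [div_pow, Real.sq_sqrt (by positivity), div_eq_mul_inv, mul_inv, mul_inv]
end

section
/- Let n ≥ 2, let ε > 0, and let δ < 1/√(n−1) be nonnegative. There exists a constant C = C(n, δ, ε) such that the following holds: if u is a smooth solution to the special Lagrangian equation ∑_{i=1}^n arctan λᵢ(x) = c on the unit ball B₁(0) ⊂ ℝⁿ satisfying 3 + (1−ε)λᵢ(x)² + 2λᵢ(x)λⱼ(x) ≥ 0 for all i, j and all x ∈ B₁(0), and |∇u(x)| ≤ δ for all x ∈ B₁(0), then the Hessian at the origin satisfies |D²u(0)| ≤ C. -/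
section MatCalc
open Matrix Filter Topology

theorem sl_det_deriv {n : ℕ} (B : ℝ → Matrix (Fin n) (Fin n) ℂ) (B' : Matrix (Fin n) (Fin n) ℂ)
    (t : ℝ) (h : ∀ j k, HasDerivAt (fun s => B s j k) (B' j k) t) :
    HasDerivAt (fun s => (B s).det) (((B t).adjugate * B').trace) t := by
  have h1 : HasDerivAt (fun s => (B s).det)
      (∑ σ : Equiv.Perm (Fin n), Equiv.Perm.sign σ •
        ∑ i, (∏ j ∈ Finset.univ.erase i, B t (σ j) j) • B' (σ i) i) t := by
    simp only [Matrix.det_apply]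
    refine HasDerivAt.fun_sum fun σ _ => ?_
    have := (HasDerivAt.fun_finsetProd (u := Finset.univ) (f := fun i s => B s (σ i) i)
      (f' := fun i => B' (σ i) i) (x := t) (fun i _ => h _ _))
    simp only [Units.smul_def, zsmul_eq_mul]
    exact this.const_mul _
  convert h1 using 1
  have h2 : ((B t).adjugate * B').trace = ∑ i, ((B t).updateCol i (fun j => B' j i)).det := by
    simp only [Matrix.trace, Matrix.diag]
    refine Finset.sum_congr rfl fun i _ => ?_
    rw [← Matrix.cramer_apply, Matrix.cramer_eq_adjugate_mulVec]
    rfl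
  rw [h2]
  simp only [Matrix.det_apply, Finset.smul_sum]
  rw [Finset.sum_comm]
  refine Finset.sum_congr rfl fun σ _ => Finset.sum_congr rfl fun i _ => ?_
  congr 1
  rw [← Finset.mul_prod_erase Finset.univ _ (Finset.mem_univ i), smul_eq_mul, mul_comm]
  congr 1
  · refine Finset.prod_congr rfl fun j hj => ?_
    rw [Matrix.updateCol_ne (Finset.ne_of_mem_erase hj)]
  · simp

attribute [local instance] Matrix.linftyOpNormedRing Matrix.linftyOpNormedAlgebra

theorem sl_inv_deriv {n : ℕ} (B : ℝ → Matrix (Fin n) (Fin n) ℂ) (B' : Matrix (Fin n) (Fin n) ℂ)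
    (t : ℝ) (h : ∀ j k, HasDerivAt (fun s => B s j k) (B' j k) t) (hu : IsUnit (B t)) (j k : Fin n) :
    HasDerivAt (fun s => (B s)⁻¹ j k) (-(((B t)⁻¹ * B' * (B t)⁻¹) j k)) t := by
  have hB : HasDerivAt B B' t := by
    have : HasDerivAt (fun s => ∑ a, ∑ b, B s a b • Matrix.single a b (1:ℂ))
        (∑ a, ∑ b, B' a b • Matrix.single a b (1:ℂ)) t := by
      refine HasDerivAt.fun_sum fun a _ => HasDerivAt.fun_sum fun b _ => ?_
      exact (h a b).smul_const _
    have e : ∀ M : Matrix (Fin n) (Fin n) ℂ, M = ∑ a, ∑ b, M a b • Matrix.single a b (1:ℂ) := by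
      intro M
      conv_lhs => rw [Matrix.matrix_eq_sum_single M]
      simp
    rw [← e] at this
    convert this using 1
    funext s
    exact e _
  obtain ⟨U, hU⟩ := hu
  have h1 := hasFDerivAt_ringInverse (𝕜 := ℝ) U
  rw [hU] at h1
  have h2 := h1.comp_hasDerivAt t hB
  have h3 : HasDerivAt (fun s => (B s)⁻¹) (-((B t)⁻¹ * B' * (B t)⁻¹)) t := by
    have e1 : (fun s => (B s)⁻¹) = Ring.inverse ∘ B := by
      funext s
      simp [Matrix.nonsing_inv_eq_ringInverse]
    have e2 : (-((B t)⁻¹ * B' * (B t)⁻¹)) =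
        (-((ContinuousLinearMap.mulLeftRight ℝ (Matrix (Fin n) (Fin n) ℂ)) ↑U⁻¹) ↑U⁻¹) B' := by
      simp [← hU]
    rw [e1, e2]
    exact h2
  let L : Matrix (Fin n) (Fin n) ℂ →ₗ[ℝ] ℂ := 
    { toFun := fun M => M j k, map_add' := fun _ _ => rfl, map_smul' := fun _ _ => rfl }
  have h4 := (L.toContinuousLinearMap).hasFDerivAt (x := (B t)⁻¹) |>.comp_hasDerivAt t h3
  exact h4
end MatCalc
section PathCalc
open Matrix Filter Topology

/-- The entry `(lam + i)/(1+lam^2) = i/(1+i lam)`. -/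
noncomputable def slMu (l : ℝ) : ℂ := Complex.I * (1 + Complex.I * l)⁻¹

theorem sl_one_add_ne (l : ℝ) : (1 + Complex.I * (l:ℂ)) ≠ 0 := by
  intro h
  have := congrArg Complex.re h
  simp at this

noncomputable def slB {n : ℕ} (A : Matrix (Fin n) (Fin n) ℝ) : Matrix (Fin n) (Fin n) ℂ :=
  1 + Complex.I • A.map (fun x : ℝ => (x : ℂ))

theorem sl_path {n : ℕ} (A A' : ℝ → Matrix (Fin n) (Fin n) ℝ) (A'' : Matrix (Fin n) (Fin n) ℝ)
    (lam : Fin n → ℝ) (c : ℝ) (b : ℝ → ℝ)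
    (hA : ∀ᶠ t in 𝓝 (0:ℝ), ∀ j k, HasDerivAt (fun s => A s j k) (A' t j k) t)
    (hA' : ∀ j k, HasDerivAt (fun s => A' s j k) (A'' j k) 0)
    (h0 : A 0 = Matrix.diagonal lam)
    (hD : ∀ᶠ t in 𝓝 (0:ℝ), (slB (A t)).det = Complex.exp ((b t : ℂ) + c * Complex.I)) :
    ∃ b1 : ℝ → ℝ, ∃ b2 : ℝ, (∀ᶠ t in 𝓝 (0:ℝ), HasDerivAt b (b1 t) t) ∧ HasDerivAt b1 b2 0 ∧
      (b1 0 : ℂ) = ∑ j, slMu (lam j) * (A' 0 j j : ℂ) ∧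
      (b2 : ℂ) = ∑ j, slMu (lam j) * (A'' j j : ℂ) -
        ∑ j, ∑ k, slMu (lam j) * slMu (lam k) * ((A' 0 j k : ℂ) * (A' 0 k j : ℂ)) := by
  set B : ℝ → Matrix (Fin n) (Fin n) ℂ := fun t => slB (A t) with hB
  set B1 : ℝ → Matrix (Fin n) (Fin n) ℂ := fun t => Complex.I • (A' t).map (fun x : ℝ => (x : ℂ))
    with hB1
  set B2 : Matrix (Fin n) (Fin n) ℂ := Complex.I • (A'').map (fun x : ℝ => (x : ℂ)) with hB2
  set z : ℝ → ℂ := fun t => ((B t)⁻¹ * B1 t).trace with hz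
  have hBd : ∀ᶠ t in 𝓝 (0:ℝ), ∀ j k, HasDerivAt (fun s => B s j k) (B1 t j k) t := by
    filter_upwards [hA] with t ht j k
    simp only [hB, hB1, slB, Matrix.add_apply, Matrix.smul_apply, Matrix.map_apply, smul_eq_mul]
    exact ((ht j k).ofReal_comp.const_mul Complex.I).const_add _
  have hB1d : ∀ j k, HasDerivAt (fun s => B1 s j k) (B2 j k) 0 := by
    intro j k
    simp only [hB2, hB1, Matrix.smul_apply, Matrix.map_apply, smul_eq_mul]
    exact ((hA' j k).ofReal_comp.const_mul Complex.I)
  -- the basic first-order identity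
  have key : ∀ᶠ t in 𝓝 (0:ℝ), HasDerivAt b (z t).re t ∧ (z t).im = 0 := by
    filter_upwards [hBd, hD, hD.eventually_nhds] with t h1 h2 h3
    have hd := sl_det_deriv B (B1 t) t h1
    have hdet : (B t).det ≠ 0 := by
      rw [hB]; simp only; rw [h2]; exact Complex.exp_ne_zero _
    have e1 : ((B t).adjugate * B1 t).trace = (B t).det * z t := by
      have : (B t).adjugate = (B t).det • (B t)⁻¹ := by
        rw [Matrix.inv_def, smul_smul, Ring.mul_inverse_cancel _ (isUnit_iff_ne_zero.2 hdet),
          one_smul]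
      rw [this, Matrix.smul_mul, Matrix.trace_smul, smul_eq_mul]
    rw [e1] at hd
    have hw : HasDerivAt (fun s => ((Real.exp (b s) : ℝ) : ℂ)) (Real.exp (b t) * z t) t := by
      have h4 := hd.const_mul (Complex.exp (-(c * Complex.I)))
      have e2 : Complex.exp (-(c * Complex.I)) * ((B t).det * z t) = Real.exp (b t) * z t := by
        rw [← mul_assoc]
        congr 1
        show _ * (slB (A t)).det = _
        rw [h2, ← Complex.exp_add, Complex.ofReal_exp]
        congr 1; ring
      rw [e2] at h4
      refine h4.congr_of_eventuallyEq ?_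
      filter_upwards [h3] with s hs
      show _ = _ * (slB (A s)).det
      rw [hs, ← Complex.exp_add, Complex.ofReal_exp]
      congr 1; ring
    have hre : HasDerivAt (fun s => Real.exp (b s)) (Real.exp (b t) * (z t).re) t := by
      have := (Complex.reCLM.hasFDerivAt (x := ((Real.exp (b t) : ℝ) : ℂ))).comp_hasDerivAt t hw
      simpa [Function.comp_def, -Complex.ofReal_exp] using this
    have him : HasDerivAt (fun s : ℝ => (0:ℝ)) (Real.exp (b t) * (z t).im) t := by
      have := (Complex.imCLM.hasFDerivAt (x := ((Real.exp (b t) : ℝ) : ℂ))).comp_hasDerivAt t hw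
      have e3 : (Complex.imCLM ∘ fun s => ((Real.exp (b s) : ℝ) : ℂ)) = fun _ => 0 := by
        funext s
        simp only [Function.comp, Complex.imCLM_apply, Complex.ofReal_im]
      rw [e3] at this
      simpa only [Complex.imCLM_apply, Complex.im_ofReal_mul] using this
    constructor
    · have := hre.log (Real.exp_ne_zero _)
      simp only [Real.log_exp] at this
      rwa [mul_div_cancel_left₀ _ (Real.exp_ne_zero _)] at this
    · have := him.unique (hasDerivAt_const t (0:ℝ))
      exact (mul_eq_zero.1 this).resolve_left (Real.exp_ne_zero _)
  have hB0 : B 0 = Matrix.diagonal (fun j => 1 + Complex.I * (lam j : ℂ)) := by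
    ext j k
    simp only [hB, slB, h0]
    by_cases hjk : j = k
    · subst hjk; simp
    · simp [hjk]
  have hB0i : (B 0)⁻¹ = Matrix.diagonal (fun j => (1 + Complex.I * (lam j : ℂ))⁻¹) := by
    apply Matrix.inv_eq_right_inv
    rw [hB0, Matrix.diagonal_mul_diagonal]
    simp [mul_inv_cancel₀ (sl_one_add_ne _)]
  have hu : IsUnit (B 0) := by
    rw [Matrix.isUnit_iff_isUnit_det, hB0, Matrix.det_diagonal, isUnit_iff_ne_zero]
    exact Finset.prod_ne_zero_iff.2 fun j _ => sl_one_add_ne _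
  -- derivative of z
  have hz2 : HasDerivAt z (∑ j, slMu (lam j) * (A'' j j : ℂ) -
        ∑ j, ∑ k, slMu (lam j) * slMu (lam k) * ((A' 0 j k : ℂ) * (A' 0 k j : ℂ))) 0 := by
    have h5 := sl_inv_deriv B (B1 0) 0 hBd.self_of_nhds hu
    have h6 : HasDerivAt z (∑ j, ∑ k, (-(((B 0)⁻¹ * B1 0 * (B 0)⁻¹) j k) * B1 0 k j +
        (B 0)⁻¹ j k * B2 k j)) 0 := by
      simp only [hz, Matrix.trace, Matrix.diag, Matrix.mul_apply (M := (B _)⁻¹)]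
      refine HasDerivAt.fun_sum fun j _ => HasDerivAt.fun_sum fun k _ => ?_
      exact (h5 j k).mul (hB1d k j)
    convert h6 using 1
    simp only [Finset.sum_add_distrib, hB0i, Matrix.mul_diagonal, Matrix.diagonal_mul,
      Matrix.diagonal_apply, ite_mul, zero_mul, Finset.sum_ite_eq, Finset.mem_univ, if_true,
      hB1, hB2, Matrix.smul_apply, Matrix.map_apply, smul_eq_mul, neg_mul, Finset.sum_neg_distrib]
    rw [sub_eq_add_neg, add_comm]
    congr 1
    · congr 1
      refine Finset.sum_congr rfl fun j _ => Finset.sum_congr rfl fun k _ => ?_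
      simp only [slMu]; ring
    · refine Finset.sum_congr rfl fun j _ => ?_
      simp only [slMu]; ring
  have hz1 : z 0 = ∑ j, slMu (lam j) * (A' 0 j j : ℂ) := by
    simp only [hz, hB0i, Matrix.trace, Matrix.diag, Matrix.diagonal_mul, hB1, Matrix.smul_apply,
      Matrix.map_apply, smul_eq_mul, slMu]
    refine Finset.sum_congr rfl fun j _ => ?_
    ring
  set Z2 := (∑ j, slMu (lam j) * (A'' j j : ℂ) -
        ∑ j, ∑ k, slMu (lam j) * slMu (lam k) * ((A' 0 j k : ℂ) * (A' 0 k j : ℂ))) with hZ2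
  refine ⟨fun t => (z t).re, Z2.re, key.mono fun t h => h.1, ?_, ?_, ?_⟩
  · have := (Complex.reCLM.hasFDerivAt (x := z 0)).comp_hasDerivAt 0 hz2
    simpa [Function.comp_def] using this
  · rw [← hz1]
    apply Complex.ext
    · simp
    · simp [key.self_of_nhds.2]
  · apply Complex.ext
    · simp
    · have := (Complex.imCLM.hasFDerivAt (x := z 0)).comp_hasDerivAt 0 hz2
      have h7 : HasDerivAt (fun _ : ℝ => (0:ℝ)) (Complex.imCLM Z2) 0 := by
        refine this.congr_of_eventuallyEq ?_
        filter_upwards [key] with s hs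
        simp [hs.2]
      have h8 := h7.unique (hasDerivAt_const 0 (0:ℝ))
      simp only [Complex.imCLM_apply] at h8
      simp [h8]
end PathCalc
section AlgCore

theorem slMu_eq (l : ℝ) : slMu l = (((1 + l ^ 2)⁻¹ * l : ℝ) : ℂ) + ((1 + l ^ 2)⁻¹ : ℝ) * Complex.I := by
  unfold slMu
  have h1 := sl_one_add_ne l
  have h2 : (1 + (l:ℂ) ^ 2) ≠ 0 := by
    have : (1 + l ^ 2 : ℝ) ≠ 0 := by positivity
    exact_mod_cast this
  push_cast
  field_simp
  ring_nf
  simp only [Complex.I_sq]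
  ring

theorem sl_triple_pos (m a b : ℝ) (hm : 0 < m) (ha : 0 ≤ a) (hb : 0 ≤ b)
    (h1 : 2 * m * a ≤ 3 + m ^ 2) (h2 : 2 * m * b ≤ 3 + m ^ 2)
    (h3 : 2 * m * a ≤ 3 + a ^ 2) (h4 : 2 * m * b ≤ 3 + b ^ 2) : m * (a + b) ≤ 3 + a * b := by
  wlog hab : b ≤ a with H
  · have := H m b a hm hb ha h2 h1 h4 h3 (le_of_not_ge hab)
    linarith
  rcases le_total (m ^ 2) 3 with hm3 | hm3
  · rcases le_total m b with hmb | hmb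
    · nlinarith [mul_nonneg (sub_nonneg.2 hmb) (sub_nonneg.2 (hmb.trans hab))]
    · rcases le_total a m with ham | ham
      · nlinarith [mul_nonneg (sub_nonneg.2 hmb) (sub_nonneg.2 ham)]
      · have h5 : 2 * m * (a - m) ≤ 3 - m ^ 2 := by nlinarith
        nlinarith [mul_nonneg (sub_nonneg.2 ham) hb, mul_nonneg (sub_nonneg.2 hmb) (sub_nonneg.2 ham)]
  · have ham : a ≤ m := by nlinarith
    have hbm : b ≤ m := hab.trans ham
    have h5 : m ^ 2 - 3 ≤ (m - a) ^ 2 := by nlinarith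
    nlinarith [mul_nonneg (sub_nonneg.2 ham) (sub_nonneg.2 hab)]

theorem sl_triple (x y z : ℝ) (h : ∀ s t : ℝ, (s = x ∨ s = y ∨ s = z) → (t = x ∨ t = y ∨ t = z) →
    0 ≤ 3 + s ^ 2 + 2 * s * t) : 0 ≤ 3 + x * y + y * z + z * x := by
  have hxy := h x y (by simp) (by simp)
  have hyx := h y x (by simp) (by simp)
  have hxz := h x z (by simp) (by simp)
  have hzx := h z x (by simp) (by simp)
  have hyz := h y z (by simp) (by simp)
  have hzy := h z y (by simp) (by simp)
  -- auxiliary form: one negative, two nonnegative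
  have aux : ∀ p q r : ℝ, p < 0 → 0 ≤ q → 0 ≤ r → 0 ≤ 3 + p ^ 2 + 2 * p * q → 0 ≤ 3 + p ^ 2 + 2 * p * r →
      0 ≤ 3 + q ^ 2 + 2 * q * p → 0 ≤ 3 + r ^ 2 + 2 * r * p → 0 ≤ 3 + p * q + q * r + r * p := by
    intro p q r hp hq hr h1 h2 h3 h4
    have := sl_triple_pos (-p) q r (by linarith) hq hr (by nlinarith) (by nlinarith) (by nlinarith)
      (by nlinarith)
    nlinarith
  rcases lt_or_ge x 0 with hx | hx <;> rcases lt_or_ge y 0 with hy | hy <;>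
    rcases lt_or_ge z 0 with hz | hz
  · nlinarith [mul_pos_of_neg_of_neg hx hy, mul_pos_of_neg_of_neg hy hz, mul_pos_of_neg_of_neg hz hx]
  · rcases hz.eq_or_lt with hz | hz
    · subst hz; nlinarith [mul_pos_of_neg_of_neg hx hy]
    have := aux (-z) (-x) (-y) (by linarith) (by linarith) (by linarith) (by nlinarith) (by nlinarith)
      (by nlinarith) (by nlinarith)
    nlinarith
  · rcases hy.eq_or_lt with hy | hy
    · subst hy; nlinarith [mul_pos_of_neg_of_neg hx hz]
    have := aux (-y) (-x) (-z) (by linarith) (by linarith) (by linarith) (by nlinarith) (by nlinarith)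
      (by nlinarith) (by nlinarith)
    nlinarith
  · have := aux x y z hx hy hz (by nlinarith) (by nlinarith) (by nlinarith) (by nlinarith)
    nlinarith
  · rcases hx.eq_or_lt with hx | hx
    · subst hx; nlinarith [mul_pos_of_neg_of_neg hy hz]
    have := aux (-x) (-y) (-z) (by linarith) (by linarith) (by linarith) (by nlinarith) (by nlinarith)
      (by nlinarith) (by nlinarith)
    nlinarith
  · have := aux y x z hy hx hz (by nlinarith) (by nlinarith) (by nlinarith) (by nlinarith)
    nlinarith
  · have := aux z x y hz hx hy (by nlinarith) (by nlinarith) (by nlinarith) (by nlinarith)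
    nlinarith
  · positivity

theorem sl_algebra {n : ℕ} (lam : Fin n → ℝ) (ε : ℝ) (hε : 0 < ε) (hε1 : ε ≤ 1)
    (hl : ∀ i j, 0 ≤ 3 + (1 - ε) * lam i ^ 2 + 2 * lam i * lam j)
    (T : Fin n → Fin n → Fin n → ℝ) (hT1 : ∀ i j k, T i j k = T j i k)
    (hT2 : ∀ i j k, T i j k = T i k j) (Q : Fin n → Fin n → ℝ) (hQ : ∀ i j, Q i j = Q j i)
    (b1 b2 : Fin n → ℝ)
    (hb1 : ∀ i, (b1 i : ℂ) = ∑ j, slMu (lam j) * (T i j j : ℂ))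
    (hb2 : ∀ i, (b2 i : ℂ) = ∑ j, slMu (lam j) * (Q i j : ℂ) -
        ∑ j, ∑ k, slMu (lam j) * slMu (lam k) * ((T i j k : ℂ) * (T i k j : ℂ))) :
    (∀ i, ∑ j, (1 + lam j ^ 2)⁻¹ * T i j j = 0) ∧
    ε / n * ∑ i, (1 + lam i ^ 2)⁻¹ * b1 i ^ 2 ≤ ∑ i, (1 + lam i ^ 2)⁻¹ * b2 i := by
  set g : Fin n → ℝ := fun i => (1 + lam i ^ 2)⁻¹ with hg
  have hgpos : ∀ i, 0 < g i := fun i => by simp only [hg]; positivity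
  have hre1 : ∀ i, b1 i = ∑ j, g j * lam j * T i j j := by
    intro i
    have := congrArg Complex.re (hb1 i)
    simpa [slMu_eq, -Complex.ofReal_inv, -Complex.ofReal_mul, Complex.re_sum] using this
  have him1 : ∀ i, ∑ j, g j * T i j j = 0 := by
    intro i
    have := congrArg Complex.im (hb1 i)
    simpa [slMu_eq, -Complex.ofReal_inv, -Complex.ofReal_mul, Complex.im_sum] using this.symm
  have hre2 : ∀ i, b2 i = ∑ j, g j * lam j * Q i j -
      ∑ j, ∑ k, g j * g k * (lam j * lam k - 1) * T i j k ^ 2 := by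
    intro i
    have := congrArg Complex.re (hb2 i)
    simp only [slMu_eq, Complex.re_sum, Complex.ofReal_re, Complex.sub_re, Complex.mul_re,
      Complex.mul_im, Complex.add_re, Complex.add_im, Complex.ofReal_im, Complex.I_re,
      Complex.I_im] at this
    rw [this]
    congr 1
    · refine Finset.sum_congr rfl fun j _ => ?_
      simp only [hg]; ring
    · refine Finset.sum_congr rfl fun j _ => Finset.sum_congr rfl fun k _ => ?_
      rw [hT2 i k j]; simp only [hg]; ring
  have him2 : ∀ i, ∑ j, g j * Q i j = ∑ j, ∑ k, g j * g k * (lam j + lam k) * T i j k ^ 2 := by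
    intro i
    have := congrArg Complex.im (hb2 i)
    simp only [slMu_eq, Complex.im_sum, Complex.ofReal_re, Complex.sub_im, Complex.mul_re,
      Complex.mul_im, Complex.add_re, Complex.add_im, Complex.ofReal_im, Complex.I_re,
      Complex.I_im] at this
    rw [eq_comm, sub_eq_zero] at this
    convert this using 1
    · refine Finset.sum_congr rfl fun j _ => ?_
      simp only [hg]; ring
    · refine Finset.sum_congr rfl fun j _ => Finset.sum_congr rfl fun k _ => ?_
      rw [hT2 i k j]; simp only [hg]; ring
  refine ⟨him1, ?_⟩
  set h : Fin n → Fin n → Fin n → ℝ := fun i j k => g i * g j * g k * T i j k ^ 2 with hh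
  have hh0 : ∀ i j k, 0 ≤ h i j k := fun i j k => by
    have := hgpos i; have := hgpos j; have := hgpos k
    simp only [hh]; positivity
  have hs1 : ∀ i j k, h i j k = h j i k := fun i j k => by simp only [hh]; rw [hT1 i j k]; ring
  have hs2 : ∀ i j k, h i j k = h i k j := fun i j k => by simp only [hh]; rw [hT2 i j k]; ring
  -- the Laplacian of b
  have hlap : ∑ i, g i * b2 i = ∑ i, ∑ j, ∑ k, (1 + lam i * lam j) * h i j k := by
    have e1 : ∑ i, g i * b2 i = ∑ i, ∑ j, g i * g j * lam j * Q i j -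
        ∑ i, ∑ j, ∑ k, (lam j * lam k - 1) * h i j k := by
      rw [← Finset.sum_sub_distrib]
      refine Finset.sum_congr rfl fun i _ => ?_
      rw [hre2 i, mul_sub, Finset.mul_sum, Finset.mul_sum]
      congr 1
      · exact Finset.sum_congr rfl fun j _ => by ring
      · refine Finset.sum_congr rfl fun j _ => ?_
        rw [Finset.mul_sum]
        exact Finset.sum_congr rfl fun k _ => by simp only [hh]; ring
    have e2 : ∑ i, ∑ j, g i * g j * lam j * Q i j =
        ∑ i, ∑ j, ∑ k, (lam i * lam j + lam i * lam k) * h i j k := by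
      rw [Finset.sum_comm]
      refine Finset.sum_congr rfl fun j _ => ?_
      have : ∑ i, g i * g j * lam j * Q i j = g j * lam j * ∑ i, g i * Q j i := by
        rw [Finset.mul_sum]
        exact Finset.sum_congr rfl fun i _ => by rw [hQ i j]; ring
      rw [this, him2 j, Finset.mul_sum]
      refine Finset.sum_congr rfl fun i _ => ?_
      rw [Finset.mul_sum]
      exact Finset.sum_congr rfl fun k _ => by simp only [hh]; ring
    have e3 : ∑ i, ∑ j, ∑ k, (lam i * lam k) * h i j k = ∑ i, ∑ j, ∑ k, (lam j * lam k) * h i j k := by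
      rw [Finset.sum_comm]
      refine Finset.sum_congr rfl fun i _ => Finset.sum_congr rfl fun j _ =>
        Finset.sum_congr rfl fun k _ => by rw [hs1]
    rw [e1, e2]
    simp only [add_mul, sub_mul, Finset.sum_add_distrib, Finset.sum_sub_distrib] at *
    rw [e3]; ring
  have hlap3 : 3 * ∑ i, g i * b2 i =
      ∑ i, ∑ j, ∑ k, (3 + lam i * lam j + lam j * lam k + lam k * lam i) * h i j k := by
    have e4 : ∑ i, ∑ j, ∑ k, (lam j * lam k) * h i j k = ∑ i, ∑ j, ∑ k, (lam i * lam j) * h i j k := by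
      have : ∑ i, ∑ j, ∑ k, (lam j * lam k) * h i j k = ∑ i, ∑ j, ∑ k, (lam i * lam k) * h i j k := by
        rw [Finset.sum_comm]
        refine Finset.sum_congr rfl fun i _ => Finset.sum_congr rfl fun j _ =>
          Finset.sum_congr rfl fun k _ => by rw [hs1]
      rw [this]
      refine Finset.sum_congr rfl fun i _ => ?_
      rw [Finset.sum_comm]
      refine Finset.sum_congr rfl fun j _ => Finset.sum_congr rfl fun k _ => by rw [hs2]
    have e5 : ∑ i, ∑ j, ∑ k, (lam k * lam i) * h i j k = ∑ i, ∑ j, ∑ k, (lam i * lam j) * h i j k := by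
      refine Finset.sum_congr rfl fun i _ => ?_
      rw [Finset.sum_comm]
      refine Finset.sum_congr rfl fun j _ => Finset.sum_congr rfl fun k _ => by rw [hs2]; ring
    rw [hlap]
    simp only [add_mul, Finset.sum_add_distrib]
    rw [e4, e5]
    simp only [one_mul, ← Finset.mul_sum]
    ring
  -- pointwise bound
  have hpt : ∀ i j k, ε * ((if i = j then lam i ^ 2 else 0) + (if j = k then lam j ^ 2 else 0) +
      (if i = k then lam k ^ 2 else 0)) ≤ 3 + lam i * lam j + lam j * lam k + lam k * lam i := by
    intro i j k
    by_cases hij : i = j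
    · subst hij
      by_cases hik : i = k
      · subst hik; simp; nlinarith [sq_nonneg (lam i)]
      · simp [hik]; nlinarith [hl i k]
    · by_cases hjk : j = k
      · subst hjk; simp [hij]; nlinarith [hl j i]
      · by_cases hik : i = k
        · subst hik; simp [hij, hjk]; nlinarith [hl i j]
        · simp [hij, hjk, hik]
          apply sl_triple
          have hh : ∀ i j, 0 ≤ 3 + lam i ^ 2 + 2 * lam i * lam j := fun i j => by
            nlinarith [hl i j, sq_nonneg (lam i)]
          rintro s t (rfl | rfl | rfl) (rfl | rfl | rfl) <;> exact hh _ _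
  have hsum : 3 * (ε * ∑ i, ∑ j, lam j ^ 2 * h i j j) ≤ 3 * ∑ i, g i * b2 i := by
    rw [hlap3]
    have e6 : 3 * (ε * ∑ i, ∑ j, lam j ^ 2 * h i j j) = ∑ i, ∑ j, ∑ k,
        (ε * ((if i = j then lam i ^ 2 else 0) + (if j = k then lam j ^ 2 else 0) +
      (if i = k then lam k ^ 2 else 0))) * h i j k := by
      simp only [mul_add, add_mul, Finset.sum_add_distrib]
      have f2 : ∑ i, ∑ j, ∑ k, ε * (if j = k then lam j ^ 2 else 0) * h i j k =
          ε * ∑ i, ∑ j, lam j ^ 2 * h i j j := by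
        simp [Finset.mul_sum, mul_assoc]
      have f3 : ∑ i, ∑ j, ∑ k, ε * (if i = k then lam k ^ 2 else 0) * h i j k =
          ε * ∑ i, ∑ j, lam j ^ 2 * h i j j := by
        rw [← f2, Finset.sum_comm]
        refine Finset.sum_congr rfl fun i _ => Finset.sum_congr rfl fun j _ =>
          Finset.sum_congr rfl fun k _ => ?_
        rw [hs1 i j k]
        by_cases hjk : j = k
        · subst hjk; simp
        · simp [hjk]
      have f1 : ∑ i, ∑ j, ∑ k, ε * (if i = j then lam i ^ 2 else 0) * h i j k =
          ε * ∑ i, ∑ j, lam j ^ 2 * h i j j := by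
        rw [← f3]
        refine Finset.sum_congr rfl fun i _ => ?_
        rw [Finset.sum_comm]
        refine Finset.sum_congr rfl fun j _ => Finset.sum_congr rfl fun k _ => ?_
        rw [hs2 i k j]
        by_cases hik : i = k
        · subst hik; simp
        · simp [hik]
      rw [f1, f2, f3]; ring
    rw [e6]
    exact Finset.sum_le_sum fun i _ => Finset.sum_le_sum fun j _ => Finset.sum_le_sum fun k _ =>
      mul_le_mul_of_nonneg_right (hpt i j k) (hh0 i j k)
  have hcs : ∑ i, g i * b1 i ^ 2 ≤ n * ∑ i, ∑ j, lam j ^ 2 * h i j j := by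
    rw [Finset.mul_sum]
    refine Finset.sum_le_sum fun i _ => ?_
    have := sq_sum_le_card_mul_sum_sq (s := Finset.univ) (f := fun j => g j * lam j * T i j j)
    rw [← hre1 i, Finset.card_univ, Fintype.card_fin] at this
    calc g i * b1 i ^ 2 ≤ g i * (n * ∑ j, (g j * lam j * T i j j) ^ 2) :=
          mul_le_mul_of_nonneg_left this (hgpos i).le
      _ = _ := by
          rw [mul_left_comm, Finset.mul_sum]
          congr 1
          exact Finset.sum_congr rfl fun j _ => by simp only [hh]; ring
  have hS0 : 0 ≤ ∑ i, ∑ j, lam j ^ 2 * h i j j :=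
    Finset.sum_nonneg fun i _ => Finset.sum_nonneg fun j _ => mul_nonneg (sq_nonneg _) (hh0 _ _ _)
  calc ε / n * ∑ i, g i * b1 i ^ 2 ≤ ε / n * (n * ∑ i, ∑ j, lam j ^ 2 * h i j j) :=
        mul_le_mul_of_nonneg_left hcs (by positivity)
    _ ≤ ε * ∑ i, ∑ j, lam j ^ 2 * h i j j := by
        rcases Nat.eq_zero_or_pos n with hn | hn
        · subst hn; simp
        · have : (n:ℝ) ≠ 0 := by positivity
          apply le_of_eq; field_simp
    _ ≤ _ := by linarith
end AlgCore
section DirDeriv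
open Matrix Filter Topology

/-- Directional derivative. -/
noncomputable def sldd {n : ℕ} (v : EuclideanSpace ℝ (Fin n)) (f : EuclideanSpace ℝ (Fin n) → ℝ) :
    EuclideanSpace ℝ (Fin n) → ℝ := fun x => fderiv ℝ f x v

/-- Smoothness on the unit ball. -/
def SlSm {n : ℕ} (f : EuclideanSpace ℝ (Fin n) → ℝ) : Prop :=
  ContDiffOn ℝ (⊤ : ℕ∞) f (Metric.ball 0 1)

variable {n : ℕ} {f h : EuclideanSpace ℝ (Fin n) → ℝ} {x v w : EuclideanSpace ℝ (Fin n)}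

theorem SlSm.contDiffAt (hf : SlSm f) (hx : x ∈ Metric.ball (0 : EuclideanSpace ℝ (Fin n)) 1) :
    ContDiffAt ℝ (⊤ : ℕ∞) f x :=
  ContDiffOn.contDiffAt hf (Metric.isOpen_ball.mem_nhds hx)

theorem SlSm.diffAt (hf : SlSm f) (hx : x ∈ Metric.ball (0 : EuclideanSpace ℝ (Fin n)) 1) :
    DifferentiableAt ℝ f x :=
  (hf.contDiffAt hx).differentiableAt (by simp)

theorem SlSm.fderiv' (hf : SlSm f) :
    ContDiffOn ℝ (⊤ : ℕ∞) (fderiv ℝ f) (Metric.ball 0 1) :=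
  ContDiffOn.fderiv_of_isOpen hf Metric.isOpen_ball (by norm_cast)

theorem SlSm.dd (hf : SlSm f) (v : EuclideanSpace ℝ (Fin n)) : SlSm (sldd v f) :=
  hf.fderiv'.clm_apply contDiffOn_const

theorem sldd_dd (hf : SlSm f) (hx : x ∈ Metric.ball (0 : EuclideanSpace ℝ (Fin n)) 1)
    (v w : EuclideanSpace ℝ (Fin n)) :
    sldd v (sldd w f) x = fderiv ℝ (fderiv ℝ f) x v w := by
  have h1 : DifferentiableAt ℝ (fderiv ℝ f) x :=
    (hf.fderiv'.contDiffAt (Metric.isOpen_ball.mem_nhds hx)).differentiableAt (by simp)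
  unfold sldd
  rw [fderiv_clm_apply h1 (differentiableAt_const w)]
  simp

theorem sldd_comm (hf : SlSm f) (hx : x ∈ Metric.ball (0 : EuclideanSpace ℝ (Fin n)) 1)
    (v w : EuclideanSpace ℝ (Fin n)) : sldd v (sldd w f) x = sldd w (sldd v f) x := by
  rw [sldd_dd hf hx, sldd_dd hf hx]
  exact (hf.contDiffAt hx).isSymmSndFDerivAt (by simp; exact WithTop.coe_le_coe.2 (le_top : (2:ℕ∞) ≤ ⊤)) v w

theorem sldd_congr (hfh : ∀ y ∈ Metric.ball (0 : EuclideanSpace ℝ (Fin n)) 1, f y = h y)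
    (hx : x ∈ Metric.ball (0 : EuclideanSpace ℝ (Fin n)) 1) (v : EuclideanSpace ℝ (Fin n)) :
    sldd v f x = sldd v h x := by
  unfold sldd
  have : f =ᶠ[𝓝 x] h := by
    filter_upwards [Metric.isOpen_ball.mem_nhds hx] with y hy using hfh y hy
  rw [this.fderiv_eq]

theorem sldd_line (hf : SlSm f) (x v : EuclideanSpace ℝ (Fin n)) (t : ℝ)
    (hx : x + t • v ∈ Metric.ball (0 : EuclideanSpace ℝ (Fin n)) 1) :
    HasDerivAt (fun s : ℝ => f (x + s • v)) (sldd v f (x + t • v)) t := by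
  have h1 : HasDerivAt (fun s : ℝ => x + s • v) v t := by
    simpa using ((hasDerivAt_id t).smul_const v).const_add x
  exact (hf.diffAt hx).hasFDerivAt.comp_hasDerivAt t h1

theorem sl_line_mem (hx : x ∈ Metric.ball (0 : EuclideanSpace ℝ (Fin n)) 1)
    (v : EuclideanSpace ℝ (Fin n)) :
    ∀ᶠ t in 𝓝 (0:ℝ), x + t • v ∈ Metric.ball (0 : EuclideanSpace ℝ (Fin n)) 1 := by
  have hc : ContinuousAt (fun t : ℝ => x + t • v) 0 := by fun_prop
  apply hc.eventually_mem
  simpa using Metric.isOpen_ball.mem_nhds (by simpa using hx)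

/-- Conjugation. -/
theorem slB_conj (P Q A : Matrix (Fin n) (Fin n) ℝ) (hPQ : P * Q = 1) :
    (slB (P * A * Q)).det = (slB A).det := by
  have hmap : ∀ M : Matrix (Fin n) (Fin n) ℝ, M.map (fun x : ℝ => (x : ℂ)) =
      (Complex.ofRealHom.mapMatrix M) := fun M => rfl
  have h1 : (Complex.ofRealHom.mapMatrix P) * (Complex.ofRealHom.mapMatrix Q) = 1 := by
    rw [← map_mul, hPQ, map_one]
  have h2 : slB (P * A * Q) = (Complex.ofRealHom.mapMatrix P) * slB A *
      (Complex.ofRealHom.mapMatrix Q) := by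
    unfold slB
    rw [hmap, hmap, map_mul, map_mul, mul_add, add_mul, mul_one, h1, Matrix.mul_smul,
      Matrix.smul_mul]
  rw [h2, Matrix.det_mul, Matrix.det_mul, mul_right_comm, ← Matrix.det_mul, h1, Matrix.det_one,
    one_mul]

theorem sl_one_add_exp (l : ℝ) : 1 + Complex.I * (l : ℂ) =
    Complex.exp (((1/2 * Real.log (1 + l ^ 2) : ℝ) : ℂ) + Real.arctan l * Complex.I) := by
  have hpos : 0 < 1 + l ^ 2 := by positivity
  have h1 : Real.exp (1/2 * Real.log (1 + l ^ 2)) = Real.sqrt (1 + l ^ 2) := by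
    rw [Real.sqrt_eq_rpow, Real.rpow_def_of_pos hpos]; ring_nf
  have hs : Real.sqrt (1 + l ^ 2) ≠ 0 := by positivity
  rw [Complex.exp_add, ← Complex.ofReal_exp, h1, Complex.exp_mul_I, ← Complex.ofReal_cos,
    ← Complex.ofReal_sin, Real.cos_arctan, Real.sin_arctan]
  apply Complex.ext
  · simp [-Complex.ofReal_div, -Complex.ofReal_inv, hs]
  · simp [-Complex.ofReal_div, -Complex.ofReal_inv]
    field_simp

theorem sl_eigU (A : Matrix (Fin n) (Fin n) ℝ) (hA : A.IsHermitian) :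
    (hA.eigenvectorUnitary : Matrix (Fin n) (Fin n) ℝ)ᵀ * A *
      (hA.eigenvectorUnitary : Matrix (Fin n) (Fin n) ℝ) = Matrix.diagonal hA.eigenvalues ∧
    (hA.eigenvectorUnitary : Matrix (Fin n) (Fin n) ℝ)ᵀ *
      (hA.eigenvectorUnitary : Matrix (Fin n) (Fin n) ℝ) = 1 := by
  constructor
  · have := hA.conjStarAlgAut_star_eigenvectorUnitary
    rw [Unitary.conjStarAlgAut_star_apply] at this
    rw [Matrix.star_eq_conjTranspose, Matrix.conjTranspose_eq_transpose_of_trivial] at this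
    rw [this]
    rfl
  · have := Unitary.coe_star_mul_self hA.eigenvectorUnitary
    rwa [Matrix.star_eq_conjTranspose, Matrix.conjTranspose_eq_transpose_of_trivial] at this

theorem sl_det (A : Matrix (Fin n) (Fin n) ℝ) (hA : A.IsHermitian) :
    (slB A).det = Complex.exp (((∑ i, 1/2 * Real.log (1 + hA.eigenvalues i ^ 2) : ℝ) : ℂ) +
      ((∑ i, Real.arctan (hA.eigenvalues i) : ℝ) : ℂ) * Complex.I) := by
  obtain ⟨h1, h2⟩ := sl_eigU A hA
  rw [← slB_conj _ _ A h2, h1]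
  have h3 : slB (Matrix.diagonal hA.eigenvalues) =
      Matrix.diagonal (fun j => 1 + Complex.I * (hA.eigenvalues j : ℂ)) := by
    ext j k
    by_cases hjk : j = k
    · subst hjk; simp [slB]
    · simp [slB, hjk]
  rw [h3, Matrix.det_diagonal]
  simp only [sl_one_add_exp]
  rw [← Complex.exp_sum, Finset.sum_add_distrib]
  push_cast
  rw [Finset.sum_mul]

theorem sl_hess_apply (hf : SlSm f) (hx : x ∈ Metric.ball (0 : EuclideanSpace ℝ (Fin n)) 1)
    (i j : Fin n) : Hess f x i j =
      sldd (EuclideanSpace.single i 1) (sldd (EuclideanSpace.single j 1) f) x := by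
  rw [sldd_dd hf hx]
  simp [Hess, iteratedFDeriv_two_apply]

theorem sl_hess_conj (hf : SlSm f) (hx : x ∈ Metric.ball (0 : EuclideanSpace ℝ (Fin n)) 1)
    (U : Matrix (Fin n) (Fin n) ℝ) (e : Fin n → EuclideanSpace ℝ (Fin n))
    (he : ∀ a b, U a b = e b a) :
    (Matrix.of fun j k => sldd (e j) (sldd (e k) f) x) = Uᵀ * Hess f x * U := by
  ext j k
  have hexp : ∀ v : EuclideanSpace ℝ (Fin n), v = ∑ a, v a • EuclideanSpace.single a (1:ℝ) := by
    intro v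
    have := (EuclideanSpace.basisFun (Fin n) ℝ).sum_repr v
    simpa using this.symm
  rw [Matrix.of_apply, sldd_dd hf hx]
  conv_lhs => rw [hexp (e j), hexp (e k)]
  simp only [map_sum, map_smul, _root_.sum_apply, _root_.smul_apply,
    smul_eq_mul, Matrix.mul_apply, Matrix.transpose_apply, he, Finset.sum_mul, Finset.mul_sum,
    sl_hess_apply hf hx, sldd_dd hf hx]

  refine Finset.sum_congr rfl fun a _ => Finset.sum_congr rfl fun b _ => ?_
  ring
end DirDeriv
section MaxPrinciple
open Matrix Filter Topology

theorem sl_second (F F1 : ℝ → ℝ) (F2 : ℝ) (hF : ∀ᶠ t in 𝓝 (0:ℝ), HasDerivAt F (F1 t) t)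
    (hF1 : HasDerivAt F1 F2 0) (hmax : IsLocalMax F 0) : F1 0 = 0 ∧ F2 ≤ 0 := by
  have h0 : F1 0 = 0 := hmax.hasDerivAt_eq_zero hF.self_of_nhds
  refine ⟨h0, ?_⟩
  by_contra hcon
  push Not at hcon
  have h1 : deriv F =ᶠ[𝓝 0] F1 := hF.mono fun t ht => ht.deriv
  have h2 : deriv (deriv F) 0 = F2 := by rw [h1.deriv_eq, hF1.deriv]
  have hmin : IsLocalMin F 0 := isLocalMin_of_deriv_deriv_pos (by rw [h2]; exact hcon)
    (by rw [hF.self_of_nhds.deriv, h0]) hF.self_of_nhds.continuousAt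
  have h3 : F =ᶠ[𝓝 0] fun _ => F 0 := by
    filter_upwards [hmin, hmax] with t h4 h5
    exact le_antisymm h5 h4
  have h4 : deriv F =ᶠ[𝓝 0] fun _ => 0 := by
    have := h3.deriv
    simpa using this
  have h5 : deriv (deriv F) 0 = 0 := by rw [h4.deriv_eq]; simp
  linarith

variable {n : ℕ}

theorem sl_grad_sq (u : EuclideanSpace ℝ (Fin n) → ℝ) (x : EuclideanSpace ℝ (Fin n))
    (e : OrthonormalBasis (Fin n) ℝ (EuclideanSpace ℝ (Fin n))) :
    ‖gradient u x‖ ^ 2 = ∑ k, sldd (e k) u x ^ 2 := by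
  rw [← e.sum_sq_norm_inner_left (gradient u x)]
  refine Finset.sum_congr rfl fun k _ => ?_
  have : inner ℝ (gradient u x) (e k) = sldd (e k) u x := by
    simp [gradient, sldd]
  rw [Real.norm_eq_abs, sq_abs, this]

/-- The cutoff function. -/
noncomputable def slEta (A r δ : ℝ) (u : EuclideanSpace ℝ (Fin n) → ℝ)
    (x : EuclideanSpace ℝ (Fin n)) : ℝ :=
  r ^ 2 - ‖x‖ ^ 2 + A * (‖gradient u x‖ ^ 2 - δ ^ 2)

theorem sl_point (ε A r δ c : ℝ) (hε : 0 < ε) (hε1 : ε ≤ 1)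
    (u : EuclideanSpace ℝ (Fin n) → ℝ) (hu : SlSm u) (b : EuclideanSpace ℝ (Fin n) → ℝ)
    (x : EuclideanSpace ℝ (Fin n)) (hx : x ∈ Metric.ball (0 : EuclideanSpace ℝ (Fin n)) 1)
    (hH : (Hess u x).IsHermitian)
    (hb : ∀ y ∈ Metric.ball (0 : EuclideanSpace ℝ (Fin n)) 1,
      (slB (Hess u y)).det = Complex.exp ((b y : ℂ) + c * Complex.I))
    (hl : ∀ i j, 0 ≤ 3 + (1 - ε) * hH.eigenvalues i ^ 2 + 2 * hH.eigenvalues i * hH.eigenvalues j)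
    (hη : 0 < slEta A r δ u x)
    (hmax : IsLocalMax (fun y => Real.log (slEta A r δ u y) + ε / n * b y) x) :
    ∑ i, (1 + hH.eigenvalues i ^ 2)⁻¹ * (A * hH.eigenvalues i ^ 2 - 1) ≤ 0 := by
  set lam := hH.eigenvalues with hlam
  set e := hH.eigenvectorBasis with he
  set U : Matrix (Fin n) (Fin n) ℝ := (hH.eigenvectorUnitary : Matrix (Fin n) (Fin n) ℝ) with hU
  have hUe : ∀ a b, U a b = e b a := fun a b => rfl
  obtain ⟨hdiag, hUU⟩ := sl_eigU (Hess u x) hH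
  set M : EuclideanSpace ℝ (Fin n) → Matrix (Fin n) (Fin n) ℝ :=
    fun y => Matrix.of fun j k => sldd (e j) (sldd (e k) u) y with hM
  set T : Fin n → Fin n → Fin n → ℝ := fun i j k => sldd (e i) (sldd (e j) (sldd (e k) u)) x with hT
  set Q4 : Fin n → Fin n → Fin n → ℝ :=
    fun i j k => sldd (e i) (sldd (e i) (sldd (e j) (sldd (e k) u))) x with hQ4
  have hM0 : M x = Matrix.diagonal lam := by
    simp only [hM]; rw [sl_hess_conj hu hx U e hUe]; exact hdiag
  have hMdet : ∀ y ∈ Metric.ball (0 : EuclideanSpace ℝ (Fin n)) 1,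
      (slB (M y)).det = Complex.exp ((b y : ℂ) + c * Complex.I) := by
    intro y hy
    simp only [hM]; rw [sl_hess_conj hu hy U e hUe, slB_conj _ _ _ hUU]
    exact hb y hy
  -- derivatives of b along the coordinate lines
  have hpath : ∀ i, ∃ b1 : ℝ → ℝ, ∃ b2 : ℝ,
      (∀ᶠ t in 𝓝 (0:ℝ), HasDerivAt (fun s : ℝ => b (x + s • e i)) (b1 t) t) ∧ HasDerivAt b1 b2 0 ∧
      (b1 0 : ℂ) = ∑ j, slMu (lam j) * (T i j j : ℂ) ∧
      (b2 : ℂ) = ∑ j, slMu (lam j) * (Q4 i j j : ℂ) -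
        ∑ j, ∑ k, slMu (lam j) * slMu (lam k) * ((T i j k : ℂ) * (T i k j : ℂ)) := by
    intro i
    have := sl_path (fun t => M (x + t • e i))
      (fun t => Matrix.of fun j k => sldd (e i) (sldd (e j) (sldd (e k) u)) (x + t • e i))
      (Matrix.of fun j k => Q4 i j k) lam c (fun s : ℝ => b (x + s • e i)) ?_ ?_ ?_ ?_
    · simpa [hT] using this
    · filter_upwards [sl_line_mem hx (e i)] with t ht j k
      exact sldd_line ((hu.dd _).dd _) x (e i) t ht
    · intro j k
      have := sldd_line (((hu.dd (e k)).dd (e j)).dd (e i)) x (e i) 0 (by simpa using hx)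
      simpa [hQ4] using this
    · simpa using hM0
    · filter_upwards [sl_line_mem hx (e i)] with t ht
      exact hMdet _ ht
  choose b1 b2 hb1d hb2d hb1 hb2 using hpath
  -- symmetries
  have hT1 : ∀ i j k, T i j k = T j i k := fun i j k => sldd_comm (hu.dd _) hx _ _
  have hT2 : ∀ i j k, T i j k = T i k j := fun i j k =>
    sldd_congr (fun y hy => sldd_comm hu hy _ _) hx _
  have hQ : ∀ i j, Q4 i j j = Q4 j i i := by
    intro i j
    simp only [hQ4]
    calc sldd (e i) (sldd (e i) (sldd (e j) (sldd (e j) u))) x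
        = sldd (e i) (sldd (e j) (sldd (e i) (sldd (e j) u))) x :=
          sldd_congr (fun y hy => sldd_comm (hu.dd _) hy _ _) hx _
      _ = sldd (e j) (sldd (e i) (sldd (e i) (sldd (e j) u))) x :=
          sldd_comm ((hu.dd _).dd _) hx _ _
      _ = sldd (e j) (sldd (e i) (sldd (e j) (sldd (e i) u))) x :=
          sldd_congr (fun y hy => sldd_congr (fun z hz => sldd_comm hu hz _ _) hy _) hx _
      _ = sldd (e j) (sldd (e j) (sldd (e i) (sldd (e i) u))) x :=
          sldd_congr (fun y hy => sldd_comm (hu.dd _) hy _ _) hx _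
  obtain ⟨hpde, hjac⟩ := sl_algebra lam ε hε hε1 hl T hT1 hT2 (fun i j => Q4 i j j) hQ
    (fun i => b1 i 0) b2 hb1 hb2
  set α := ε / n with hα
  have hα0 : 0 ≤ α := by positivity
  set η0 := slEta A r δ u x with hη0
  -- the second derivative test in each direction
  have hdir : ∀ i, (-2 + 2 * A * lam i ^ 2 + 2 * A * ∑ k, sldd (e k) u x * T k i i) / η0 ≤
      α ^ 2 * b1 i 0 ^ 2 - α * b2 i := by
    intro i
    set η : ℝ → ℝ := fun t => slEta A r δ u (x + t • e i) with hηd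
    set p1 : Fin n → ℝ → ℝ := fun k t => sldd (e k) u (x + t • e i) with hp1
    set p2 : Fin n → ℝ → ℝ := fun k t => sldd (e i) (sldd (e k) u) (x + t • e i) with hp2
    set η1 : ℝ → ℝ := fun t => -(2 * inner ℝ x (e i) + 2 * t) + A * ∑ k, 2 * p1 k t * p2 k t with hη1
    have hp1d : ∀ᶠ t in 𝓝 (0:ℝ), ∀ k, HasDerivAt (p1 k) (p2 k t) t := by
      filter_upwards [sl_line_mem hx (e i)] with t ht k
      exact sldd_line (hu.dd _) x (e i) t ht
    have hp2d : ∀ k, HasDerivAt (p2 k) (T i i k) 0 := by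
      intro k
      have := sldd_line ((hu.dd (e k)).dd (e i)) x (e i) 0 (by simpa using hx)
      simpa [hT] using this
    have hηeq : η = fun t => r ^ 2 - (‖x‖ ^ 2 + (2 * inner ℝ x (e i)) * t + t ^ 2) +
        A * (∑ k, p1 k t ^ 2 - δ ^ 2) := by
      funext t
      simp only [hηd, slEta]
      rw [sl_grad_sq u _ e, norm_add_sq_real, inner_smul_right, norm_smul, e.norm_eq_one,
        Real.norm_eq_abs, mul_one, sq_abs]
      ring
    have hη1d : ∀ᶠ t in 𝓝 (0:ℝ), HasDerivAt η (η1 t) t := by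
      filter_upwards [hp1d] with t ht
      rw [hηeq]
      have h1 : HasDerivAt (fun t => ∑ k, p1 k t ^ 2) (∑ k, 2 * p1 k t * p2 k t) t := by
        refine HasDerivAt.fun_sum fun k _ => ?_
        simpa using (ht k).fun_pow 2
      have h2 : HasDerivAt (fun t : ℝ => ‖x‖ ^ 2 + (2 * inner ℝ x (e i)) * t + t ^ 2)
          (2 * inner ℝ x (e i) + 2 * t) t := by
        have h3 := ((hasDerivAt_id t).const_mul (2 * inner ℝ x (e i))).const_add (‖x‖ ^ 2)
        have h4 := h3.add ((hasDerivAt_id t).fun_pow 2)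
        simpa [Pi.add_def] using h4
      exact (h2.const_sub (r ^ 2)).add ((h1.sub_const (δ ^ 2)).const_mul A)
    have hp20 : ∀ k, p2 k 0 = if i = k then lam i else 0 := by
      intro k
      have := congrFun (congrFun hM0 i) k
      simp only [hM, Matrix.of_apply, Matrix.diagonal_apply] at this
      simpa [hp2] using this
    have hη2d : HasDerivAt η1 (-2 + 2 * A * lam i ^ 2 + 2 * A * ∑ k, sldd (e k) u x * T k i i) 0 := by
      have h1 : HasDerivAt (fun t => ∑ k, 2 * p1 k t * p2 k t)
          (∑ k, (2 * p2 k 0 * p2 k 0 + 2 * p1 k 0 * T i i k)) 0 := by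
        refine HasDerivAt.fun_sum fun k _ => ?_
        exact ((hp1d.self_of_nhds k).const_mul 2).mul (hp2d k)
      have h2 : HasDerivAt (fun t : ℝ => -(2 * inner ℝ x (e i) + 2 * t)) (-2) 0 := by
        have := (((hasDerivAt_id (0:ℝ)).const_mul 2).const_add (2 * inner ℝ x (e i))).neg
        simpa [Pi.neg_def] using this
      have h3 := h2.add (h1.const_mul A)
      refine HasDerivAt.congr_deriv h3 ?_
      rw [Finset.sum_add_distrib]
      have e1 : ∑ k, 2 * p2 k 0 * p2 k 0 = 2 * lam i ^ 2 := by
        simp only [hp20]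
        simp
        ring
      have e2 : ∑ k, 2 * p1 k 0 * T i i k = 2 * ∑ k, sldd (e k) u x * T k i i := by
        rw [Finset.mul_sum]
        refine Finset.sum_congr rfl fun k _ => ?_
        rw [hT1 k i i, hT2 i k i]
        simp [hp1, mul_assoc]
      rw [e1, e2]; ring
    have hη00 : η 0 = η0 := by simp [hηd, hη0]
    have hηpos : ∀ᶠ t in 𝓝 (0:ℝ), 0 < η t :=
      hη1d.self_of_nhds.continuousAt.eventually (lt_mem_nhds (by rw [hη00]; exact hη))
    have hline : IsLocalMax (fun t : ℝ => Real.log (η t) + α * b (x + t • e i)) 0 := by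
      have hc : ContinuousAt (fun t : ℝ => x + t • e i) 0 := by fun_prop
      have : Tendsto (fun t : ℝ => x + t • e i) (𝓝 0) (𝓝 x) := by
        simpa [ContinuousAt] using hc
      have h5 := this.eventually hmax
      show ∀ᶠ t in 𝓝 (0:ℝ), _
      filter_upwards [h5] with t ht
      simpa [hηd] using ht
    obtain ⟨g1, g2⟩ := sl_second _ (fun t => η1 t / η t + α * b1 i t)
      (((-2 + 2 * A * lam i ^ 2 + 2 * A * ∑ k, sldd (e k) u x * T k i i) * η 0 - η1 0 * η1 0) / η 0 ^ 2
        + α * b2 i) (by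
        filter_upwards [hη1d, hηpos, hb1d i] with t h6 h7 h8
        exact (h6.log h7.ne').add (h8.const_mul α))
      ((hη2d.fun_div hη1d.self_of_nhds (by rw [hη00]; exact hη.ne')).add ((hb2d i).const_mul α)) hline
    rw [hη00] at g1 g2
    have g3 : η1 0 / η0 = -(α * b1 i 0) := by linarith
    have g4 : ((-2 + 2 * A * lam i ^ 2 + 2 * A * ∑ k, sldd (e k) u x * T k i i) * η0 - η1 0 * η1 0) / η0 ^ 2
        = (-2 + 2 * A * lam i ^ 2 + 2 * A * ∑ k, sldd (e k) u x * T k i i) / η0 - (η1 0 / η0) ^ 2 := by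
      field_simp
    rw [g4, g3] at g2
    nlinarith
  -- sum up
  have hgpos : ∀ i, 0 < (1 + lam i ^ 2)⁻¹ := fun i => by positivity
  have hsum : ∑ i, (1 + lam i ^ 2)⁻¹ *
      ((-2 + 2 * A * lam i ^ 2 + 2 * A * ∑ k, sldd (e k) u x * T k i i) / η0) ≤
      ∑ i, (1 + lam i ^ 2)⁻¹ * (α ^ 2 * b1 i 0 ^ 2 - α * b2 i) :=
    Finset.sum_le_sum fun i _ => mul_le_mul_of_nonneg_left (hdir i) (hgpos i).le
  have hR : ∑ i, (1 + lam i ^ 2)⁻¹ * (α ^ 2 * b1 i 0 ^ 2 - α * b2 i) =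
      α * (α * ∑ i, (1 + lam i ^ 2)⁻¹ * b1 i 0 ^ 2 - ∑ i, (1 + lam i ^ 2)⁻¹ * b2 i) := by
    rw [mul_sub, Finset.mul_sum, Finset.mul_sum, Finset.mul_sum, ← Finset.sum_sub_distrib]
    exact Finset.sum_congr rfl fun i _ => by ring
  have hR0 : ∑ i, (1 + lam i ^ 2)⁻¹ * (α ^ 2 * b1 i 0 ^ 2 - α * b2 i) ≤ 0 := by
    rw [hR]
    exact mul_nonpos_of_nonneg_of_nonpos hα0 (by linarith)
  have hz : ∑ i, (1 + lam i ^ 2)⁻¹ * ∑ k, sldd (e k) u x * T k i i = 0 := by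
    simp only [Finset.mul_sum]
    rw [Finset.sum_comm]
    refine Finset.sum_eq_zero fun k _ => ?_
    have : ∑ i, (1 + lam i ^ 2)⁻¹ * (sldd (e k) u x * T k i i) =
        sldd (e k) u x * ∑ i, (1 + lam i ^ 2)⁻¹ * T k i i := by
      rw [Finset.mul_sum]
      exact Finset.sum_congr rfl fun i _ => by ring
    rw [this, hpde k, mul_zero]
  have hL : ∑ i, (1 + lam i ^ 2)⁻¹ *
      ((-2 + 2 * A * lam i ^ 2 + 2 * A * ∑ k, sldd (e k) u x * T k i i) / η0) =
      2 / η0 * ∑ i, (1 + lam i ^ 2)⁻¹ * (A * lam i ^ 2 - 1) +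
      2 * A / η0 * ∑ i, (1 + lam i ^ 2)⁻¹ * ∑ k, sldd (e k) u x * T k i i := by
    rw [Finset.mul_sum (s := Finset.univ) (a := 2 / η0), Finset.mul_sum (s := Finset.univ) (a := 2 * A / η0), ← Finset.sum_add_distrib]
    exact Finset.sum_congr rfl fun i _ => by ring
  rw [hL, hz, mul_zero, add_zero] at hsum
  have h9 := hsum.trans hR0
  have h10 : 0 < 2 / η0 := by positivity
  by_contra hcon
  push Not at hcon
  have := mul_pos h10 hcon
  linarith
end MaxPrinciple
section Final
open Matrix Filter Topology

variable {n : ℕ}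

theorem sl_bound (hn : 1 ≤ n) (ε A r δ κ c : ℝ) (hε : 0 < ε) (hε1 : ε ≤ 1)
    (hA : (n : ℝ) - 1 < A) (hδ0 : 0 ≤ δ) (hr0 : 0 < r) (hr1 : r < 1) (hκ : 0 < κ)
    (hrκ : κ ≤ r ^ 2 - A * δ ^ 2)
    (u : EuclideanSpace ℝ (Fin n) → ℝ) (hu : SlSm u)
    (hsym : ∀ x ∈ Metric.ball (0 : EuclideanSpace ℝ (Fin n)) 1, (Hess u x).IsHermitian)
    (hpde : ∀ x, ∀ hx : x ∈ Metric.ball (0 : EuclideanSpace ℝ (Fin n)) 1,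
        ∑ i, Real.arctan ((hsym x hx).eigenvalues i) = c)
    (hl : ∀ x, ∀ hx : x ∈ Metric.ball (0 : EuclideanSpace ℝ (Fin n)) 1, ∀ i j : Fin n,
        0 ≤ 3 + (1 - ε) * ((hsym x hx).eigenvalues i) ^ 2 +
          2 * (hsym x hx).eigenvalues i * (hsym x hx).eigenvalues j)
    (hgrad : ∀ x ∈ Metric.ball (0 : EuclideanSpace ℝ (Fin n)) 1, ‖gradient u x‖ ≤ δ)
    (i : Fin n) :
    |(hsym 0 (Metric.mem_ball_self one_pos)).eigenvalues i| ≤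
      Real.exp (∑ _i : Fin n, 1/2 * Real.log ((A + 1) / (A - (n - 1))) - Real.log κ / (ε / n)) := by
  have hn1 : (1:ℝ) ≤ n := by exact_mod_cast hn
  have hA0 : 0 < A := by linarith
  set α := ε / n with hα
  have hαpos : 0 < α := by positivity
  set b : EuclideanSpace ℝ (Fin n) → ℝ := fun y => Real.log ‖(slB (Hess u y)).det‖ with hb
  have hbval : ∀ y, ∀ hy : y ∈ Metric.ball (0 : EuclideanSpace ℝ (Fin n)) 1,
      b y = ∑ i, 1/2 * Real.log (1 + (hsym y hy).eigenvalues i ^ 2) := by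
    intro y hy
    simp only [hb]
    rw [sl_det _ (hsym y hy), Complex.norm_exp, Real.log_exp]
    simp [-Complex.ofReal_sum]
  have hbdet : ∀ y ∈ Metric.ball (0 : EuclideanSpace ℝ (Fin n)) 1,
      (slB (Hess u y)).det = Complex.exp ((b y : ℂ) + c * Complex.I) := by
    intro y hy
    rw [hbval y hy, sl_det _ (hsym y hy), hpde y hy]
  have hcH : ContinuousOn (fun y => Hess u y) (Metric.ball 0 1) := by
    refine continuousOn_pi.2 fun j => continuousOn_pi.2 fun k => ?_
    refine ContinuousOn.congr (f := sldd (EuclideanSpace.single j 1)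
      (sldd (EuclideanSpace.single k 1) u)) ?_ fun y hy => sl_hess_apply hu hy j k
    exact ContDiffOn.continuousOn ((hu.dd _).dd _)
  have hcb : ContinuousOn b (Metric.ball 0 1) := by
    have h1 : Continuous (fun M : Matrix (Fin n) (Fin n) ℝ => ‖(slB M).det‖) := by
      unfold slB
      refine (Continuous.matrix_det ?_).norm
      refine continuous_const.add ?_
      have h0 : Continuous (fun M : Matrix (Fin n) (Fin n) ℝ => M.map Complex.ofReal) :=
        continuous_id.matrix_map Complex.continuous_ofReal
      exact h0.const_smul Complex.I
    refine ContinuousOn.log (h1.comp_continuousOn hcH) ?_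
    intro y hy
    rw [hbdet y hy]
    simp
  have hcη : ContinuousOn (slEta A r δ u) (Metric.ball 0 1) := by
    have h1 : ContinuousOn (fun y => ‖gradient u y‖ ^ 2) (Metric.ball 0 1) := by
      have e1 : (fun y => ‖gradient u y‖ ^ 2) = fun y => ‖fderiv ℝ u y‖ ^ 2 := by
        funext y
        simp [gradient]
      rw [e1]
      exact (hu.fderiv'.continuousOn.norm).pow 2
    unfold slEta
    refine ContinuousOn.add (by fun_prop) (continuousOn_const.mul (h1.sub continuousOn_const))
  have hsub : Metric.closedBall (0 : EuclideanSpace ℝ (Fin n)) r ⊆ Metric.ball 0 1 :=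
    Metric.closedBall_subset_ball hr1
  have hcΦ : ContinuousOn (fun y => slEta A r δ u y * Real.exp (α * b y))
      (Metric.closedBall (0 : EuclideanSpace ℝ (Fin n)) r) :=
    (hcη.mono hsub).mul ((continuousOn_const.mul (hcb.mono hsub)).rexp)
  obtain ⟨x, hxr, hxmax⟩ := (isCompact_closedBall (0 : EuclideanSpace ℝ (Fin n)) r).exists_isMaxOn
    ⟨0, Metric.mem_closedBall_self hr0.le⟩ hcΦ
  have h0r : (0 : EuclideanSpace ℝ (Fin n)) ∈ Metric.closedBall 0 r := Metric.mem_closedBall_self hr0.le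
  have hηle : ∀ y ∈ Metric.ball (0 : EuclideanSpace ℝ (Fin n)) 1, slEta A r δ u y ≤ r ^ 2 - ‖y‖ ^ 2 := by
    intro y hy
    have h1 := hgrad y hy
    have h2 : ‖gradient u y‖ ^ 2 ≤ δ ^ 2 := pow_le_pow_left₀ (norm_nonneg _) h1 2
    unfold slEta
    nlinarith
  have hη0 : κ ≤ slEta A r δ u 0 := by
    unfold slEta
    simp only [norm_zero]
    nlinarith [mul_nonneg hA0.le (sq_nonneg ‖gradient u (0 : EuclideanSpace ℝ (Fin n))‖)]
  have hcmp : slEta A r δ u 0 * Real.exp (α * b 0) ≤ slEta A r δ u x * Real.exp (α * b x) := hxmax h0r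
  have hηx : 0 < slEta A r δ u x := by
    have h1 : 0 < slEta A r δ u x * Real.exp (α * b x) :=
      lt_of_lt_of_le (mul_pos (hκ.trans_le hη0) (Real.exp_pos _)) hcmp
    exact pos_of_mul_pos_left h1 (Real.exp_pos _).le
  have hx1 : x ∈ Metric.ball (0 : EuclideanSpace ℝ (Fin n)) 1 := hsub hxr
  have hxlt : ‖x‖ < r := by
    have h1 := hηle x hx1
    have h2 : ‖x‖ ^ 2 < r ^ 2 := by linarith
    exact lt_of_pow_lt_pow_left₀ 2 hr0.le h2
  have hlogmul : ∀ y, 0 < slEta A r δ u y →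
      Real.log (slEta A r δ u y * Real.exp (α * b y)) = Real.log (slEta A r δ u y) + α * b y := by
    intro y hy
    rw [Real.log_mul hy.ne' (Real.exp_ne_zero _), Real.log_exp]
  have hlocal : IsLocalMax (fun y => Real.log (slEta A r δ u y) + ε / n * b y) x := by
    have h1 : ∀ᶠ y in 𝓝 x, y ∈ Metric.closedBall (0 : EuclideanSpace ℝ (Fin n)) r := by
      filter_upwards [Metric.isOpen_ball.mem_nhds (show x ∈ Metric.ball 0 r by simpa using hxlt)]
        with y hy using Metric.ball_subset_closedBall hy
    have h2 : ∀ᶠ y in 𝓝 x, 0 < slEta A r δ u y :=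
      (hcη.continuousAt (Metric.isOpen_ball.mem_nhds hx1)).eventually (lt_mem_nhds hηx)
    show ∀ᶠ y in 𝓝 x, _
    filter_upwards [h1, h2] with y hy hyp
    rw [← hα, ← hlogmul y hyp, ← hlogmul x hηx]
    exact Real.log_le_log (mul_pos hyp (Real.exp_pos _)) (hxmax hy)
  have hpt := sl_point ε A r δ c hε hε1 u hu b x hx1 (hsym x hx1) hbdet (hl x hx1) hηx hlocal
  set lam := (hsym x hx1).eigenvalues with hlam
  have hlamle : ∀ j, 1 + lam j ^ 2 ≤ (A + 1) / (A - (n - 1)) := by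
    intro j
    have e1 : ∀ k, (1 + lam k ^ 2)⁻¹ * (A * lam k ^ 2 - 1) = A - (A + 1) * (1 + lam k ^ 2)⁻¹ := by
      intro k
      have : 1 + lam k ^ 2 ≠ 0 := by positivity
      field_simp
      ring
    have e2 : ∀ k, (1 + lam k ^ 2)⁻¹ ≤ 1 := fun k => inv_le_one_of_one_le₀ (by nlinarith [sq_nonneg (lam k)])
    rw [← Finset.add_sum_erase _ _ (Finset.mem_univ j)] at hpt
    have e3 : ∑ k ∈ Finset.univ.erase j, (-1:ℝ) ≤
        ∑ k ∈ Finset.univ.erase j, (1 + lam k ^ 2)⁻¹ * (A * lam k ^ 2 - 1) := by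
      refine Finset.sum_le_sum fun k _ => ?_
      rw [e1]
      nlinarith [e2 k]
    have e4 : ∑ k ∈ Finset.univ.erase j, (-1:ℝ) = -((n:ℝ) - 1) := by
      rw [Finset.sum_const, Finset.card_erase_of_mem (Finset.mem_univ j), Finset.card_univ,
        Fintype.card_fin, nsmul_eq_mul, Nat.cast_sub hn]
      push_cast; ring
    rw [e1 j] at hpt
    rw [e4] at e3
    have e5 : A - (n - 1) ≤ (A + 1) * (1 + lam j ^ 2)⁻¹ := by linarith
    have hp : 0 < 1 + lam j ^ 2 := by positivity
    rw [le_div_iff₀ (by linarith)]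
    calc (1 + lam j ^ 2) * (A - (n - 1)) ≤ (1 + lam j ^ 2) * ((A + 1) * (1 + lam j ^ 2)⁻¹) :=
          mul_le_mul_of_nonneg_left e5 hp.le
      _ = A + 1 := by field_simp
  have hbx : b x ≤ ∑ _i : Fin n, 1/2 * Real.log ((A + 1) / (A - (n - 1))) := by
    rw [hbval x hx1]
    refine Finset.sum_le_sum fun j _ => ?_
    have := Real.log_le_log (by positivity) (hlamle j)
    linarith
  have hlogs : Real.log κ + α * b 0 ≤ α * b x := by
    have h1 : Real.log (slEta A r δ u 0) + α * b 0 ≤ Real.log (slEta A r δ u x) + α * b x := by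
      rw [← hlogmul x hηx, ← hlogmul 0 (hκ.trans_le hη0)]
      exact Real.log_le_log (mul_pos (hκ.trans_le hη0) (Real.exp_pos _)) hcmp
    have h2 : Real.log (slEta A r δ u x) ≤ 0 := by
      apply Real.log_nonpos hηx.le
      have := hηle x hx1
      nlinarith [sq_nonneg ‖x‖]
    have h3 := Real.log_le_log hκ hη0
    linarith
  have hb0 : b 0 ≤ ∑ _i : Fin n, 1/2 * Real.log ((A + 1) / (A - (n - 1))) - Real.log κ / α := by
    have h1 : b 0 ≤ b x - Real.log κ / α := by
      have : α * b 0 ≤ α * (b x - Real.log κ / α) := by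
        rw [mul_sub, mul_div_cancel₀ _ hαpos.ne']
        linarith
      exact le_of_mul_le_mul_left this hαpos
    linarith
  refine le_trans ?_ (Real.exp_le_exp.2 hb0)
  rw [hbval 0 (Metric.mem_ball_self one_pos)]
  set mu := (hsym 0 (Metric.mem_ball_self one_pos)).eigenvalues with hmu
  have h1 : 1/2 * Real.log (1 + mu i ^ 2) ≤ ∑ i, 1/2 * Real.log (1 + mu i ^ 2) := by
    refine Finset.single_le_sum (f := fun i => 1/2 * Real.log (1 + mu i ^ 2)) (fun k _ => ?_) (Finset.mem_univ i)
    have := Real.log_nonneg (show 1 ≤ 1 + mu k ^ 2 by nlinarith [sq_nonneg (mu k)])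
    positivity
  refine le_trans ?_ (Real.exp_le_exp.2 h1)
  have h2 : Real.exp (1/2 * Real.log (1 + mu i ^ 2)) = Real.sqrt (1 + mu i ^ 2) := by
    rw [Real.sqrt_eq_rpow, Real.rpow_def_of_pos (by positivity)]; ring_nf
  rw [h2]
  apply Real.le_sqrt_of_sq_le
  rw [sq_abs]; linarith
end Final

/-- Interior Hessian estimate on the unit ball (Lemma 2.2). -/
theorem stmt_7 {n : ℕ} (hn : 2 ≤ n) (ε : ℝ) (hε : 0 < ε)
    (δ : ℝ) (hδ0 : 0 ≤ δ) (hδ : δ < 1 / Real.sqrt ((n : ℝ) - 1)) :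
    ∃ C : ℝ, ∀ (c : ℝ) (u : EuclideanSpace ℝ (Fin n) → ℝ),
      ContDiffOn ℝ (⊤ : ℕ∞) u (Metric.ball 0 1) →
      ∀ hsym : ∀ x ∈ Metric.ball (0 : EuclideanSpace ℝ (Fin n)) 1, (Hess u x).IsHermitian,
      (∀ x, ∀ hx : x ∈ Metric.ball (0 : EuclideanSpace ℝ (Fin n)) 1,
        ∑ i, Real.arctan ((hsym x hx).eigenvalues i) = c) →
      (∀ x, ∀ hx : x ∈ Metric.ball (0 : EuclideanSpace ℝ (Fin n)) 1, ∀ i j : Fin n,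
        0 ≤ 3 + (1 - ε) * ((hsym x hx).eigenvalues i) ^ 2 +
          2 * (hsym x hx).eigenvalues i * (hsym x hx).eigenvalues j) →
      (∀ x ∈ Metric.ball (0 : EuclideanSpace ℝ (Fin n)) 1, ‖gradient u x‖ ≤ δ) →
      ∀ i : Fin n,
        |(hsym 0 (Metric.mem_ball_self one_pos)).eigenvalues i| ≤ C := by
  have hn2 : (2:ℝ) ≤ n := by exact_mod_cast hn
  have hN : 0 < (n:ℝ) - 1 := by linarith
  have hNδ : ((n:ℝ) - 1) * δ ^ 2 < 1 := by
    have hs : 0 < Real.sqrt ((n:ℝ) - 1) := Real.sqrt_pos.2 hN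
    rw [lt_div_iff₀ hs] at hδ
    have h1 : (δ * Real.sqrt ((n:ℝ) - 1)) ^ 2 < 1 :=
      pow_lt_one₀ (by positivity) hδ (by norm_num)
    rw [mul_pow, Real.sq_sqrt hN.le] at h1
    linarith
  obtain ⟨A, hA, hAδ⟩ : ∃ A : ℝ, (n:ℝ) - 1 < A ∧ A * δ ^ 2 < 1 := by
    have hd : 0 < δ ^ 2 + 1 := by positivity
    refine ⟨(n:ℝ) - 1 + (1 - ((n:ℝ) - 1) * δ ^ 2) / 2 / (δ ^ 2 + 1), ?_, ?_⟩
    · have : 0 < (1 - ((n:ℝ) - 1) * δ ^ 2) / 2 / (δ ^ 2 + 1) := div_pos (by linarith) hd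
      linarith
    · have h1 : (1 - ((n:ℝ) - 1) * δ ^ 2) / 2 / (δ ^ 2 + 1) * δ ^ 2 ≤
          (1 - ((n:ℝ) - 1) * δ ^ 2) / 2 := by
        rw [div_mul_eq_mul_div, div_le_iff₀ hd]
        nlinarith
      rw [add_mul]
      linarith
  have hA0 : 0 < A := hN.trans hA
  have hAδ0 : 0 ≤ A * δ ^ 2 := by positivity
  set r : ℝ := Real.sqrt ((1 + A * δ ^ 2) / 2) with hr
  have hr2 : r ^ 2 = (1 + A * δ ^ 2) / 2 := Real.sq_sqrt (by positivity)
  have hr0 : 0 < r := Real.sqrt_pos.2 (by positivity)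
  have hr1 : r < 1 := by nlinarith
  refine ⟨_, fun c u hu hsym hpde hl hgrad i => sl_bound (by omega) (min ε 1) A r δ
    ((1 - A * δ ^ 2) / 2) c (lt_min hε one_pos) (min_le_right _ _) hA hδ0 hr0 hr1 (by linarith)
    (by rw [hr2]; linarith) u hu hsym hpde (fun x hx i j => ?_) hgrad i⟩
  have h1 := hl x hx i j
  have h2 : min ε 1 ≤ ε := min_le_left _ _
  nlinarith [sq_nonneg ((hsym x hx).eigenvalues i)]
end

section
/- Let n ≥ 2, ε > 0, 0 ≤ δ < 1/√(n−1), and set α = (1/√(n−1) − δ)/2 (assume δ > 0 so that δ/α is defined, or interpret with ∇u(0)=0 accordingly). If u is a smooth solution to the special Lagrangian equation ∑_{i=1}^n arctan λᵢ(x) = c on the unit ball B₁(0) ⊂ ℝⁿ satisfying 3 + (1−ε)λᵢ(x)² + 2λᵢ(x)λⱼ(x) ≥ 0 for all i, j and all x, and |∇u(x)| ≤ δ on B₁(0), then every eigenvalue λᵢ(0) of D²u(0) satisfies the explicit bound 1 + λᵢ(0)² ≤ (1 + δ/α)^{4n/ε} · [ (1 + (α+δ)²) / (1 − (n−1)(α+δ)²)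 ]ⁿ. -/
section
open Filter Topology

section Calc
variable {E : Type*} [NormedAddCommGroup E] [NormedSpace ℝ E]
variable {F : Type*} [NormedAddCommGroup F] [NormedSpace ℝ F]

/-- Directional derivative. -/
noncomputable def DD (v : E) (f : E → F) : E → F := fun x => fderiv ℝ f x v

/-- Smooth at a point. -/
def SM (f : E → F) (x : E) : Prop := ContDiffAt ℝ (⊤ : ℕ∞) f x

lemma SM.diff {f : E → F} {x : E} (h : SM f x) : DifferentiableAt ℝ f x :=
  ContDiffAt.differentiableAt h (by simp)

lemma SM.dd {f : E → F} {x : E} (h : SM f x) (v : E) : SM (DD v f) x := by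
  have h1 : ContDiffAt ℝ (⊤ : ℕ∞) (fderiv ℝ f) x := ContDiffAt.fderiv_right h (by simp)
  exact h1.clm_apply contDiffAt_const

lemma SM.ev_diff {f : E → F} {x : E} (h : SM f x) : ∀ᶠ y in 𝓝 x, DifferentiableAt ℝ f y := by
  have h1 : ContDiffAt ℝ 1 f x := ContDiffAt.of_le h (by norm_cast)
  filter_upwards [h1.eventually (by simp)] with y hy using hy.differentiableAt (by simp)

lemma DD_DD_eq {f : E → F} {x : E} (h : ContDiffAt ℝ 2 f x) (a b : E) :
    DD a (DD b f) x = fderiv ℝ (fderiv ℝ f) x a b := by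
  have hd : DifferentiableAt ℝ (fderiv ℝ f) x :=
    (h.fderiv_right (m := 1) (by norm_num)).differentiableAt (by simp)
  have h2 : HasFDerivAt (fun y => fderiv ℝ f y b) _ x :=
    hd.hasFDerivAt.clm_apply (hasFDerivAt_const b x)
  change fderiv ℝ (fun y => fderiv ℝ f y b) x a = _
  rw [h2.fderiv]
  simp

lemma DD_comm {f : E → F} {x : E} (h : ContDiffAt ℝ 2 f x) (v w : E) :
    DD v (DD w f) x = DD w (DD v f) x := by
  have hs : IsSymmSndFDerivAt ℝ f x := h.isSymmSndFDerivAt (by simp)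
  have hd : DifferentiableAt ℝ (fderiv ℝ f) x :=
    (h.fderiv_right (m := 1) (by norm_num)).differentiableAt (by simp)
  rw [DD_DD_eq h, DD_DD_eq h, hs.eq]

lemma SM.comm {f : E → F} {x : E} (h : SM f x) (v w : E) :
    DD v (DD w f) =ᶠ[𝓝 x] DD w (DD v f) := by
  have h1 : ContDiffAt ℝ 2 f x := ContDiffAt.of_le h (by norm_cast)
  filter_upwards [h1.eventually (by simp)] with y hy using DD_comm hy v w

lemma DD_congr {f g : E → F} {x : E} (h : f =ᶠ[𝓝 x] g) (v : E) : DD v f =ᶠ[𝓝 x] DD v g := by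
  filter_upwards [h.fderiv (𝕜 := ℝ)] with y hy
  simp [DD, hy]

lemma DD_const (v : E) (a : F) : DD v (fun _ : E => a) = fun _ => 0 := by
  ext x; simp [DD]

lemma DD_add {f g : E → F} {x : E} (hf : DifferentiableAt ℝ f x) (hg : DifferentiableAt ℝ g x)
    (v : E) : DD v (fun y => f y + g y) x = DD v f x + DD v g x := by
  simp [DD, fderiv_fun_add hf hg]

lemma DD_sum {ι : Type*} {s : Finset ι} {f : ι → E → F} {x : E}
    (hf : ∀ i ∈ s, DifferentiableAt ℝ (f i) x)
    (v : E) : DD v (fun y => ∑ i ∈ s, f i y) x = ∑ i ∈ s, DD v (f i) x := by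
  simp [DD, fderiv_fun_sum hf]

variable {A : Type*} [NormedCommRing A] [NormedAlgebra ℝ A]

lemma DD_mul {f g : E → A} {x : E} (hf : DifferentiableAt ℝ f x) (hg : DifferentiableAt ℝ g x)
    (v : E) : DD v (fun y => f y * g y) x = f x * DD v g x + DD v f x * g x := by
  simp [DD, fderiv_fun_mul hf hg, mul_comm]

lemma DD_const_mul {g : E → A} {x : E} (a : A) (hg : DifferentiableAt ℝ g x)
    (v : E) : DD v (fun y => a * g y) x = a * DD v g x := by
  simp [DD, fderiv_const_mul hg]

lemma DD_ofReal {f : E → ℝ} {x : E} (hf : DifferentiableAt ℝ f x) (v : E) :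
    DD v (fun y => (f y : ℂ)) x = ((DD v f x : ℝ) : ℂ) := by
  have h := (Complex.ofRealCLM.hasFDerivAt (x := f x)).comp x hf.hasFDerivAt
  have h2 : fderiv ℝ (fun y => (f y : ℂ)) x = Complex.ofRealCLM.comp (fderiv ℝ f x) := h.fderiv
  simp [DD, h2]

lemma SM.ofReal {f : E → ℝ} {x : E} (hf : SM f x) : SM (fun y => (f y : ℂ)) x :=
  Complex.ofRealCLM.contDiff.contDiffAt.comp x hf

lemma SM.re {f : E → ℂ} {x : E} (hf : SM f x) : SM (fun y => (f y).re) x :=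
  Complex.reCLM.contDiff.contDiffAt.comp x hf

lemma SM.sum {ι : Type*} {s : Finset ι} {f : ι → E → F} {x : E} (h : ∀ i ∈ s, SM (f i) x) :
    SM (fun y => ∑ i ∈ s, f i y) x := ContDiffAt.sum h

lemma SM.mul {f g : E → A} {x : E} (hf : SM f x) (hg : SM g x) : SM (fun y => f y * g y) x :=
  ContDiffAt.mul hf hg

lemma SM.const (a : F) (x : E) : SM (fun _ => a) x := contDiffAt_const

/-- Second derivative test along a line. -/
lemma DD2_nonpos {f : E → ℝ} {x : E} (hf : SM f x) (hm : IsLocalMax f x) (v : E) :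
    DD v f x = 0 ∧ DD v (DD v f) x ≤ 0 := by
  have h0 : fderiv ℝ f x = 0 := hm.fderiv_eq_zero
  refine ⟨by simp [DD, h0], ?_⟩
  set l : ℝ → E := fun t => x + t • v with hl
  have hl0 : l 0 = x := by simp [hl]
  have hlc : Tendsto l (𝓝 0) (𝓝 x) := by
    have : Continuous l := by fun_prop
    simpa [hl0] using this.tendsto 0
  have hld : ∀ t, HasDerivAt l v t := fun t => by
    simpa [hl] using ((hasDerivAt_id t).smul_const v).const_add x
  have gen : ∀ g : E → ℝ, ∀ t, DifferentiableAt ℝ g (l t) →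
      HasDerivAt (fun t => g (l t)) (DD v g (l t)) t := fun g t hg =>
    hg.hasFDerivAt.comp_hasDerivAt t (hld t)
  have hd1 : deriv (fun t => f (l t)) =ᶠ[𝓝 0] fun t => DD v f (l t) := by
    filter_upwards [hlc.eventually hf.ev_diff] with t ht using (gen f t ht).deriv
  have hd2 : deriv (deriv (fun t => f (l t))) 0 = DD v (DD v f) x := by
    rw [hd1.deriv_eq, (gen (DD v f) 0 (by rw [hl0]; exact (hf.dd v).diff)).deriv, hl0]
  by_contra! hc
  have hmax : IsLocalMax (fun t => f (l t)) 0 := by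
    have := hlc.eventually hm
    simpa [IsLocalMax, IsMaxFilter, hl0] using this
  have hmin : IsLocalMin (fun t => f (l t)) 0 := by
    apply isLocalMin_of_deriv_deriv_pos
    · rw [hd2]; exact hc
    · exact hmax.deriv_eq_zero
    · exact (gen f 0 (by rw [hl0]; exact hf.diff)).continuousAt
  have hcst : (fun t => f (l t)) =ᶠ[𝓝 0] fun _ => f x := by
    filter_upwards [hmax, hmin] with t h1 h2
    simp only [hl0] at h1 h2
    exact le_antisymm h1 h2
  have : deriv (deriv (fun t => f (l t))) 0 = 0 := by
    rw [hcst.deriv.deriv_eq]; simp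
  linarith

variable {n : ℕ}

lemma SM.prod {ι : Type*} {s : Finset ι} {f : ι → E → A} {x : E} (h : ∀ i ∈ s, SM (f i) x) :
    SM (fun y => ∏ i ∈ s, f i y) x := contDiffAt_prod h

lemma SM.det {M : E → Matrix (Fin n) (Fin n) ℂ} {x : E} (h : ∀ i j, SM (fun y => M y i j) x) :
    SM (fun y => (M y).det) x := by
  simp only [Matrix.det_apply']
  exact SM.sum fun σ _ => (SM.const _ x).mul (SM.prod fun i _ => h _ _)

lemma SM.matinv {M : E → Matrix (Fin n) (Fin n) ℂ} {x : E} (h : ∀ i j, SM (fun y => M y i j) x)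
    (hd : (M x).det ≠ 0) (i j : Fin n) : SM (fun y => (M y)⁻¹ i j) x := by
  simp only [Matrix.inv_def, Ring.inverse_eq_inv', Matrix.smul_apply, smul_eq_mul,
    Matrix.adjugate_apply]
  refine SM.mul ?_ ?_
  · exact ContDiffAt.inv (SM.det h) hd
  · apply SM.det
    intro a b
    simp only [Matrix.updateRow_apply]
    split_ifs
    · exact SM.const _ x
    · exact h a b

lemma DD_det {M : E → Matrix (Fin n) (Fin n) ℂ} {x : E}
    (h : ∀ i j, DifferentiableAt ℝ (fun y => M y i j) x) (hd : (M x).det ≠ 0) (v : E) :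
    DD v (fun y => (M y).det) x =
      (M x).det * ∑ i, ∑ j, (M x)⁻¹ i j * DD v (fun y => M y j i) x := by
  have h1 : ∀ σ : Equiv.Perm (Fin n), HasFDerivAt (fun y => ∏ i, M y (σ i) i)
      (∑ i, (∏ j ∈ Finset.univ.erase i, M x (σ j) j) • fderiv ℝ (fun y => M y (σ i) i) x) x :=
    fun σ => HasFDerivAt.finsetProd (fun i _ => (h _ _).hasFDerivAt)
  have h2 : HasFDerivAt (fun y => (M y).det)
      (∑ σ : Equiv.Perm (Fin n), ((Equiv.Perm.sign σ : ℤ) : ℂ) •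
        (∑ i, (∏ j ∈ Finset.univ.erase i, M x (σ j) j) • fderiv ℝ (fun y => M y (σ i) i) x)) x := by
    simp only [Matrix.det_apply']
    exact HasFDerivAt.fun_sum fun σ _ => (h1 σ).const_mul _
  have h3 : ∀ i, ((M x).updateCol i (fun j => DD v (fun y => M y j i) x)).det =
      ∑ σ : Equiv.Perm (Fin n), ((Equiv.Perm.sign σ : ℤ) : ℂ) *
        ((∏ j ∈ Finset.univ.erase i, M x (σ j) j) * DD v (fun y => M y (σ i) i) x) := by
    intro i
    rw [Matrix.det_apply']
    refine Finset.sum_congr rfl fun σ _ => ?_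
    congr 1
    rw [← Finset.prod_erase_mul _ _ (Finset.mem_univ i)]
    congr 1
    · refine Finset.prod_congr rfl fun j hj => ?_
      rw [Matrix.updateCol_ne (Finset.ne_of_mem_erase hj)]
    · simp
  have h4 : ∀ i, ((M x).updateCol i (fun j => DD v (fun y => M y j i) x)).det =
      (M x).det * ∑ j, (M x)⁻¹ i j * DD v (fun y => M y j i) x := by
    intro i
    rw [← Matrix.cramer_apply, Matrix.cramer_eq_adjugate_mulVec, Matrix.mulVec, dotProduct,
      Finset.mul_sum]
    refine Finset.sum_congr rfl fun j _ => ?_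
    rw [Matrix.inv_def, Ring.inverse_eq_inv', Matrix.smul_apply, smul_eq_mul]
    field_simp
  have h5 : DD v (fun y => (M y).det) x =
      ∑ i, ((M x).updateCol i (fun j => DD v (fun y => M y j i) x)).det := by
    simp only [h3]
    rw [Finset.sum_comm, DD, h2.fderiv]
    simp [DD, Finset.mul_sum]
  rw [h5, Finset.mul_sum]
  exact Finset.sum_congr rfl fun i _ => h4 i

end Calc

end

section
open Filter Topology

section Core
variable {E : Type*} [NormedAddCommGroup E] [NormedSpace ℝ E] {n : ℕ}

/-- the complex matrix `I + i U`. -/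
noncomputable def CM (U : Matrix (Fin n) (Fin n) ℝ) : Matrix (Fin n) (Fin n) ℂ :=
  1 + Complex.I • U.map (fun t : ℝ => (t : ℂ))

lemma CM_apply (U : Matrix (Fin n) (Fin n) ℝ) (i j : Fin n) :
    CM U i j = (1 : Matrix (Fin n) (Fin n) ℂ) i j + Complex.I * (U i j : ℂ) := by
  simp [CM]

lemma SM.cm {U : E → Matrix (Fin n) (Fin n) ℝ} {x : E} (h : ∀ i j, SM (fun y => U y i j) x)
    (i j : Fin n) : SM (fun y => CM (U y) i j) x := by
  simp only [CM_apply]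
  exact ContDiffAt.add (SM.const _ x) ((SM.const _ x).mul (h i j).ofReal)

lemma DD_cm {U : E → Matrix (Fin n) (Fin n) ℝ} {x : E}
    (h : ∀ i j, DifferentiableAt ℝ (fun y => U y i j) x)
    (i j : Fin n) (v : E) :
    DD v (fun y => CM (U y) i j) x = Complex.I * ((DD v (fun y => U y i j) x : ℝ) : ℂ) := by
  simp only [CM_apply]
  have h1 : DifferentiableAt ℝ (fun y => ((U y i j : ℝ) : ℂ)) x :=
    Complex.ofRealCLM.differentiableAt.comp x (h i j)
  rw [DD_add (by fun_prop) (by fun_prop), DD_const, DD_const_mul _ h1, DD_ofReal (h i j)]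
  simp

lemma core_smooth {U : E → Matrix (Fin n) (Fin n) ℝ} {x0 : E} {L : E → ℝ} {w : ℂ}
    (hU : ∀ i j, SM (fun y => U y i j) x0)
    (hW : ∀ᶠ y in 𝓝 x0, ((Real.exp (L y) : ℝ) : ℂ) = w * (CM (U y)).det) : SM L x0 := by
  have h1 : SM (fun y => (w * (CM (U y)).det).re) x0 :=
    ((SM.const w x0).mul (SM.det (SM.cm hU))).re
  have h2 : (w * (CM (U x0)).det).re ≠ 0 := by
    rw [← hW.self_of_nhds, Complex.ofReal_re]; exact (Real.exp_pos _).ne'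
  have h3 : SM (fun y => Real.log ((w * (CM (U y)).det).re)) x0 := ContDiffAt.log h1 h2
  refine ContDiffAt.congr_of_eventuallyEq h3 ?_
  filter_upwards [hW] with y hy
  rw [← hy, Complex.ofReal_re, Real.log_exp]

lemma core_first {U : E → Matrix (Fin n) (Fin n) ℝ} {x0 : E} {L : E → ℝ} {w : ℂ}
    (hU : ∀ i j, SM (fun y => U y i j) x0)
    (hW : ∀ᶠ y in 𝓝 x0, ((Real.exp (L y) : ℝ) : ℂ) = w * (CM (U y)).det) (v : E) :
    ∀ᶠ y in 𝓝 x0, ((DD v L y : ℝ) : ℂ) =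
      ∑ i, ∑ j, (CM (U y))⁻¹ i j * (Complex.I * ((DD v (fun y => U y j i) y : ℝ) : ℂ)) := by
  have hL := core_smooth hU hW
  have hUd : ∀ᶠ y in 𝓝 x0, ∀ i j, DifferentiableAt ℝ (fun y => U y i j) y := by
    simp only [eventually_all]
    exact fun i j => (hU i j).ev_diff
  have hCd : ∀ᶠ y in 𝓝 x0, ∀ i j, DifferentiableAt ℝ (fun y => CM (U y) i j) y := by
    simp only [eventually_all]
    exact fun i j => (SM.cm hU i j).ev_diff
  have hdetd := (SM.det (SM.cm hU)).ev_diff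
  filter_upwards [hUd, hCd, hdetd, hL.ev_diff, hW, DD_congr hW v] with y h1 h2 h3 h4 h5 h6
  have hne : (CM (U y)).det ≠ 0 := by
    intro h
    rw [h, mul_zero] at h5
    exact (Real.exp_pos (L y)).ne' (by exact_mod_cast h5)
  rw [DD_const_mul _ h3, DD_det h2 hne, DD_ofReal h4.exp] at h6
  have h7 : DD v (fun y => Real.exp (L y)) y = Real.exp (L y) * DD v L y := by
    simp [DD, fderiv_exp h4]
  rw [h7] at h6
  push_cast at h6 h5
  rw [← mul_assoc, ← h5] at h6
  have h8 := mul_left_cancel₀ (Complex.exp_ne_zero _) h6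
  rw [h8]
  refine Finset.sum_congr rfl fun i _ => Finset.sum_congr rfl fun j _ => ?_
  rw [DD_cm h1]

lemma inv_one_add_I (l : ℝ) : (1 + Complex.I * (l : ℂ))⁻¹ =
    (((1 + l ^ 2)⁻¹ : ℝ) : ℂ) - Complex.I * ((l * (1 + l ^ 2)⁻¹ : ℝ) : ℂ) := by
  have h : (1 + (l : ℂ) ^ 2) ≠ 0 := by
    have : (1 + l ^ 2 : ℝ) ≠ 0 := by positivity
    exact_mod_cast this
  have h2 : (1 + Complex.I * (l : ℂ)) ≠ 0 := by
    intro h3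
    apply h
    have : (1 + (l : ℂ) ^ 2) = (1 + Complex.I * l) * (1 - Complex.I * l) := by
      ring_nf; simp
    rw [this, h3, zero_mul]
  apply inv_eq_of_mul_eq_one_right
  push_cast
  field_simp
  ring_nf
  simp

lemma CM_diag_inv {U : Matrix (Fin n) (Fin n) ℝ} {lam : Fin n → ℝ}
    (h : U = Matrix.diagonal lam) :
    (CM U)⁻¹ = Matrix.diagonal (fun i => (1 + Complex.I * (lam i : ℂ))⁻¹) := by
  have hne : ∀ i, (1 + Complex.I * (lam i : ℂ)) ≠ 0 := by
    intro i h
    have := congrArg Complex.re h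
    simp at this
  have h1 : CM U = Matrix.diagonal (fun i => (1 + Complex.I * (lam i : ℂ))) := by
    ext i j
    rw [CM_apply, h]
    by_cases hij : i = j
    · subst hij; simp
    · simp [hij]
  rw [h1]
  apply Matrix.inv_eq_right_inv
  rw [Matrix.diagonal_mul_diagonal]
  ext i j
  by_cases hij : i = j
  · subst hij; simp [hne]
  · simp [hij]

lemma core_dinv {U : E → Matrix (Fin n) (Fin n) ℝ} {x0 : E} {L : E → ℝ} {w : ℂ}
    (hU : ∀ i j, SM (fun y => U y i j) x0)
    (hW : ∀ᶠ y in 𝓝 x0, ((Real.exp (L y) : ℝ) : ℂ) = w * (CM (U y)).det)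
    {lam : Fin n → ℝ} (hd : U x0 = Matrix.diagonal lam) (v : E) (i j : Fin n) :
    DD v (fun y => (CM (U y))⁻¹ i j) x0 = - ((1 + Complex.I * (lam i : ℂ))⁻¹ *
      (Complex.I * ((DD v (fun y => U y i j) x0 : ℝ) : ℂ)) * (1 + Complex.I * (lam j : ℂ))⁻¹) := by
  have hne : ∀ᶠ y in 𝓝 x0, (CM (U y)).det ≠ 0 := by
    filter_upwards [hW] with y h5 h
    rw [h, mul_zero] at h5
    exact (Real.exp_pos (L y)).ne' (by exact_mod_cast h5)
  have hl : (1 + Complex.I * (lam i : ℂ)) ≠ 0 := by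
    intro h
    have := congrArg Complex.re h
    simp at this
  have hB := SM.matinv (SM.cm hU) hne.self_of_nhds
  have h1 : (fun y => ∑ k, CM (U y) i k * (CM (U y))⁻¹ k j) =ᶠ[𝓝 x0]
      fun _ => (1 : Matrix (Fin n) (Fin n) ℂ) i j := by
    filter_upwards [hne] with y hy
    rw [← Matrix.mul_apply, Matrix.mul_nonsing_inv _ (isUnit_iff_ne_zero.mpr hy)]
  have h2 := (DD_congr h1 v).self_of_nhds
  rw [DD_const, DD_sum (fun k _ => ((SM.cm hU i k).mul (hB k j)).diff)] at h2
  simp only [DD_mul (SM.cm hU i _).diff (hB _ j).diff, DD_cm (fun i j => (hU i j).diff),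
    CM_diag_inv hd, Finset.sum_add_distrib] at h2
  have h3 : ∀ k, CM (U x0) i k = if i = k then (1 + Complex.I * (lam i : ℂ)) else 0 := by
    intro k
    rw [CM_apply, hd]
    by_cases hij : i = k
    · subst hij; simp
    · simp [hij]
  simp only [h3, Matrix.diagonal_apply, ite_mul, mul_ite, zero_mul, mul_zero,
    Finset.sum_ite_eq, Finset.sum_ite_eq', Finset.mem_univ, if_true] at h2
  have h4 := eq_neg_of_add_eq_zero_left h2
  have h5 : DD v (fun y => (CM (U y))⁻¹ i j) x0 = (1 + Complex.I * (lam i : ℂ))⁻¹ *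
     ((1 + Complex.I * (lam i : ℂ)) * DD v (fun y => (CM (U y))⁻¹ i j) x0) := by
    field_simp
  rw [h5, h4]
  ring

lemma core_first' {U : E → Matrix (Fin n) (Fin n) ℝ} {x0 : E} {L : E → ℝ} {w : ℂ}
    (hU : ∀ i j, SM (fun y => U y i j) x0)
    (hW : ∀ᶠ y in 𝓝 x0, ((Real.exp (L y) : ℝ) : ℂ) = w * (CM (U y)).det)
    {lam : Fin n → ℝ} (hd : U x0 = Matrix.diagonal lam) (v : E) :
    DD v L x0 = ∑ i, lam i * (1 + lam i ^ 2)⁻¹ * DD v (fun y => U y i i) x0 ∧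
    ∑ i, (1 + lam i ^ 2)⁻¹ * DD v (fun y => U y i i) x0 = 0 := by
  have h := (core_first hU hW v).self_of_nhds
  simp only [CM_diag_inv hd, Matrix.diagonal_apply, ite_mul, zero_mul,
    Finset.sum_ite_eq, Finset.mem_univ, if_true, inv_one_add_I] at h
  constructor
  · have := congrArg Complex.re h
    rw [Complex.ofReal_re, Complex.re_sum] at this
    rw [this]
    refine Finset.sum_congr rfl fun i _ => ?_
    simp [-Complex.ofReal_inv, -Complex.ofReal_mul]
  · have := congrArg Complex.im h
    rw [Complex.ofReal_im, Complex.im_sum] at this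
    rw [this]
    refine Finset.sum_congr rfl fun i _ => ?_
    simp [-Complex.ofReal_inv, -Complex.ofReal_mul]

lemma core_second {U : E → Matrix (Fin n) (Fin n) ℝ} {x0 : E} {L : E → ℝ} {w : ℂ}
    (hU : ∀ i j, SM (fun y => U y i j) x0)
    (hW : ∀ᶠ y in 𝓝 x0, ((Real.exp (L y) : ℝ) : ℂ) = w * (CM (U y)).det)
    {lam : Fin n → ℝ} (hd : U x0 = Matrix.diagonal lam) (v : E) :
    DD v (DD v L) x0 = ∑ i, lam i * (1 + lam i ^ 2)⁻¹ * DD v (DD v (fun y => U y i i)) x0 +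
      ∑ i, ∑ j, (1 - lam i * lam j) * ((1 + lam i ^ 2)⁻¹ * (1 + lam j ^ 2)⁻¹) *
        (DD v (fun y => U y i j) x0 * DD v (fun y => U y j i) x0) ∧
    ∑ i, (1 + lam i ^ 2)⁻¹ * DD v (DD v (fun y => U y i i)) x0 =
      ∑ i, ∑ j, (lam i + lam j) * ((1 + lam i ^ 2)⁻¹ * (1 + lam j ^ 2)⁻¹) *
        (DD v (fun y => U y i j) x0 * DD v (fun y => U y j i) x0) := by
  have hne : (CM (U x0)).det ≠ 0 := by
    have h5 := hW.self_of_nhds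
    intro h
    rw [h, mul_zero] at h5
    exact (Real.exp_pos (L x0)).ne' (by exact_mod_cast h5)
  have hB := SM.matinv (SM.cm hU) hne
  have hI : ∀ i j, SM (fun y => Complex.I * ((DD v (fun y => U y j i) y : ℝ) : ℂ)) x0 :=
    fun i j => (SM.const _ x0).mul ((hU j i).dd v).ofReal
  have h := (DD_congr (core_first hU hW v) v).self_of_nhds
  rw [DD_ofReal ((core_smooth hU hW).dd v).diff,
    DD_sum (fun i _ => (SM.sum fun j _ => (hB i j).mul (hI i j)).diff)] at h
  simp only [DD_sum (fun j (_ : j ∈ Finset.univ) => ((hB _ j).mul (hI _ j)).diff),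
    DD_mul (hB _ _).diff (hI _ _).diff,
    DD_const_mul Complex.I ((hU _ _).dd v).ofReal.diff,
    DD_ofReal ((hU _ _).dd v).diff,
    core_dinv hU hW hd,
    Finset.sum_add_distrib] at h
  simp only [CM_diag_inv hd, Matrix.diagonal_apply, ite_mul, zero_mul,
    Finset.sum_ite_eq, Finset.mem_univ, if_true, inv_one_add_I] at h
  constructor
  · have := congrArg Complex.re h
    rw [Complex.ofReal_re, Complex.add_re, Complex.re_sum, Complex.re_sum] at this
    rw [this]
    congr 1
    · refine Finset.sum_congr rfl fun i _ => ?_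
      simp [-Complex.ofReal_inv, -Complex.ofReal_mul]
    · refine Finset.sum_congr rfl fun i _ => ?_
      rw [Complex.re_sum]
      refine Finset.sum_congr rfl fun j _ => ?_
      simp [-Complex.ofReal_inv, -Complex.ofReal_mul]
      ring
  · have := congrArg Complex.im h
    rw [Complex.ofReal_im, Complex.add_im, Complex.im_sum, Complex.im_sum] at this
    have h9 : ∑ i, (1 + lam i ^ 2)⁻¹ * DD v (DD v (fun y => U y i i)) x0 -
      ∑ i, ∑ j, (lam i + lam j) * ((1 + lam i ^ 2)⁻¹ * (1 + lam j ^ 2)⁻¹) *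
        (DD v (fun y => U y i j) x0 * DD v (fun y => U y j i) x0) = 0 := by
      rw [this, sub_eq_add_neg, ← Finset.sum_neg_distrib]
      congr 1
      · refine Finset.sum_congr rfl fun i _ => ?_
        simp [-Complex.ofReal_inv, -Complex.ofReal_mul]
      · refine Finset.sum_congr rfl fun i _ => ?_
        rw [Complex.im_sum, ← Finset.sum_neg_distrib]
        refine Finset.sum_congr rfl fun j _ => ?_
        simp [-Complex.ofReal_inv, -Complex.ofReal_mul]
        ring
    linarith
end Core

end

section
open Filter Topology

section Alg
variable {n : ℕ}

lemma alg_pos {p b c : ℝ} (hp : 0 ≤ p) (hb : 0 ≤ b) (hbc : b ≤ c)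
    (h1 : 0 ≤ 3 + p ^ 2 - 2 * p * c) (h2 : 0 ≤ 3 + c ^ 2 - 2 * p * c) :
    0 ≤ 3 - p * b - p * c + b * c := by
  rcases le_total p c with h | h
  · nlinarith [mul_nonneg hb (sub_nonneg.2 h), mul_nonneg hp (sub_nonneg.2 h)]
  · nlinarith [mul_nonneg (sub_nonneg.2 hbc) (sub_nonneg.2 h)]

lemma alg_pos' {p b c : ℝ} (hp : 0 ≤ p) (hb : 0 ≤ b) (hc : 0 ≤ c)
    (h1 : 0 ≤ 3 + p ^ 2 - 2 * p * c) (h2 : 0 ≤ 3 + c ^ 2 - 2 * p * c)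
    (h3 : 0 ≤ 3 + p ^ 2 - 2 * p * b) (h4 : 0 ≤ 3 + b ^ 2 - 2 * p * b) :
    0 ≤ 3 - p * b - p * c + b * c := by
  rcases le_total b c with h | h
  · exact alg_pos hp hb h h1 h2
  · have := alg_pos hp hc h h3 h4
    linarith

/-- opposite signs version. -/
lemma alg_opp {a b c : ℝ} (hbc : 0 ≤ b * c)
    (h1 : 0 ≤ 3 + a ^ 2 + 2 * a * b) (h2 : 0 ≤ 3 + a ^ 2 + 2 * a * c)
    (h3 : 0 ≤ 3 + b ^ 2 + 2 * b * a) (h4 : 0 ≤ 3 + c ^ 2 + 2 * c * a) :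
    0 ≤ 3 + a * b + b * c + c * a := by
  rcases mul_nonneg_iff.1 hbc with ⟨hb, hc⟩ | ⟨hb, hc⟩
  · rcases le_total 0 a with ha | ha
    · positivity
    · have := alg_pos' (neg_nonneg.2 ha) hb hc (by linarith) (by linarith) (by linarith)
        (by linarith)
      linarith
  · rcases le_total 0 a with ha | ha
    · have := alg_pos' ha (neg_nonneg.2 hb) (neg_nonneg.2 hc) (by linarith) (by linarith)
        (by linarith) (by linarith)
      linarith
    · nlinarith [mul_nonneg_of_nonpos_of_nonpos ha hb, mul_nonneg_of_nonpos_of_nonpos ha hc]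

lemma alg_trip {a b c : ℝ}
    (hab : 0 ≤ 3 + a ^ 2 + 2 * a * b) (hac : 0 ≤ 3 + a ^ 2 + 2 * a * c)
    (hba : 0 ≤ 3 + b ^ 2 + 2 * b * a) (hbc : 0 ≤ 3 + b ^ 2 + 2 * b * c)
    (hca : 0 ≤ 3 + c ^ 2 + 2 * c * a) (hcb : 0 ≤ 3 + c ^ 2 + 2 * c * b) :
    0 ≤ 3 + a * b + b * c + c * a := by
  rcases le_or_gt 0 (b * c) with h | h
  · exact alg_opp h hab hac hba hca
  rcases le_or_gt 0 (a * c) with h' | h'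
  · have := alg_opp h' hba hbc hab hcb
    linarith
  · have h3 : 0 ≤ a * b := by
      by_contra! hh
      have h4 := mul_pos_of_neg_of_neg h h'
      have h5 := mul_nonneg_of_nonpos_of_nonpos hh.le (neg_nonpos.2 (sq_nonneg c))
      nlinarith
    have := alg_opp h3 hca hcb hac hbc
    linarith

lemma sum3_cyc (f : Fin n → Fin n → Fin n → ℝ) :
    ∑ i, ∑ j, ∑ k, f i j k = ∑ i, ∑ j, ∑ k, f j k i := by
  have h1 : ∑ i, ∑ j, ∑ k, f j k i = ∑ j, ∑ i, ∑ k, f j k i := Finset.sum_comm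
  rw [h1]
  exact Finset.sum_congr rfl fun j _ => Finset.sum_comm

lemma jacobi_alg (hn : 1 ≤ n) {ε : ℝ} (hε : 0 < ε) (lam g : Fin n → ℝ) (hg : ∀ i, 0 < g i)
    (T : Fin n → Fin n → Fin n → ℝ) (hT1 : ∀ i j k, T i j k = T j i k)
    (hT2 : ∀ i j k, T i j k = T k j i)
    (hc : ∀ i j, 0 ≤ 3 + (1 - ε) * lam i ^ 2 + 2 * lam i * lam j) :
    (ε / (n - 1 + ε)) * ∑ k, g k * (∑ i, lam i * g i * T i i k) ^ 2 ≤
      ∑ i, ∑ j, ∑ k, (1 + lam i * lam j) * (g i * g j * g k * T i j k ^ 2) := by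
  classical
  have hnr : (0 : ℝ) ≤ n - 1 := by
    have : (1 : ℝ) ≤ n := by exact_mod_cast hn
    linarith
  have hK : (0 : ℝ) < n - 1 + ε := by linarith
  set w : Fin n → Fin n → ℝ := fun i k => if i = k then 1 else ε with hw
  have hwpos : ∀ i k, 0 < w i k := by
    intro i k; simp only [hw]; split_ifs <;> linarith
  set H : Fin n → Fin n → Fin n → ℝ := fun i j k => g i * g j * g k * T i j k ^ 2 with hH
  have hH1 : ∀ i j k, H i j k = H j i k := fun i j k => by
    simp only [hH]; rw [hT1 i j k]; ring
  have hH2 : ∀ i j k, H i j k = H k j i := fun i j k => by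
    simp only [hH]; rw [hT2 i j k]; ring
  have hHc : ∀ i j k, H j k i = H i j k := fun i j k => by
    rw [hH2 j k i, hH1 i k j, hH2 k i j, hH1 j i k]
  have hHp : ∀ i j k, 0 ≤ H i j k := fun i j k => by
    have := hg i; have := hg j; have := hg k
    simp only [hH]; positivity
  have hwsum : ∀ k, ∑ i, (w i k)⁻¹ = (n - 1 + ε) / ε := by
    intro k
    rw [← Finset.add_sum_erase _ _ (Finset.mem_univ k)]
    have : ∑ i ∈ Finset.univ.erase k, (w i k)⁻¹ = ∑ i ∈ Finset.univ.erase k, ε⁻¹ := by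
      refine Finset.sum_congr rfl fun i hi => ?_
      simp [hw, Finset.ne_of_mem_erase hi]
    rw [this, Finset.sum_const, Finset.card_erase_of_mem (Finset.mem_univ k)]
    simp [hw, Nat.cast_sub hn]
    field_simp
    ring
  have hCS : ∀ k, g k * (∑ i, lam i * g i * T i i k) ^ 2 ≤
      (n - 1 + ε) / ε * ∑ i, w i k * lam i ^ 2 * H i i k := by
    intro k
    have h1 : (∑ i, lam i * g i * T i i k) ^ 2 ≤
        (∑ i, (w i k)⁻¹) * ∑ i, w i k * (lam i * g i * T i i k) ^ 2 := by
      apply Finset.sum_sq_le_sum_mul_sum_of_sq_le_mul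
      · intro i _; exact (inv_pos.2 (hwpos i k)).le
      · intro i _; have := hwpos i k; positivity
      · intro i _; have := (hwpos i k).ne'; apply le_of_eq; field_simp
    rw [hwsum] at h1
    have h2 := mul_le_mul_of_nonneg_left h1 (hg k).le
    refine h2.trans (le_of_eq ?_)
    rw [mul_left_comm, Finset.mul_sum]
    congr 1
    refine Finset.sum_congr rfl fun i _ => ?_
    simp only [hH]; ring
  -- pointwise bound
  have hpt : ∀ i j k, (if i = j then w i k * lam i ^ 2 * H i i k else 0) +
      (if j = k then w j i * lam j ^ 2 * H j j i else 0) +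
      (if k = i then w k j * lam k ^ 2 * H k k j else 0) ≤
      (3 + lam i * lam j + lam j * lam k + lam k * lam i) * H i j k := by
    have two : ∀ i k, i ≠ k → w i k * lam i ^ 2 * H i i k ≤
        (3 + lam i * lam i + lam i * lam k + lam k * lam i) * H i i k := by
      intro i k hik
      apply mul_le_mul_of_nonneg_right _ (hHp _ _ _)
      simp only [hw, if_neg hik]
      have := hc i k
      nlinarith
    intro i j k
    by_cases h1 : i = j
    · subst h1
      by_cases h2 : i = k
      · subst h2
        simp only [hw, if_true]
        nlinarith [hHp i i i, mul_nonneg (sq_nonneg (lam i)) (hHp i i i)]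
      · simp only [if_neg h2, if_neg (Ne.symm h2), if_true, add_zero]
        exact two i k h2
    · by_cases h2 : j = k
      · subst h2
        simp only [if_neg h1, if_neg (Ne.symm h1), if_true, add_zero, zero_add]
        refine (two j i (Ne.symm h1)).trans (le_of_eq ?_)
        rw [hHc i j j]; ring
      · by_cases h3 : k = i
        · subst h3
          simp only [if_neg h1, if_neg h2, if_true, zero_add]
          refine (two k j h1).trans (le_of_eq ?_)
          rw [hHc j k k, hH1 j k k]; ring
        · simp only [if_neg h1, if_neg h2, if_neg h3, add_zero]
          apply mul_nonneg _ (hHp _ _ _)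
          have hc' : ∀ i j, 0 ≤ 3 + lam i ^ 2 + 2 * lam i * lam j := fun i j => by
            nlinarith [hc i j, mul_nonneg hε.le (sq_nonneg (lam i))]
          exact alg_trip (hc' _ _) (hc' _ _) (hc' _ _) (hc' _ _) (hc' _ _) (hc' _ _)
  have hsum := Finset.sum_le_sum fun i (_ : i ∈ Finset.univ) =>
    Finset.sum_le_sum fun j (_ : j ∈ Finset.univ) =>
    Finset.sum_le_sum fun k (_ : k ∈ Finset.univ) => hpt i j k
  simp only [Finset.sum_add_distrib] at hsum
  set S := ∑ i, ∑ j, ∑ k, (1 + lam i * lam j) * H i j k with hS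
  set P := ∑ k, ∑ i, w i k * lam i ^ 2 * H i i k with hP
  have c1 : ∑ i, ∑ j, ∑ k, (if i = j then w i k * lam i ^ 2 * H i i k else 0) = P := by
    rw [hP, Finset.sum_comm]
    rw [Finset.sum_comm (f := fun k i => w i k * lam i ^ 2 * H i i k), Finset.sum_comm]
    refine Finset.sum_congr rfl fun i _ => ?_
    rw [Finset.sum_comm]
    simp
  have c2 : ∑ i, ∑ j, ∑ k, (if j = k then w j i * lam j ^ 2 * H j j i else 0) = P := by
    rw [← c1, sum3_cyc (fun i j k => (if i = j then w i k * lam i ^ 2 * H i i k else 0))]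
  have c3 : ∑ i, ∑ j, ∑ k, (if k = i then w k j * lam k ^ 2 * H k k j else 0) = P := by
    rw [← c2, sum3_cyc (fun i j k => (if j = k then w j i * lam j ^ 2 * H j j i else 0))]
  have d2 : ∑ i, ∑ j, ∑ k, (1 + lam j * lam k) * H i j k = S := by
    rw [hS, sum3_cyc (fun i j k => (1 + lam i * lam j) * H i j k)]
    simp only [hHc]
  have d3 : ∑ i, ∑ j, ∑ k, (1 + lam k * lam i) * H i j k = S := by
    rw [← d2, sum3_cyc (fun i j k => (1 + lam j * lam k) * H i j k)]
    simp only [hHc]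
  have d : ∑ i, ∑ j, ∑ k, (3 + lam i * lam j + lam j * lam k + lam k * lam i) * H i j k
      = 3 * S := by
    have e : ∑ i, ∑ j, ∑ k, (3 + lam i * lam j + lam j * lam k + lam k * lam i) * H i j k
      = S + ∑ i, ∑ j, ∑ k, (1 + lam j * lam k) * H i j k
        + ∑ i, ∑ j, ∑ k, (1 + lam k * lam i) * H i j k := by
      rw [hS]
      simp only [← Finset.sum_add_distrib]
      refine Finset.sum_congr rfl fun i _ => Finset.sum_congr rfl fun j _ =>
        Finset.sum_congr rfl fun k _ => ?_
      ring
    rw [e, d2, d3]; ring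
  rw [c1, c2, c3, d] at hsum
  have hfin : ∑ k, g k * (∑ i, lam i * g i * T i i k) ^ 2 ≤ (n - 1 + ε) / ε * P := by
    rw [hP, Finset.mul_sum]
    exact Finset.sum_le_sum fun k _ => hCS k
  have h5 : (ε / (n - 1 + ε)) * ∑ k, g k * (∑ i, lam i * g i * T i i k) ^ 2 ≤
      (ε / (n - 1 + ε)) * ((n - 1 + ε) / ε * P) :=
    mul_le_mul_of_nonneg_left hfin (by positivity)
  have h6 : (ε / (n - 1 + ε)) * ((n - 1 + ε) / ε * P) = P := by
    field_simp
  linarith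

end Alg

end

section
open Filter Topology

section Jac
variable {E : Type*} [NormedAddCommGroup E] [InnerProductSpace ℝ E] {n : ℕ}

/-- Hessian in a frame. -/
noncomputable def HU (u : E → ℝ) (e : Fin n → E) (y : E) : Matrix (Fin n) (Fin n) ℝ :=
  Matrix.of fun i j => DD (e i) (DD (e j) u) y

lemma HU_sm {u : E → ℝ} {x0 : E} (hu : SM u x0) (e : Fin n → E) (i j : Fin n) :
    SM (fun y => HU u e y i j) x0 := (hu.dd (e j)).dd (e i)

lemma T_sym1 {u : E → ℝ} {x0 : E} (hu : SM u x0) (e : Fin n → E) (i j k : Fin n) :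
    DD (e k) (fun y => HU u e y i j) x0 = DD (e k) (fun y => HU u e y j i) x0 :=
  (DD_congr (hu.comm (e i) (e j)) (e k)).self_of_nhds

lemma T_sym2 {u : E → ℝ} {x0 : E} (hu : SM u x0) (e : Fin n → E) (i j k : Fin n) :
    DD (e k) (fun y => HU u e y i j) x0 = DD (e i) (fun y => HU u e y k j) x0 :=
  ((hu.dd (e j)).comm (e k) (e i)).self_of_nhds

lemma Q_sym {u : E → ℝ} {x0 : E} (hu : SM u x0) (e : Fin n → E) (i k : Fin n) :
    DD (e k) (DD (e k) (fun y => HU u e y i i)) x0 =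
      DD (e i) (DD (e i) (fun y => HU u e y k k)) x0 := by
  have h1 := (DD_congr ((hu.dd (e i)).comm (e k) (e i)) (e k)).self_of_nhds
  have h2 := (((hu.dd (e i)).dd (e k)).comm (e k) (e i)).self_of_nhds
  have h3 := (DD_congr (DD_congr (hu.comm (e k) (e i)) (e k)) (e i)).self_of_nhds
  have h4 := (DD_congr ((hu.dd (e k)).comm (e k) (e i)) (e i)).self_of_nhds
  exact h1.trans (h2.trans (h3.trans h4))

lemma lap_L {u : E → ℝ} {x0 : E} (hu : SM u x0) (e : Fin n → E) {L : E → ℝ} {w : ℂ}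
    (hW : ∀ᶠ y in 𝓝 x0, ((Real.exp (L y) : ℝ) : ℂ) = w * (CM (HU u e y)).det)
    {lam : Fin n → ℝ} (hd : HU u e x0 = Matrix.diagonal lam) :
    ∑ k, (1 + lam k ^ 2)⁻¹ * DD (e k) (DD (e k) L) x0 =
    ∑ i, ∑ j, ∑ k, (1 + lam i * lam j) *
      ((1 + lam i ^ 2)⁻¹ * (1 + lam j ^ 2)⁻¹ * (1 + lam k ^ 2)⁻¹ *
        (DD (e k) (fun y => HU u e y i j) x0) ^ 2) := by
  have h2 := fun k => core_second (HU_sm hu e) hW hd (e k)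
  set g : Fin n → ℝ := fun i => (1 + lam i ^ 2)⁻¹ with hg
  set T : Fin n → Fin n → Fin n → ℝ := fun i j k => DD (e k) (fun y => HU u e y i j) x0 with hT
  set Q : Fin n → Fin n → ℝ := fun i k => DD (e k) (DD (e k) (fun y => HU u e y i i)) x0 with hQ
  have hT1 : ∀ i j k, T i j k = T j i k := fun i j k => T_sym1 hu e i j k
  have hT2 : ∀ i j k, T i j k = T k j i := fun i j k => T_sym2 hu e i j k
  have hQs : ∀ i k, Q i k = Q k i := fun i k => Q_sym hu e i k
  have hTc : ∀ i j k, T j k i = T i j k := fun i j k => by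
    rw [hT2 j k i, hT1 i k j, hT2 k i j, hT1 j i k]
  have a1 : ∀ k, DD (e k) (DD (e k) L) x0 = ∑ i, lam i * g i * Q i k +
      ∑ i, ∑ j, (1 - lam i * lam j) * (g i * g j) * (T i j k * T i j k) := by
    intro k
    rw [(h2 k).1]
    congr 1
    refine Finset.sum_congr rfl fun i _ => Finset.sum_congr rfl fun j _ => ?_
    change _ * (T i j k * T j i k) = _
    rw [hT1 j i k]
  have a2 : ∀ k, ∑ i, g i * Q i k =
      ∑ i, ∑ j, (lam i + lam j) * (g i * g j) * (T i j k * T i j k) := by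
    intro k
    refine (h2 k).2.trans ?_
    refine Finset.sum_congr rfl fun i _ => Finset.sum_congr rfl fun j _ => ?_
    change _ * (T i j k * T j i k) = _
    rw [hT1 j i k]
  change ∑ k, g k * DD (e k) (DD (e k) L) x0 = ∑ i, ∑ j, ∑ k, (1 + lam i * lam j) *
    (g i * g j * g k * T i j k ^ 2)
  simp only [a1, mul_add, Finset.sum_add_distrib]
  have b1 : ∑ k, g k * ∑ i, lam i * g i * Q i k =
      ∑ i, ∑ j, ∑ k, (lam i * lam j + lam i * lam k) * (g i * g j * g k * T i j k ^ 2) := by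
    have : ∑ k, g k * ∑ i, lam i * g i * Q i k = ∑ i, lam i * g i * ∑ k, g k * Q k i := by
      simp only [Finset.mul_sum]
      rw [Finset.sum_comm]
      refine Finset.sum_congr rfl fun i _ => Finset.sum_congr rfl fun k _ => ?_
      rw [hQs i k]; ring
    rw [this]
    simp only [a2, Finset.mul_sum]
    refine Finset.sum_congr rfl fun i _ => Finset.sum_congr rfl fun j _ =>
      Finset.sum_congr rfl fun k _ => ?_
    rw [hTc i j k]; ring
  have b2 : ∑ i, ∑ j, ∑ k, (lam i * lam k) * (g i * g j * g k * T i j k ^ 2) =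
      ∑ i, ∑ j, ∑ k, (lam i * lam j) * (g i * g j * g k * T i j k ^ 2) := by
    refine Finset.sum_congr rfl fun i _ => ?_
    rw [Finset.sum_comm]
    refine Finset.sum_congr rfl fun j _ => Finset.sum_congr rfl fun k _ => ?_
    rw [hT1 i k j, hT2 k i j, hT1 j i k]; ring
  have b3 : ∑ k, g k * ∑ i, ∑ j, (1 - lam i * lam j) * (g i * g j) * (T i j k * T i j k) =
      ∑ i, ∑ j, ∑ k, (1 - lam i * lam j) * (g i * g j * g k * T i j k ^ 2) := by
    simp only [Finset.mul_sum]
    rw [sum3_cyc (fun i j k => (1 - lam i * lam j) * (g i * g j * g k * T i j k ^ 2))]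
    refine Finset.sum_congr rfl fun i _ => Finset.sum_congr rfl fun j _ =>
      Finset.sum_congr rfl fun k _ => ?_
    ring
  rw [b1, b3]
  simp only [add_mul, sub_mul, Finset.sum_add_distrib, Finset.sum_sub_distrib]
  rw [b2]
  ring

/-- The maximum principle at the maximum point. -/
lemma max_point (hn : 1 ≤ n) {u : E → ℝ} {x0 : E} (hu : SM u x0) (e : Fin n → E)
    (he : ∀ k, ‖e k‖ = 1) {L : E → ℝ} {w : ℂ}
    (hW : ∀ᶠ y in 𝓝 x0, ((Real.exp (L y) : ℝ) : ℂ) = w * (CM (HU u e y)).det)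
    {lam : Fin n → ℝ} (hd : HU u e x0 = Matrix.diagonal lam)
    {ε : ℝ} (hε : 0 < ε)
    (hc : ∀ i j, 0 ≤ 3 + (1 - ε) * lam i ^ 2 + 2 * lam i * lam j)
    (t C : ℝ) (η : E → ℝ)
    (hη : ∀ᶠ y in 𝓝 x0, η y = ∑ i, DD (e i) u y * DD (e i) u y + (- t ^ 2) * ‖y‖ ^ 2 + C)
    (hpos : 0 < η x0)
    (hmax : IsLocalMax (fun y => Real.log (η y) + (ε / (n - 1 + ε)) * L y) x0) :
    ∑ k, (1 + lam k ^ 2)⁻¹ * (lam k ^ 2 - t ^ 2) ≤ 0 := by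
  have hnr : (0 : ℝ) ≤ n - 1 := by
    have : (1 : ℝ) ≤ n := by exact_mod_cast hn
    linarith
  set κ : ℝ := ε / (n - 1 + ε) with hκ
  have hκ0 : 0 < κ := by rw [hκ]; positivity
  have hL := core_smooth (HU_sm hu e) hW
  have hDu := fun i => hu.dd (e i)
  have hns : SM (fun y : E => ‖y‖ ^ 2) x0 := (contDiff_norm_sq ℝ).contDiffAt
  have hS1 : SM (fun y => ∑ i, DD (e i) u y * DD (e i) u y) x0 :=
    SM.sum fun i _ => (hDu i).mul (hDu i)
  have hη' : η =ᶠ[𝓝 x0] fun y => ∑ i, DD (e i) u y * DD (e i) u y + (- t ^ 2) * ‖y‖ ^ 2 + C := hη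
  have hS2 : SM (fun y : E => (- t ^ 2) * ‖y‖ ^ 2) x0 := (SM.const _ x0).mul hns
  have hS3 : SM (fun y => ∑ i, DD (e i) u y * DD (e i) u y + (- t ^ 2) * ‖y‖ ^ 2) x0 :=
    ContDiffAt.add hS1 hS2
  have hηs : SM η x0 :=
    ContDiffAt.congr_of_eventuallyEq (ContDiffAt.add hS3 (SM.const C x0)) hη'
  have hlog : SM (fun y => Real.log (η y)) x0 := ContDiffAt.log hηs hpos.ne'
  have hκL : SM (fun y => κ * L y) x0 := (SM.const _ x0).mul hL
  have hF : SM (fun y => Real.log (η y) + κ * L y) x0 := ContDiffAt.add hlog hκL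
  have hηpos : ∀ᶠ y in 𝓝 x0, 0 < η y := hηs.diff.continuousAt.eventually (lt_mem_nhds hpos)
  -- derivatives of log η
  have hl1 : ∀ v, DD v (fun y => Real.log (η y)) =ᶠ[𝓝 x0] fun y => (η y)⁻¹ * DD v η y := by
    intro v
    filter_upwards [hηpos, hηs.ev_diff] with y h1 h2
    simp [DD, fderiv.log h2 h1.ne']
  have hinv : SM (fun y => (η y)⁻¹) x0 := ContDiffAt.inv hηs hpos.ne'
  have hl2 : ∀ v, DD v (DD v (fun y => Real.log (η y))) x0 =
      (η x0)⁻¹ * DD v (DD v η) x0 - ((η x0)⁻¹ * DD v η x0) ^ 2 := by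
    intro v
    rw [(DD_congr (hl1 v) v).self_of_nhds, DD_mul hinv.diff (hηs.dd v).diff]
    have : DD v (fun y => (η y)⁻¹) x0 = - ((η x0)⁻¹ ^ 2 * DD v η x0) := by
      have h0 : HasFDerivAt (fun y => (η y)⁻¹) _ x0 :=
        (hasDerivAt_inv hpos.ne').comp_hasFDerivAt x0 hηs.diff.hasFDerivAt
      simp only [DD]
      rw [h0.fderiv]
      simp
    rw [this]; ring
  -- derivative conditions
  have hm := fun k => DD2_nonpos hF hmax (e k)
  have f1 : ∀ k, (η x0)⁻¹ * DD (e k) η x0 = - (κ * DD (e k) L x0) := by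
    intro k
    have := (hm k).1
    rw [DD_add hlog.diff hκL.diff, DD_const_mul _ hL.diff, (hl1 (e k)).self_of_nhds] at this
    linarith
  have f2 : ∀ k, (η x0)⁻¹ * DD (e k) (DD (e k) η) x0 - (κ * DD (e k) L x0) ^ 2 +
      κ * DD (e k) (DD (e k) L) x0 ≤ 0 := by
    intro k
    have h2 := (hm k).2
    have h3 : DD (e k) (fun y => Real.log (η y) + κ * L y) =ᶠ[𝓝 x0]
        fun y => DD (e k) (fun y => Real.log (η y)) y + κ * DD (e k) L y := by
      filter_upwards [hlog.ev_diff, hκL.ev_diff, hL.ev_diff] with y h1 h2 h3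
      rw [DD_add h1 h2, DD_const_mul _ h3]
    rw [(DD_congr h3 (e k)).self_of_nhds, DD_add (hlog.dd _).diff
      ((SM.const κ x0).mul (hL.dd _)).diff, DD_const_mul _ (hL.dd _).diff, hl2, f1] at h2
    linarith
  -- second derivatives of η
  have hη2 : ∀ k, DD (e k) (DD (e k) η) x0 = 2 * lam k ^ 2 - 2 * t ^ 2 +
      2 * ∑ i, DD (e i) u x0 * DD (e i) (fun y => HU u e y k k) x0 := by
    intro k
    have hn1 : DD (e k) (fun y : E => ‖y‖ ^ 2) = fun y => 2 * inner ℝ (e k) y := by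
      ext y
      simp [DD, fderiv_norm_sq_apply, real_inner_comm]
    have hn2 : DD (e k) (fun y => 2 * inner ℝ (e k) y) x0 = 2 := by
      have : HasFDerivAt (fun y => 2 * inner ℝ (e k) y) ((2 : ℝ) • innerSL ℝ (e k)) x0 :=
        (innerSL ℝ (e k)).hasFDerivAt.const_mul 2
      simp [DD, this.fderiv, he]
    have h3 : DD (e k) η =ᶠ[𝓝 x0] fun y => ∑ i, 2 * (DD (e i) u y * HU u e y k i) +
        (-t ^ 2) * (2 * inner ℝ (e k) y) := by
      have hd1 : ∀ᶠ y in 𝓝 x0, ∀ i, DifferentiableAt ℝ (DD (e i) u) y := by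
        simp only [eventually_all]
        exact fun i => (hDu i).ev_diff
      filter_upwards [DD_congr hη' (e k), hS1.ev_diff, hns.ev_diff, hS2.ev_diff, hS3.ev_diff, hd1]
        with y h1 h2 h3 h4 h5 h6
      rw [h1, DD_add h5 (by fun_prop), DD_add h2 h4, DD_const_mul _ h3, hn1, DD_const,
        DD_sum (fun i _ => (h6 i).fun_mul (h6 i))]
      simp only [DD_mul (h6 _) (h6 _), add_zero]
      congr 1
      refine Finset.sum_congr rfl fun i _ => ?_
      simp only [HU, Matrix.of_apply]
      ring
    have hHs : ∀ i, SM (fun y => DD (e i) u y * HU u e y k i) x0 := fun i =>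
      (hDu i).mul (HU_sm hu e k i)
    have hin : SM (fun y : E => 2 * inner ℝ (e k) y) x0 := by
      refine (SM.const (2 : ℝ) x0).mul ?_
      exact (innerSL ℝ (e k)).contDiff.contDiffAt
    rw [(DD_congr h3 (e k)).self_of_nhds,
      DD_add (SM.sum fun i _ => (SM.const (2 : ℝ) x0).mul (hHs i)).diff
        ((SM.const (- t ^ 2) x0).mul hin).diff, DD_const_mul _ hin.diff, hn2,
      DD_sum (fun i _ => ((SM.const (2 : ℝ) x0).mul (hHs i)).diff)]
    simp only [DD_const_mul _ (hHs _).diff, DD_mul (hDu _).diff (HU_sm hu e k _).diff]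
    have h8 : ∀ i, DD (e k) (fun y => HU u e y k i) x0 = DD (e i) (fun y => HU u e y k k) x0 := by
      intro i
      rw [T_sym1 hu e k i k, T_sym2 hu e i k k]
    have h9 : ∀ i, DD (e k) (DD (e i) u) x0 * HU u e x0 k i = if k = i then lam k ^ 2 else 0 := by
      intro i
      change HU u e x0 k i * HU u e x0 k i = _
      rw [hd]
      by_cases h : k = i
      · subst h; simp [pow_two]
      · simp [h]
    simp only [h8, h9, mul_add, Finset.sum_add_distrib, ← Finset.mul_sum, Finset.sum_ite_eq,
      Finset.mem_univ, if_true]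
    ring
  -- combine
  set g : Fin n → ℝ := fun i => (1 + lam i ^ 2)⁻¹ with hg
  have hgpos : ∀ i, 0 < g i := fun i => by simp only [hg]; positivity
  have hfirst := fun v => core_first' (HU_sm hu e) hW hd v
  have hlap := lap_L hu e hW hd
  have hjac := jacobi_alg hn hε lam g hgpos (fun i j k => DD (e k) (fun y => HU u e y i j) x0)
    (fun i j k => T_sym1 hu e i j k) (fun i j k => T_sym2 hu e i j k) hc
  have hJ : κ * ∑ k, g k * (DD (e k) L x0) ^ 2 ≤ ∑ k, g k * DD (e k) (DD (e k) L) x0 := by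
    refine le_trans (le_of_eq ?_) (hjac.trans (le_of_eq hlap.symm))
    congr 1
    refine Finset.sum_congr rfl fun k _ => ?_
    rw [(hfirst (e k)).1]
  have hsum : ∑ k, g k * ((η x0)⁻¹ * DD (e k) (DD (e k) η) x0 - (κ * DD (e k) L x0) ^ 2 +
      κ * DD (e k) (DD (e k) L) x0) ≤ 0 :=
    Finset.sum_nonpos fun k _ => mul_nonpos_of_nonneg_of_nonpos (hgpos k).le (f2 k)
  have hexp : ∑ k, g k * ((η x0)⁻¹ * DD (e k) (DD (e k) η) x0 - (κ * DD (e k) L x0) ^ 2 +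
      κ * DD (e k) (DD (e k) L) x0) = (η x0)⁻¹ * ∑ k, g k * DD (e k) (DD (e k) η) x0 +
      κ * (∑ k, g k * DD (e k) (DD (e k) L) x0 - κ * ∑ k, g k * (DD (e k) L x0) ^ 2) := by
    simp only [Finset.mul_sum, ← Finset.sum_sub_distrib, ← Finset.sum_add_distrib]
    refine Finset.sum_congr rfl fun k _ => ?_
    ring
  have hη3 : ∑ k, g k * DD (e k) (DD (e k) η) x0 = 2 * ∑ k, g k * (lam k ^ 2 - t ^ 2) := by
    have z : ∑ k, g k * (2 * ∑ i, DD (e i) u x0 * DD (e i) (fun y => HU u e y k k) x0) = 0 := by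
      have : ∑ k, g k * (2 * ∑ i, DD (e i) u x0 * DD (e i) (fun y => HU u e y k k) x0) =
          ∑ i, 2 * DD (e i) u x0 * ∑ k, g k * DD (e i) (fun y => HU u e y k k) x0 := by
        simp only [Finset.mul_sum]
        rw [Finset.sum_comm]
        refine Finset.sum_congr rfl fun i _ => Finset.sum_congr rfl fun k _ => ?_
        ring
      rw [this]
      refine Finset.sum_eq_zero fun i _ => ?_
      rw [(hfirst (e i)).2, mul_zero]
    have z2 : ∑ k, g k * DD (e k) (DD (e k) η) x0 = ∑ k, g k * (2 * lam k ^ 2 - 2 * t ^ 2) +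
        ∑ k, g k * (2 * ∑ i, DD (e i) u x0 * DD (e i) (fun y => HU u e y k k) x0) := by
      rw [← Finset.sum_add_distrib]
      refine Finset.sum_congr rfl fun k _ => ?_
      rw [hη2, mul_add]
    rw [z2, z, add_zero, Finset.mul_sum]
    refine Finset.sum_congr rfl fun k _ => ?_
    ring
  rw [hexp, hη3] at hsum
  have h7 := mul_nonneg hκ0.le (sub_nonneg.2 hJ)
  have h8 : (η x0)⁻¹ * (2 * ∑ k, g k * (lam k ^ 2 - t ^ 2)) ≤ 0 := by linarith
  by_contra! hcon
  have : 0 < (η x0)⁻¹ * (2 * ∑ k, g k * (lam k ^ 2 - t ^ 2)) := by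
    have := inv_pos.2 hpos
    positivity
  linarith

end Jac

end

section
open Filter Topology

section Lin
variable {n : ℕ}

lemma CM_conj (P A : Matrix (Fin n) (Fin n) ℝ) (hP : P.transpose * P = 1) :
    (CM (P.transpose * A * P)).det = (CM A).det := by
  have hP' : (P.map (fun t : ℝ => (t : ℂ))).transpose * P.map (fun t : ℝ => (t : ℂ)) = 1 := by
    have := congrArg (fun M => Matrix.map M Complex.ofRealHom) hP
    simp only [Matrix.map_mul, Matrix.transpose_map] at this
    rw [Matrix.map_one _ (map_zero _) (map_one _)] at this
    exact this
  have h : CM (P.transpose * A * P) = (P.map (fun t : ℝ => (t : ℂ))).transpose * CM A *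
      P.map (fun t : ℝ => (t : ℂ)) := by
    have h1 : (P.transpose * A * P).map (fun t : ℝ => (t : ℂ)) =
        (P.map (fun t : ℝ => (t : ℂ))).transpose * A.map (fun t : ℝ => (t : ℂ)) *
          P.map (fun t : ℝ => (t : ℂ)) := by
      have : (P.transpose * A * P).map Complex.ofRealHom =
        (P.map Complex.ofRealHom).transpose * A.map Complex.ofRealHom *
          P.map Complex.ofRealHom := by
        simp only [Matrix.map_mul, Matrix.transpose_map]
      exact this
    rw [CM, CM, h1, Matrix.mul_add, Matrix.add_mul, Matrix.mul_one, hP', Matrix.mul_smul,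
      Matrix.smul_mul]
  rw [h, Matrix.det_mul_right_comm, hP', one_mul]

lemma eig_diag {A : Matrix (Fin n) (Fin n) ℝ} (hA : A.IsHermitian) :
    (hA.eigenvectorUnitary : Matrix (Fin n) (Fin n) ℝ).transpose * A *
      (hA.eigenvectorUnitary : Matrix (Fin n) (Fin n) ℝ) = Matrix.diagonal hA.eigenvalues := by
  have h := hA.conjStarAlgAut_star_eigenvectorUnitary
  rw [Unitary.conjStarAlgAut_star_apply] at h
  simpa [Matrix.star_eq_conjTranspose, Function.comp_def] using h

lemma eig_orth {A : Matrix (Fin n) (Fin n) ℝ} (hA : A.IsHermitian) :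
    (hA.eigenvectorUnitary : Matrix (Fin n) (Fin n) ℝ).transpose *
      (hA.eigenvectorUnitary : Matrix (Fin n) (Fin n) ℝ) = 1 := by
  have h := Unitary.coe_star_mul_self hA.eigenvectorUnitary
  simpa [Matrix.star_eq_conjTranspose] using h

lemma CM_det {A : Matrix (Fin n) (Fin n) ℝ} (hA : A.IsHermitian) :
    (CM A).det = ∏ i, (1 + Complex.I * (hA.eigenvalues i : ℂ)) := by
  rw [← CM_conj _ A (eig_orth hA), eig_diag hA]
  have : CM (Matrix.diagonal hA.eigenvalues) =
      Matrix.diagonal fun i => (1 + Complex.I * (hA.eigenvalues i : ℂ)) := by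
    ext i j
    rw [CM_apply]
    by_cases h : i = j
    · subst h; simp
    · simp [h]
  rw [this, Matrix.det_diagonal]

lemma polar (x : ℝ) : (1 + Complex.I * (x : ℂ)) =
    ((Real.sqrt (1 + x ^ 2) : ℝ) : ℂ) * Complex.exp (((Real.arctan x : ℝ) : ℂ) * Complex.I) := by
  have h : Real.sqrt (1 + x ^ 2) ≠ 0 := by positivity
  rw [Complex.exp_mul_I, ← Complex.ofReal_cos, ← Complex.ofReal_sin, Real.cos_arctan,
    Real.sin_arctan]
  apply Complex.ext <;> simp <;> field_simp

/-- The phase-normalised determinant. -/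
lemma phase {A : Matrix (Fin n) (Fin n) ℝ} (hA : A.IsHermitian) {c : ℝ}
    (hc : ∑ i, Real.arctan (hA.eigenvalues i) = c) :
    Complex.exp (-((c : ℂ) * Complex.I)) * (CM A).det =
      ((∏ i, Real.sqrt (1 + hA.eigenvalues i ^ 2) : ℝ) : ℂ) := by
  rw [CM_det hA]
  simp only [polar, Finset.prod_mul_distrib, ← Complex.exp_sum, ← Finset.sum_mul]
  rw [← Complex.ofReal_sum, hc, Complex.ofReal_prod]
  rw [mul_left_comm, ← Complex.exp_add]
  simp

lemma HU_Hess {u : EuclideanSpace ℝ (Fin n) → ℝ} {y : EuclideanSpace ℝ (Fin n)}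
    (h : ContDiffAt ℝ 2 u y) (P : Matrix (Fin n) (Fin n) ℝ)
    (e : Fin n → EuclideanSpace ℝ (Fin n)) (he : ∀ i a, e i a = P a i) :
    HU u e y = P.transpose * Hess u y * P := by
  have hexp : ∀ i, e i = ∑ a, P a i • EuclideanSpace.single a (1 : ℝ) := by
    intro i
    ext b
    simp [he, Finset.sum_apply, Pi.single_apply]
  ext i j
  rw [HU, Matrix.of_apply, DD_DD_eq h, hexp i, hexp j]
  simp only [map_sum, map_smul, Matrix.mul_apply, Matrix.transpose_apply, Hess, Matrix.of_apply,
    iteratedFDeriv_two_apply, _root_.sum_apply, _root_.smul_apply,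
    smul_eq_mul, Matrix.cons_val_zero, Matrix.cons_val_one, Finset.mul_sum, Finset.sum_mul]
  refine Finset.sum_congr rfl fun a _ => Finset.sum_congr rfl fun b _ => ?_
  ring

lemma grad_parseval {u : EuclideanSpace ℝ (Fin n) → ℝ} {y : EuclideanSpace ℝ (Fin n)}
    (b : OrthonormalBasis (Fin n) ℝ (EuclideanSpace ℝ (Fin n))) :
    ‖gradient u y‖ ^ 2 = ∑ i, DD (b i) u y * DD (b i) u y := by
  rw [← b.sum_sq_norm_inner_right]
  refine Finset.sum_congr rfl fun i _ => ?_
  have : inner ℝ (b i) (gradient u y) = DD (b i) u y := by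
    rw [real_inner_comm, gradient, InnerProductSpace.toDual_symm_apply, DD]
  rw [this, Real.norm_eq_abs, sq_abs, pow_two]

end Lin

end

section
open Filter Topology

section Num

lemma prod_bd {ι : Type*} (s : Finset ι) (y : ι → ℝ) (h0 : ∀ i, 0 ≤ y i) (h1 : ∀ i, y i ≤ 1) :
    1 - ∑ i ∈ s, (1 - y i) ≤ ∏ i ∈ s, y i ∧ ∏ i ∈ s, y i ≤ 1 := by
  classical
  induction s using Finset.induction_on with
  | empty => simp
  | insert a s ha ih =>
    rw [Finset.sum_insert ha, Finset.prod_insert ha]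
    have hp : 0 ≤ ∏ i ∈ s, y i := Finset.prod_nonneg fun i _ => h0 i
    constructor
    · nlinarith [ih.1, ih.2, h0 a, h1 a, mul_nonneg (sub_nonneg.2 (h1 a)) (sub_nonneg.2 ih.2)]
    · nlinarith [ih.1, ih.2, h0 a, h1 a]

lemma num1 {n : ℕ} (lam : Fin n → ℝ) {t : ℝ} (ht : ((n : ℝ) - 1) * t ^ 2 < 1)
    (h : ∑ k, (1 + lam k ^ 2)⁻¹ * (lam k ^ 2 - t ^ 2) ≤ 0) :
    ∏ k, (1 + lam k ^ 2) ≤ (1 + t ^ 2) / (1 - ((n : ℝ) - 1) * t ^ 2) := by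
  have hpos : ∀ k, 0 < 1 + lam k ^ 2 := fun k => by positivity
  have hb := (prod_bd Finset.univ (fun k => (1 + lam k ^ 2)⁻¹)
    (fun k => (inv_pos.2 (hpos k)).le)
    (fun k => inv_le_one_of_one_le₀ (by nlinarith [sq_nonneg (lam k)]))).1
  have e1 : ∀ k, (1 + lam k ^ 2)⁻¹ * (lam k ^ 2 - t ^ 2) = 1 - (1 + t ^ 2) * (1 + lam k ^ 2)⁻¹ := by
    intro k
    have := (hpos k).ne'
    field_simp
    ring
  simp only [e1, Finset.sum_sub_distrib, ← Finset.mul_sum, Finset.sum_const, Finset.card_univ,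
    Fintype.card_fin, nsmul_eq_mul, mul_one] at h hb
  rw [Finset.prod_inv_distrib] at hb
  have hP : 0 < ∏ k, (1 + lam k ^ 2) := Finset.prod_pos fun k _ => hpos k
  set P := ∏ k, (1 + lam k ^ 2)
  set S := ∑ k, (1 + lam k ^ 2)⁻¹
  have ht1 : 0 < 1 + t ^ 2 := by positivity
  rw [le_div_iff₀ (by linarith)]
  have h3 : (1 - ((n : ℝ) - 1) * t ^ 2) ≤ (1 + t ^ 2) * P⁻¹ := by
    have := mul_le_mul_of_nonneg_left hb ht1.le
    nlinarith
  calc P * (1 - ((n : ℝ) - 1) * t ^ 2) ≤ P * ((1 + t ^ 2) * P⁻¹) :=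
        mul_le_mul_of_nonneg_left h3 hP.le
    _ = 1 + t ^ 2 := by field_simp

/-- Algebra of the constants. -/
lemma num_consts {n : ℕ} (hn : 2 ≤ n) {δ α : ℝ} (hδ0 : 0 < δ)
    (hδ : δ < 1 / Real.sqrt ((n : ℝ) - 1)) (hα : α = (1 / Real.sqrt ((n : ℝ) - 1) - δ) / 2) :
    0 < α ∧ ((n : ℝ) - 1) * (α + δ) ^ 2 < 1 ∧ 1 ≤ 1 + δ / α ∧
    1 ≤ (1 + (α + δ) ^ 2) / (1 - ((n : ℝ) - 1) * (α + δ) ^ 2) ∧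
    1 + δ / α ≤ ((1 + (α + δ) ^ 2) / (1 - ((n : ℝ) - 1) * (α + δ) ^ 2)) ^ (n - 1) ∧
    2 ≤ ((1 + (α + δ) ^ 2) / (1 - ((n : ℝ) - 1) * (α + δ) ^ 2)) ^ n := by
  have hnr : (2 : ℝ) ≤ n := by exact_mod_cast hn
  have hm : (0 : ℝ) < (n : ℝ) - 1 := by linarith
  set s := Real.sqrt ((n : ℝ) - 1) with hs
  have hs0 : 0 < s := Real.sqrt_pos.2 hm
  have hs2 : (n : ℝ) - 1 = s ^ 2 := (Real.sq_sqrt hm.le).symm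
  set d := δ * s with hd
  have hd0 : 0 < d := by positivity
  have hd1 : d < 1 := by rwa [lt_div_iff₀ hs0] at hδ
  have hδe : δ = d / s := by rw [hd]; field_simp
  have hαe : α = (1 - d) / (2 * s) := by rw [hα, hδe]; field_simp
  have hα0 : 0 < α := by rw [hαe]; apply div_pos <;> linarith
  have hte : α + δ = (1 + d) / (2 * s) := by rw [hαe, hδe]; field_simp; ring
  have hA : 1 + δ / α = (1 + d) / (1 - d) := by
    have : 1 - d ≠ 0 := by linarith
    rw [hαe, hδe]; field_simp; ring
  have hD : 1 - ((n : ℝ) - 1) * (α + δ) ^ 2 = (1 - d) * (3 + d) / 4 := by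
    rw [hte, hs2]; field_simp; ring
  have h1d : 0 < 1 - d := by linarith
  have hDpos : 0 < (1 - d) * (3 + d) / 4 := by positivity
  have ht2 : 0 ≤ (α + δ) ^ 2 := sq_nonneg _
  have hQ1 : 1 / (1 - d) ≤ (1 + (α + δ) ^ 2) / ((1 - d) * (3 + d) / 4) := by
    rw [div_le_div_iff₀ h1d hDpos]
    nlinarith [mul_nonneg h1d.le ht2, mul_pos h1d h1d]
  have hone : 1 ≤ 1 / (1 - d) := by rw [le_div_iff₀ h1d]; linarith
  refine ⟨hα0, ?_, ?_, ?_, ?_, ?_⟩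
  · linarith
  · have := div_pos hδ0 hα0; linarith
  · rw [hD]; exact hone.trans hQ1
  · rw [hD, hA]
    rcases Nat.lt_or_ge n 3 with h3 | h3
    · have : n = 2 := by omega
      subst this
      have hs1 : s ^ 2 = 1 := by rw [← hs2]; norm_num
      have : (α + δ) ^ 2 = (1 + d) ^ 2 / 4 := by
        rw [hte, div_pow, mul_pow, hs1]; norm_num
      rw [this]
      simp only [Nat.add_one_sub_one, pow_one, Nat.reduceSub]
      rw [div_le_div_iff₀ h1d hDpos]
      nlinarith [mul_pos h1d h1d]
    · calc (1 + d) / (1 - d) ≤ (1 / (1 - d)) ^ 2 := by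
            rw [div_pow, div_le_div_iff₀ h1d (by positivity)]
            nlinarith [mul_pos h1d hd0, mul_pos h1d (mul_pos hd0 hd0)]
        _ ≤ _ := pow_le_pow_left₀ (by positivity) hQ1 2
        _ ≤ _ := pow_le_pow_right₀ (hone.trans hQ1) (by omega)
  · rw [hD]
    have hQ2 : (4 / 3) * (1 + (α + δ) ^ 2) ≤ (1 + (α + δ) ^ 2) / ((1 - d) * (3 + d) / 4) := by
      rw [le_div_iff₀ hDpos]
      have : (1 - d) * (3 + d) / 4 ≤ 3 / 4 := by nlinarith
      nlinarith
    have hb := one_add_mul_le_pow (a := (α + δ) ^ 2) (by linarith) n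
    have hnt : 1 / 4 ≤ (n : ℝ) * (α + δ) ^ 2 := by
      have : s ^ 2 * (α + δ) ^ 2 = (1 + d) ^ 2 / 4 := by
        rw [hte]; field_simp; ring
      nlinarith
    have h43 : (16 / 9 : ℝ) ≤ (4 / 3 : ℝ) ^ n := by
      calc (16 / 9 : ℝ) = (4 / 3) ^ 2 := by norm_num
        _ ≤ _ := pow_le_pow_right₀ (by norm_num) hn
    calc (2 : ℝ) ≤ (16 / 9) * (5 / 4) := by norm_num
      _ ≤ (4 / 3 : ℝ) ^ n * (1 + (α + δ) ^ 2) ^ n :=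
        mul_le_mul h43 (by linarith) (by norm_num) (by positivity)
      _ = ((4 / 3) * (1 + (α + δ) ^ 2)) ^ n := (mul_pow _ _ _).symm
      _ ≤ _ := pow_le_pow_left₀ (by positivity) hQ2 n

lemma num_final {n : ℕ} (hn : 2 ≤ n) {ε A Q L0 L1 : ℝ} (hε : 0 < ε) (hε6 : ε ≤ 6)
    (hA : 1 ≤ A) (hQ : 1 ≤ Q) (hAQ : A ≤ Q ^ (n - 1))
    (h : Real.exp ((ε / (n - 1 + ε)) * L0) ≤ A * Real.exp ((ε / (n - 1 + ε)) * L1))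
    (hL1 : Real.exp (2 * L1) ≤ Q) :
    Real.exp (2 * L0) ≤ A ^ (4 * (n : ℝ) / ε) * Q ^ n := by
  have hnr : (2 : ℝ) ≤ n := by exact_mod_cast hn
  have hA0 : 0 < A := by linarith
  set κ : ℝ := ε / (n - 1 + ε) with hκ
  have hden : 0 < (n : ℝ) - 1 + ε := by linarith
  have hκ0 : 0 < κ := by rw [hκ]; positivity
  have h1 : κ * L0 ≤ Real.log A + κ * L1 := by
    rw [← Real.exp_le_exp, Real.exp_add, Real.exp_log hA0]; exact h
  have h2 : 2 * L0 ≤ Real.log A * (2 / κ) + 2 * L1 := by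
    have := mul_le_mul_of_nonneg_left h1 (by positivity : 0 ≤ 2 / κ)
    have e : 2 / κ * (κ * L0) = 2 * L0 := by field_simp
    have e' : 2 / κ * (Real.log A + κ * L1) = Real.log A * (2 / κ) + 2 * L1 := by field_simp
    linarith
  have h3 : 2 / κ ≤ 4 * (n : ℝ) / ε + 1 := by
    have : 2 / κ = 2 * (n - 1 + ε) / ε := by rw [hκ]; field_simp
    rw [this, div_add_one hε.ne', div_le_div_iff_of_pos_right hε]
    linarith
  calc Real.exp (2 * L0) ≤ Real.exp (Real.log A * (2 / κ) + 2 * L1) := Real.exp_le_exp.2 h2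
    _ = A ^ (2 / κ) * Real.exp (2 * L1) := by rw [Real.exp_add, Real.rpow_def_of_pos hA0]
    _ ≤ A ^ (4 * (n : ℝ) / ε + 1) * Q := by
        gcongr
    _ = A ^ (4 * (n : ℝ) / ε) * (A * Q) := by rw [Real.rpow_add_one hA0.ne']; ring
    _ ≤ A ^ (4 * (n : ℝ) / ε) * (Q ^ (n - 1) * Q) := by gcongr
    _ = A ^ (4 * (n : ℝ) / ε) * Q ^ n := by
        rw [← pow_succ, Nat.sub_add_cancel (by omega)]

end Num

end

open Filter Topology

/-- The explicit eigenvalue bound (2.11) at the origin in the proof of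
Lemma 2.2, with `α = (1/√(n−1) − δ)/2`. -/
theorem stmt_8 {n : ℕ} (hn : 2 ≤ n) (ε : ℝ) (hε : 0 < ε)
    (δ : ℝ) (hδ0 : 0 < δ) (hδ : δ < 1 / Real.sqrt ((n : ℝ) - 1))
    (α : ℝ) (hα : α = (1 / Real.sqrt ((n : ℝ) - 1) - δ) / 2)
    (c : ℝ) (u : EuclideanSpace ℝ (Fin n) → ℝ)
    (hu : ContDiffOn ℝ (⊤ : ℕ∞) u (Metric.ball 0 1))
    (hsym : ∀ x ∈ Metric.ball (0 : EuclideanSpace ℝ (Fin n)) 1, (Hess u x).IsHermitian)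
    (hsol : ∀ x, ∀ hx : x ∈ Metric.ball (0 : EuclideanSpace ℝ (Fin n)) 1,
      ∑ i, Real.arctan ((hsym x hx).eigenvalues i) = c)
    (hcond : ∀ x, ∀ hx : x ∈ Metric.ball (0 : EuclideanSpace ℝ (Fin n)) 1, ∀ i j : Fin n,
      0 ≤ 3 + (1 - ε) * ((hsym x hx).eigenvalues i) ^ 2 +
        2 * (hsym x hx).eigenvalues i * (hsym x hx).eigenvalues j)
    (hgrad : ∀ x ∈ Metric.ball (0 : EuclideanSpace ℝ (Fin n)) 1, ‖gradient u x‖ ≤ δ) :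
    ∀ i : Fin n,
      1 + ((hsym 0 (Metric.mem_ball_self one_pos)).eigenvalues i) ^ 2 ≤
        (1 + δ / α) ^ ((4 * (n : ℝ)) / ε) *
          ((1 + (α + δ) ^ 2) / (1 - ((n : ℝ) - 1) * (α + δ) ^ 2)) ^ n := by
  intro i0
  obtain ⟨hα0, ht1, hA1, hQ1, hAQ, hQ2⟩ := num_consts hn hδ0 hδ hα
  rcases lt_or_ge 6 ε with hε6 | hε6
  · -- large ε
    have h := hcond 0 (Metric.mem_ball_self one_pos) i0 i0
    set l := (hsym 0 (Metric.mem_ball_self one_pos)).eigenvalues i0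
    have hl : l ^ 2 ≤ 1 := by nlinarith [sq_nonneg l]
    have hr : (1 : ℝ) ≤ (1 + δ / α) ^ ((4 * (n : ℝ)) / ε) :=
      Real.one_le_rpow hA1 (by positivity)
    nlinarith
  have h0b : (0 : EuclideanSpace ℝ (Fin n)) ∈ Metric.ball (0 : EuclideanSpace ℝ (Fin n)) 1 :=
    Metric.mem_ball_self one_pos
  have hbo : ∀ x ∈ Metric.ball (0 : EuclideanSpace ℝ (Fin n)) 1,
      ∀ᶠ y in 𝓝 x, y ∈ Metric.ball (0 : EuclideanSpace ℝ (Fin n)) 1 :=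
    fun x hx => Metric.isOpen_ball.mem_nhds hx
  have huS : ∀ x ∈ Metric.ball (0 : EuclideanSpace ℝ (Fin n)) 1, SM u x :=
    fun x hx => hu.contDiffAt (Metric.isOpen_ball.mem_nhds hx)
  have hu2 : ∀ x ∈ Metric.ball (0 : EuclideanSpace ℝ (Fin n)) 1, ContDiffAt ℝ 2 u x :=
    fun x hx => ContDiffAt.of_le (huS x hx) (by norm_cast)
  set w : ℂ := Complex.exp (-((c : ℂ) * Complex.I)) with hw
  obtain ⟨L, hLdef⟩ : ∃ L : EuclideanSpace ℝ (Fin n) → ℝ,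
      ∀ y, L y = Real.log ((w * (CM (Hess u y)).det).re) := ⟨_, fun _ => rfl⟩
  have hLexp : ∀ x (hx : x ∈ Metric.ball (0 : EuclideanSpace ℝ (Fin n)) 1),
      Real.exp (L x) = ∏ i, Real.sqrt (1 + (hsym x hx).eigenvalues i ^ 2) := by
    intro x hx
    rw [hLdef, phase (hsym x hx) (hsol x hx), Complex.ofReal_re, Real.exp_log]
    exact Finset.prod_pos fun i _ => by positivity
  have hLW : ∀ x ∈ Metric.ball (0 : EuclideanSpace ℝ (Fin n)) 1,
      ((Real.exp (L x) : ℝ) : ℂ) = w * (CM (Hess u x)).det := by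
    intro x hx
    rw [hLexp x hx, phase (hsym x hx) (hsol x hx)]
  have hL2 : ∀ x (hx : x ∈ Metric.ball (0 : EuclideanSpace ℝ (Fin n)) 1),
      Real.exp (2 * L x) = ∏ i, (1 + (hsym x hx).eigenvalues i ^ 2) := by
    intro x hx
    rw [mul_comm, Real.exp_mul, hLexp x hx, Real.rpow_two, ← Finset.prod_pow]
    exact Finset.prod_congr rfl fun i _ => Real.sq_sqrt (by positivity)
  -- the eigenframe
  have hfr : ∀ x (hx : x ∈ Metric.ball (0 : EuclideanSpace ℝ (Fin n)) 1),
      ∀ y ∈ Metric.ball (0 : EuclideanSpace ℝ (Fin n)) 1,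
      HU u (fun i => (hsym x hx).eigenvectorBasis i) y =
        ((hsym x hx).eigenvectorUnitary : Matrix (Fin n) (Fin n) ℝ).transpose * Hess u y *
        ((hsym x hx).eigenvectorUnitary : Matrix (Fin n) (Fin n) ℝ) :=
    fun x hx y hy => HU_Hess (hu2 y hy) _ _ fun i a => rfl
  have hfW : ∀ x (hx : x ∈ Metric.ball (0 : EuclideanSpace ℝ (Fin n)) 1),
      ∀ᶠ y in 𝓝 x, ((Real.exp (L y) : ℝ) : ℂ) =
        w * (CM (HU u (fun i => (hsym x hx).eigenvectorBasis i) y)).det := by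
    intro x hx
    filter_upwards [hbo x hx] with y hy
    rw [hfr x hx y hy, CM_conj _ _ (eig_orth _), hLW y hy]
  have hLs : ∀ x ∈ Metric.ball (0 : EuclideanSpace ℝ (Fin n)) 1, SM L x :=
    fun x hx => core_smooth (HU_sm (huS x hx) _) (hfW x hx)
  -- the auxiliary function
  set t := α + δ with ht
  have ht0 : 0 < t := by linarith
  set κ : ℝ := ε / (n - 1 + ε) with hκ
  obtain ⟨η, hη⟩ : ∃ η : EuclideanSpace ℝ (Fin n) → ℝ,
      ∀ y, η y = ‖gradient u y‖ ^ 2 + (- t ^ 2) * ‖y‖ ^ 2 + α * t := ⟨_, fun _ => rfl⟩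
  have hηle : ∀ y ∈ Metric.ball (0 : EuclideanSpace ℝ (Fin n)) 1,
      η y ≤ δ ^ 2 + α * t - t ^ 2 * ‖y‖ ^ 2 := by
    intro y hy
    have := pow_le_pow_left₀ (norm_nonneg _) (hgrad y hy) 2
    rw [hη]; linarith
  have hη0 : α * t ≤ η 0 := by
    rw [hη]; simp
  set ρ : ℝ := Real.sqrt (t ^ 2 - α * δ) / t with hρ
  have hαδ : 0 < t ^ 2 - α * δ := by rw [ht]; nlinarith [mul_pos hα0 hδ0]
  have hρ0 : 0 < ρ := by rw [hρ]; exact div_pos (Real.sqrt_pos.2 hαδ) ht0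
  have hρ2 : t ^ 2 * ρ ^ 2 = t ^ 2 - α * δ := by
    rw [hρ, div_pow, Real.sq_sqrt hαδ.le]; field_simp
  have hρ1 : ρ < 1 := by
    by_contra! h
    have : 1 ≤ ρ ^ 2 := one_le_pow₀ h
    nlinarith [mul_pos hα0 hδ0, sq_nonneg t]
  have hsub : Metric.closedBall (0 : EuclideanSpace ℝ (Fin n)) ρ ⊆ Metric.ball 0 1 :=
    Metric.closedBall_subset_ball hρ1
  have hgc : ∀ x ∈ Metric.ball (0 : EuclideanSpace ℝ (Fin n)) 1, ContinuousAt (gradient u) x := by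
    intro x hx
    have h1 : ContDiffAt ℝ (⊤ : ℕ∞) (fderiv ℝ u) x := ContDiffAt.fderiv_right (huS x hx) (by simp)
    exact (InnerProductSpace.toDual ℝ (EuclideanSpace ℝ (Fin n))).symm.continuous.continuousAt.comp
      h1.continuousAt
  have hηc : ∀ x ∈ Metric.ball (0 : EuclideanSpace ℝ (Fin n)) 1, ContinuousAt η x := by
    intro x hx
    have h1 := hgc x hx
    have h2 : η = fun y => ‖gradient u y‖ ^ 2 + (- t ^ 2) * ‖y‖ ^ 2 + α * t := funext hη
    rw [h2]
    fun_prop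
  have hfc : ContinuousOn (fun y => η y * Real.exp (κ * L y))
      (Metric.closedBall (0 : EuclideanSpace ℝ (Fin n)) ρ) := by
    intro x hx
    have h1 := hηc x (hsub hx)
    have h2 : ContinuousAt L x := (hLs x (hsub hx)).diff.continuousAt
    have h3 : ContinuousAt (fun y => η y * Real.exp (κ * L y)) x := by fun_prop
    exact h3.continuousWithinAt
  obtain ⟨x0, hx0, hmax⟩ := (isCompact_closedBall (0 : EuclideanSpace ℝ (Fin n)) ρ).exists_isMaxOn
    ⟨0, Metric.mem_closedBall_self hρ0.le⟩ hfc
  have hx0b := hsub hx0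
  have hf0 : η 0 * Real.exp (κ * L 0) ≤ η x0 * Real.exp (κ * L x0) :=
    hmax (Metric.mem_closedBall_self hρ0.le)
  have hαt : 0 < α * t := mul_pos hα0 ht0
  have hpos : 0 < η x0 := by
    have h1 : 0 < η 0 * Real.exp (κ * L 0) := mul_pos (by linarith) (Real.exp_pos _)
    exact pos_of_mul_pos_left (h1.trans_le hf0) (Real.exp_pos _).le
  have hx0ρ : x0 ∈ Metric.ball (0 : EuclideanSpace ℝ (Fin n)) ρ := by
    rw [mem_ball_zero_iff]
    by_contra! h
    have h1 : ρ ^ 2 ≤ ‖x0‖ ^ 2 := pow_le_pow_left₀ hρ0.le h 2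
    have h2 := hηle x0 hx0b
    have h3 := mul_le_mul_of_nonneg_left h1 (sq_nonneg t)
    have h4 : δ ^ 2 + α * t = t ^ 2 - α * δ := by rw [ht]; ring
    linarith
  have hloc : IsLocalMax (fun y => Real.log (η y) + κ * L y) x0 := by
    have hp : ∀ᶠ y in 𝓝 x0, 0 < η y := (hηc x0 hx0b).eventually (lt_mem_nhds hpos)
    filter_upwards [hp, Metric.isOpen_ball.mem_nhds hx0ρ] with y h1 h2
    have h3 : η y * Real.exp (κ * L y) ≤ η x0 * Real.exp (κ * L x0) :=
      hmax (Metric.ball_subset_closedBall h2)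
    have h4 := Real.log_le_log (mul_pos h1 (Real.exp_pos _)) h3
    rwa [Real.log_mul h1.ne' (Real.exp_pos _).ne', Real.log_mul hpos.ne' (Real.exp_pos _).ne',
      Real.log_exp, Real.log_exp] at h4
  have hmp := max_point (by omega) (huS x0 hx0b)
    (fun i => (hsym x0 hx0b).eigenvectorBasis i)
    (fun k => (hsym x0 hx0b).eigenvectorBasis.orthonormal.1 k) (hfW x0 hx0b)
    (lam := (hsym x0 hx0b).eigenvalues) (by rw [hfr x0 hx0b x0 hx0b, eig_diag]) hε
    (hcond x0 hx0b) t (α * t) η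
    (Eventually.of_forall fun y => by rw [hη, grad_parseval (hsym x0 hx0b).eigenvectorBasis])
    hpos hloc
  have hQx := num1 _ ht1 hmp
  rw [← hL2 x0 hx0b] at hQx
  have hineq : Real.exp (κ * L 0) ≤ (1 + δ / α) * Real.exp (κ * L x0) := by
    have h1 : α * t * Real.exp (κ * L 0) ≤ η 0 * Real.exp (κ * L 0) :=
      mul_le_mul_of_nonneg_right hη0 (Real.exp_pos _).le
    have h2 : η x0 ≤ α * t * (1 + δ / α) := by
      have h3 := hηle x0 hx0b
      have h4 : α * t * (1 + δ / α) = α * t + δ * t := by field_simp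
      nlinarith [mul_nonneg (sq_nonneg t) (sq_nonneg ‖x0‖), mul_pos hα0 hδ0]
    have h5 := mul_le_mul_of_nonneg_right h2 (Real.exp_pos (κ * L x0)).le
    have h6 : α * t * Real.exp (κ * L 0) ≤ α * t * ((1 + δ / α) * Real.exp (κ * L x0)) := by
      linarith
    exact le_of_mul_le_mul_left h6 hαt
  have hfin := num_final hn hε hε6 hA1 hQ1 hAQ hineq hQx
  refine le_trans ?_ hfin
  rw [hL2 0 h0b]
  have hone : ∀ i, 1 ≤ 1 + (hsym 0 h0b).eigenvalues i ^ 2 :=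
    fun i => by nlinarith [sq_nonneg ((hsym 0 h0b).eigenvalues i)]
  rw [← Finset.mul_prod_erase Finset.univ _ (Finset.mem_univ i0)]
  refine le_mul_of_one_le_right (by positivity) ?_
  calc (1 : ℝ) = ∏ i ∈ Finset.univ.erase i0, (1 : ℝ) := by simp
    _ ≤ _ := Finset.prod_le_prod (fun _ _ => zero_le_one) fun i _ => hone i
end
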